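/- arXiv:2206.04036 — 5 statements merged into one kernel-verified Lean document; each statement's English description precedes it below -/
import Mathlib

section
/- The Ramsey multiplicity constant of K_4 satisfies c_4 ≤ 4551721·2^{-24}·3^{-2} (< 0.03015). Concretely: limsup_{n→∞} ( min{ k_4(G) + k_4(Ḡ) : G a simple graph on n vertices } / binomial(n,4) ) ≤ 4551721/(2^24 · 3^2). -/
open Filter Topology

/-- `kcount t G` is the number of `t`-element vertex subsets of `G` inducing a clique,
i.e. the number of copies of `K_t` in `G`. -/
noncomputable def kcount {V : Type*} (t : ℕ) (G : SimpleGraph V) : ℕ :=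
  Nat.card {s : Finset V // G.IsNClique t s}

/-- Connection set inside a `C₂⁸` coset (colour `true`) and its complement (colour `false`). -/
noncomputable def cm0 (c : Bool) : ℕ :=
  Bool.rec
    101289725364899995719983036664390202922604736950251948764642525933197264383219
    14502363872416199703587948344297704930665247715388615274815058074715865256716 c

noncomputable def cm1 (c : Bool) : ℕ :=
  Bool.rec
    21795908555827952246989464217893264176372296901792976800433392785304086180620
    93996180681488243176581520790794643676897687763847587239024191222609043459315 c

noncomputable def nbit (m i : ℕ) : ℕ := Nat.land (Nat.shiftRight m i) 1

noncomputable def blk (m v n : ℕ) : ℕ :=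
  Nat.rec 0 (fun k ih => Nat.add ih (Nat.shiftLeft (nbit m (Nat.xor v k)) (Nat.mul 10 k))) n

noncomputable def force {α : Type} (r : ℕ) (f : ℕ → α) : α :=
  Nat.rec (f 0) (fun m _ => f m) (Nat.add r 1)

noncomputable def innerC (rz : ℕ) (L : List (ℕ × ℕ)) : ℕ :=
  List.rec 0 (fun p _ ih => Nat.add
    (Bool.rec (Nat.mod (Nat.land rz p.2) 1023) 0 (Nat.beq (nbit rz p.1) 0)) ih) L

noncomputable def outerC (M L : List (ℕ × ℕ)) : ℕ :=
  List.rec 0 (fun p _ ih => Nat.add (innerC p.2 M) ih) L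

/-- place the three blocks of a row -/
noncomputable def row3 (t a b : ℕ) : ℕ :=
  Nat.add (Bool.rec b a (Nat.beq t 0))
    (Nat.add (Nat.shiftLeft (Bool.rec b a (Nat.beq t 1)) 2560)
      (Nat.shiftLeft (Bool.rec b a (Nat.beq t 2)) 5120))

noncomputable def addRow (t v m r0 a b : ℕ) (acc : List (ℕ × ℕ)) (f : List (ℕ × ℕ) → ℕ) : ℕ :=
  Bool.rec (force (Nat.mul 10 (Nat.add (Nat.mul 256 t) v)) fun k =>
      force (Nat.land r0 (row3 t a b)) fun r => f ((k, r) :: acc))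
    (f acc) (Nat.beq (nbit m v) 0)

noncomputable def run (m0 m1 r0 n : ℕ) : List (ℕ × ℕ) → ℕ :=
  Nat.rec (fun acc => outerC acc acc) (fun v ih acc =>
    force (blk m0 v 256) fun a => force (blk m1 v 256) fun b =>
      addRow 0 v m0 r0 a b acc fun acc => addRow 1 v m1 r0 a b acc fun acc =>
        addRow 2 v m1 r0 a b acc ih) n

noncomputable def total (c : Bool) : ℕ :=
  force (row3 0 (blk (cm0 c) 0 256) (blk (cm1 c) 0 256)) fun r0 =>
    run (cm0 c) (cm1 c) r0 256 []

theorem total_sum : total true + total false = 13655163 := by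
  apply Nat.eq_of_beq_eq_true
  decide +kernel

/-! ### Correctness of the evaluation -/

theorem force_eq {α : Type} (r : ℕ) (f : ℕ → α) : force r f = f r := rfl

/-- Slot encoding in base `1024` of a `0/1` valued function. -/
def enc (f : ℕ → ℕ) (n : ℕ) : ℕ := ∑ k ∈ Finset.range n, f k * 1024 ^ k

theorem enc_succ' (f : ℕ → ℕ) (n : ℕ) :
    enc f (n + 1) = f 0 + 1024 * enc (fun k => f (k + 1)) n := by
  unfold enc
  rw [Finset.sum_range_succ', Finset.mul_sum, add_comm]
  congr 1
  · simp
  · exact Finset.sum_congr rfl fun k _ => by ring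

theorem enc_add (f : ℕ → ℕ) (a b : ℕ) :
    enc f (a + b) = enc f a + enc (fun k => f (a + k)) b * 1024 ^ a := by
  unfold enc
  rw [Finset.sum_range_add, Finset.sum_mul]
  congr 1
  exact Finset.sum_congr rfl fun k _ => by ring

theorem nbit_eq (m i : ℕ) : nbit m i = m / 2 ^ i % 2 := by
  have h : nbit m i = (m >>> i) &&& 1 := rfl
  rw [h, Nat.and_one_is_mod, Nat.shiftRight_eq_div_pow]

theorem nbit_le (m i : ℕ) : nbit m i ≤ 1 := by
  rw [nbit_eq]; omega

theorem nbit_enc (f : ℕ → ℕ) (hf : ∀ k, f k ≤ 1) (n x : ℕ) (hx : x < n) :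
    nbit (enc f n) (10 * x) = f x := by
  rw [nbit_eq]
  induction x generalizing f n with
  | zero =>
    obtain ⟨n, rfl⟩ : ∃ m, n = m + 1 := ⟨n - 1, by omega⟩
    rw [enc_succ']
    have := hf 0
    simp
    omega
  | succ x ih =>
    obtain ⟨n, rfl⟩ : ∃ m, n = m + 1 := ⟨n - 1, by omega⟩
    rw [enc_succ']
    have h0 := hf 0
    have e : 2 ^ (10 * (x + 1)) = 1024 * 2 ^ (10 * x) := by
      rw [mul_add, pow_add]; norm_num [mul_comm]
    rw [e, ← Nat.div_div_eq_div_mul]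
    have e2 : (f 0 + 1024 * enc (fun k => f (k + 1)) n) / 1024 = enc (fun k => f (k + 1)) n := by
      omega
    rw [e2]
    exact ih (fun k => f (k + 1)) (fun k => hf _) n (by omega)

theorem land_enc (f g : ℕ → ℕ) (hf : ∀ k, f k ≤ 1) (hg : ∀ k, g k ≤ 1) (n : ℕ) :
    Nat.land (enc f n) (enc g n) = enc (fun k => f k * g k) n := by
  change (enc f n) &&& (enc g n) = _
  induction n generalizing f g with
  | zero => simp [enc]
  | succ n ih =>
    rw [enc_succ', enc_succ', enc_succ',
      ← ih (fun k => f (k + 1)) (fun k => g (k + 1)) (fun k => hf _) (fun k => hg _)]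
    generalize enc (fun k => f (k + 1)) n = A
    generalize enc (fun k => g (k + 1)) n = B
    have h1 := @Nat.and_mod_two_pow (f 0 + 1024 * A) (g 0 + 1024 * B) 10
    have h2 := @Nat.and_div_two_pow (f 0 + 1024 * A) (g 0 + 1024 * B) 10
    have hf0 := hf 0
    have hg0 := hg 0
    have a1 : (f 0 + 1024 * A) % 2 ^ 10 = f 0 := by norm_num; omega
    have a2 : (g 0 + 1024 * B) % 2 ^ 10 = g 0 := by norm_num; omega
    have a3 : (f 0 + 1024 * A) / 2 ^ 10 = A := by norm_num; omega
    have a4 : (g 0 + 1024 * B) / 2 ^ 10 = B := by norm_num; omega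
    rw [a1, a2] at h1
    rw [a3, a4] at h2
    have h3 : f 0 &&& g 0 = f 0 * g 0 := by
      generalize f 0 = a at *
      generalize g 0 = b at *
      interval_cases a <;> interval_cases b <;> rfl
    rw [← Nat.div_add_mod ((f 0 + 1024 * A) &&& (g 0 + 1024 * B)) (2 ^ 10), h1, h2, h3]
    norm_num
    omega

theorem mod_enc (f : ℕ → ℕ) (hf : ∀ k, f k ≤ 1) (n : ℕ) (hn : n < 1023) :
    Nat.mod (enc f n) 1023 = ∑ k ∈ Finset.range n, f k := by
  change enc f n % 1023 = _
  have h1 : enc f n ≡ ∑ k ∈ Finset.range n, f k [MOD 1023] := by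
    unfold enc
    induction n with
    | zero => rfl
    | succ n ih =>
      rw [Finset.sum_range_succ, Finset.sum_range_succ]
      refine Nat.ModEq.add (ih (by omega)) ?_
      have : 1024 ^ n ≡ 1 ^ n [MOD 1023] := Nat.ModEq.pow n rfl
      simpa using this.mul_left (f n)
  have h2 : ∑ k ∈ Finset.range n, f k ≤ n := by
    calc _ ≤ ∑ k ∈ Finset.range n, 1 := Finset.sum_le_sum fun k _ => hf k
      _ = n := by simp
  exact Nat.mod_eq_of_modEq h1 (by omega)

theorem blk_eq (m v n : ℕ) : blk m v n = enc (fun k => nbit m (v ^^^ k)) n := by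
  induction n with
  | zero => rfl
  | succ n ih =>
    have h : blk m v (n + 1) = blk m v n + (nbit m (v ^^^ n)) <<< (10 * n) := rfl
    rw [h, ih, enc, enc, Finset.sum_range_succ, Nat.shiftLeft_eq, pow_mul]
    norm_num

/-- The `0/1` adjacency function on indices. -/
noncomputable def adjN (c : Bool) (i j : ℕ) : ℕ :=
  nbit (if i / 256 = j / 256 then cm0 c else cm1 c) ((i % 256) ^^^ (j % 256))

theorem adjN_le (c : Bool) (i j : ℕ) : adjN c i j ≤ 1 := nbit_le _ _

theorem adjN_block (c : Bool) (t v s k : ℕ) (hv : v < 256) (hk : k < 256) :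
    adjN c (256 * t + v) (256 * s + k) = nbit (if t = s then cm0 c else cm1 c) (v ^^^ k) := by
  unfold adjN
  rw [show (256 * t + v) / 256 = t by omega, show (256 * s + k) / 256 = s by omega,
    show (256 * t + v) % 256 = v by omega, show (256 * s + k) % 256 = k by omega]

theorem enc_block (c : Bool) (t v s : ℕ) (hv : v < 256) :
    enc (fun k => adjN c (256 * t + v) (256 * s + k)) 256 =
      blk (if t = s then cm0 c else cm1 c) v 256 := by
  rw [blk_eq]
  unfold enc
  refine Finset.sum_congr rfl fun k hk => ?_
  exact congrArg (· * 1024 ^ k) (adjN_block c t v s k hv (Finset.mem_range.1 hk))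

theorem row3_eq (c : Bool) (t v : ℕ) (ht : t < 3) (hv : v < 256) :
    row3 t (blk (cm0 c) v 256) (blk (cm1 c) v 256) = enc (adjN c (256 * t + v)) 768 := by
  have h0 := enc_block c t v 0 hv
  have h1 := enc_block c t v 1 hv
  have h2 := enc_block c t v 2 hv
  rw [show (768 : ℕ) = 256 + (256 + 256) by norm_num, enc_add, enc_add]
  have e2 : (fun k => adjN c (256 * t + v) (256 + (256 + k)))
      = fun k => adjN c (256 * t + v) (256 * 2 + k) := by
    funext k; exact congrArg (adjN c (256 * t + v)) (by omega)
  have e0 : adjN c (256 * t + v) = fun k => adjN c (256 * t + v) (256 * 0 + k) := by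
    funext k; exact congrArg (adjN c (256 * t + v)) (by omega)
  rw [e2, h2]
  simp only [mul_one] at h1
  rw [h1]
  conv_rhs => rw [e0]
  rw [h0]
  have d : ∀ t a b : ℕ, row3 t a b = (Bool.rec b a (Nat.beq t 0)) +
    ((Bool.rec b a (Nat.beq t 1) : ℕ) <<< 2560 + (Bool.rec b a (Nat.beq t 2) : ℕ) <<< 5120) :=
    fun _ _ _ => rfl
  rw [d, Nat.shiftLeft_eq, Nat.shiftLeft_eq, add_mul, mul_assoc, ← pow_add]
  have p1 : (1024 : ℕ) ^ 256 = 2 ^ 2560 := by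
    rw [show (1024 : ℕ) = 2 ^ 10 by norm_num, ← pow_mul]
  have p2 : (1024 : ℕ) ^ (256 + 256) = 2 ^ 5120 := by
    rw [show (1024 : ℕ) = 2 ^ 10 by norm_num, ← pow_mul]
  rw [p1, p2]
  generalize 2 ^ 2560 = X
  generalize 2 ^ 5120 = Y
  clear h0 h1 h2 e0 e2
  rw [apply_ite (fun m => blk m v 256), apply_ite (fun m => blk m v 256),
    apply_ite (fun m => blk m v 256)]
  generalize blk (cm0 c) v 256 = A
  generalize blk (cm1 c) v 256 = B
  interval_cases t <;> rfl

/-- the masked row -/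
noncomputable def rowM (c : Bool) (i : ℕ) : ℕ := enc (fun y => adjN c 0 y * adjN c i y) 768

theorem land_row (c : Bool) (i : ℕ) :
    Nat.land (enc (adjN c 0) 768) (enc (adjN c i) 768) = rowM c i :=
  land_enc _ _ (adjN_le c 0) (adjN_le c i) _

theorem innerC_eq (rz : ℕ) (L : List (ℕ × ℕ)) :
    innerC rz L = (L.map fun p => nbit rz p.1 * Nat.mod (Nat.land rz p.2) 1023).sum := by
  induction L with
  | nil => rfl
  | cons p L ih =>
    have h : innerC rz (p :: L) = (Bool.rec (Nat.mod (Nat.land rz p.2) 1023) 0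
      (Nat.beq (nbit rz p.1) 0) : ℕ) + innerC rz L := rfl
    rw [h, ih, List.map_cons, List.sum_cons]
    congr 1
    have hb := nbit_le rz p.1
    generalize nbit rz p.1 = b at *
    generalize Nat.mod (Nat.land rz p.2) 1023 = X
    interval_cases b
    · exact (Nat.zero_mul X).symm
    · exact (Nat.one_mul X).symm

theorem outerC_eq (M L : List (ℕ × ℕ)) :
    outerC M L = (L.map fun p => innerC p.2 M).sum := by
  induction L with
  | nil => rfl
  | cons p L ih =>
    rw [List.map_cons, List.sum_cons, ← ih]; rfl

/-- the list entries contributed by the index `i` -/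
noncomputable def entry (c : Bool) (i : ℕ) (g : ℕ × ℕ → ℕ) : ℕ :=
  adjN c 0 i * g (10 * i, rowM c i)

theorem addRow_eq (c : Bool) (t v : ℕ) (ht : t < 3) (hv : v < 256) (acc : List (ℕ × ℕ)) :
    ∃ acc' : List (ℕ × ℕ), (∀ g : ℕ × ℕ → ℕ, (acc'.map g).sum =
        (acc.map g).sum + entry c (256 * t + v) g) ∧
      ∀ f, addRow t v (if 0 = t then cm0 c else cm1 c) (enc (adjN c 0) 768)
        (blk (cm0 c) v 256) (blk (cm1 c) v 256) acc f = f acc' := by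
  have hd : ∀ m r0 a b f, addRow t v m r0 a b acc f =
      (Bool.rec (f ((10 * (256 * t + v), Nat.land r0 (row3 t a b)) :: acc)) (f acc)
        (Nat.beq (nbit m v) 0) : ℕ) := fun m r0 a b f => by
    unfold addRow
    rw [force_eq, force_eq]
    rfl
  have h0 : nbit (if 0 = t then cm0 c else cm1 c) v = adjN c 0 (256 * t + v) := by
    have := adjN_block c 0 0 t v (by norm_num) hv
    simpa using this.symm
  have hb := adjN_le c 0 (256 * t + v)
  simp only [hd, h0, row3_eq c t v ht hv, land_row]
  unfold entry
  generalize adjN c 0 (256 * t + v) = b at *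
  interval_cases b
  · exact ⟨acc, fun g => by simp, fun f => rfl⟩
  · exact ⟨(10 * (256 * t + v), rowM c (256 * t + v)) :: acc,
      fun g => by simp [add_comm], fun f => rfl⟩

theorem run_eq (c : Bool) (n : ℕ) (hn : n ≤ 256) (acc : List (ℕ × ℕ)) :
    ∃ L : List (ℕ × ℕ), (∀ g : ℕ × ℕ → ℕ, (L.map g).sum =
        (acc.map g).sum + ∑ v ∈ Finset.range n, (entry c (256 * 0 + v) g
          + entry c (256 * 1 + v) g + entry c (256 * 2 + v) g)) ∧
      run (cm0 c) (cm1 c) (enc (adjN c 0) 768) n acc = outerC L L := by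
  induction n generalizing acc with
  | zero => exact ⟨acc, fun g => by simp, rfl⟩
  | succ v ih =>
    have hv : v < 256 := by omega
    obtain ⟨a0, h0, f0⟩ := addRow_eq c 0 v (by norm_num) hv acc
    obtain ⟨a1, h1, f1⟩ := addRow_eq c 1 v (by norm_num) hv a0
    obtain ⟨a2, h2, f2⟩ := addRow_eq c 2 v (by norm_num) hv a1
    obtain ⟨L, hL, e⟩ := ih (by omega) a2
    refine ⟨L, fun g => ?_, ?_⟩
    · rw [hL, h2, h1, h0, Finset.sum_range_succ]; ring
    · rw [← e]
      have hr : ∀ m0 m1 r0, run m0 m1 r0 (v + 1) acc =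
        addRow 0 v m0 r0 (blk m0 v 256) (blk m1 v 256) acc fun acc =>
          addRow 1 v m1 r0 (blk m0 v 256) (blk m1 v 256) acc fun acc =>
            addRow 2 v m1 r0 (blk m0 v 256) (blk m1 v 256) acc (run m0 m1 r0 v) := by
        intro m0 m1 r0
        have h : run m0 m1 r0 (v + 1) acc = force (blk m0 v 256) fun a =>
          force (blk m1 v 256) fun b => addRow 0 v m0 r0 a b acc fun acc =>
            addRow 1 v m1 r0 a b acc fun acc => addRow 2 v m1 r0 a b acc (run m0 m1 r0 v) := rfl
        rw [h, force_eq, force_eq]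
      simp only [if_true, zero_ne_one, if_false, show ¬ (0 = 2) by norm_num] at f0 f1 f2
      rw [hr, f0, f1, f2]

theorem sum_768 (F : ℕ → ℕ) : ∑ v ∈ Finset.range 256, (F (256 * 0 + v) + F (256 * 1 + v)
    + F (256 * 2 + v)) = ∑ i ∈ Finset.range 768, F i := by
  rw [show (768 : ℕ) = 256 + 256 + 256 by norm_num, Finset.sum_range_add, Finset.sum_range_add,
    Finset.sum_add_distrib, Finset.sum_add_distrib]
  simp

theorem total_eq (c : Bool) : total c = ∑ z ∈ Finset.range 768, ∑ x ∈ Finset.range 768,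
    ∑ y ∈ Finset.range 768, adjN c 0 z * (adjN c 0 x * adjN c z x *
      (adjN c 0 y * adjN c z y * adjN c x y)) := by
  unfold total
  rw [force_eq, row3_eq c 0 0 (by norm_num) (by norm_num)]
  obtain ⟨L, hL, e⟩ := run_eq c 256 le_rfl []
  have hL' : ∀ g : ℕ × ℕ → ℕ, (L.map g).sum = ∑ i ∈ Finset.range 768, entry c i g := by
    intro g
    rw [hL, sum_768 fun i => entry c i g]; simp
  rw [show 256 * 0 + 0 = 0 by norm_num, e, outerC_eq, hL']
  refine Finset.sum_congr rfl fun z hz => ?_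
  unfold entry
  simp only
  rw [innerC_eq, hL', Finset.mul_sum]
  refine Finset.sum_congr rfl fun x hx => ?_
  rw [← Finset.mul_sum]
  refine congrArg (fun w => adjN c 0 z * w) ?_
  unfold entry
  simp only
  have hz1 : ∀ k, adjN c 0 k * adjN c z k ≤ 1 := fun k =>
    le_trans (Nat.mul_le_mul (adjN_le _ _ _) (adjN_le _ _ _)) le_rfl
  have hx1 : ∀ k, adjN c 0 k * adjN c x k ≤ 1 := fun k =>
    le_trans (Nat.mul_le_mul (adjN_le _ _ _) (adjN_le _ _ _)) le_rfl
  rw [rowM, nbit_enc _ hz1 768 x (Finset.mem_range.1 hx), rowM, land_enc _ _ hz1 hx1,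
    mod_enc _ (fun k => le_trans (Nat.mul_le_mul (hz1 k) (hx1 k)) le_rfl) 768 (by norm_num),
    ← Finset.mul_sum]
  have key : ∑ k ∈ Finset.range 768, adjN c 0 k * adjN c z k * (adjN c 0 k * adjN c x k) =
      ∑ y ∈ Finset.range 768, adjN c 0 y * adjN c z y * adjN c x y := by
    refine Finset.sum_congr rfl fun k _ => ?_
    have := adjN_le c 0 k
    generalize adjN c 0 k = b at *
    interval_cases b <;> ring
  rw [key]
  have := adjN_le c 0 x
  generalize adjN c 0 x = b at *
  interval_cases b <;> ring

/-! ### The Cayley graph on `C₃ × C₂⁸` -/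

theorem xor_lt_256 {a b : ℕ} (ha : a < 256) (hb : b < 256) : a ^^^ b < 256 :=
  Nat.xor_lt_two_pow (n := 8) ha hb

/-- adjacency on the product type -/
noncomputable def adjV (c : Bool) (x y : Fin 3 × Fin 256) : ℕ :=
  nbit (if x.1 = y.1 then cm0 c else cm1 c) (x.2.val ^^^ y.2.val)

theorem adjV_eq (c : Bool) (x y : Fin 3 × Fin 256) :
    adjV c x y = adjN c (256 * x.1.val + x.2.val) (256 * y.1.val + y.2.val) := by
  rw [adjN_block c _ _ _ _ x.2.isLt y.2.isLt, adjV]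
  simp only [Fin.ext_iff]

theorem adjV_symm (c : Bool) (x y : Fin 3 × Fin 256) : adjV c x y = adjV c y x := by
  unfold adjV
  rw [Nat.xor_comm]
  simp only [eq_comm]

theorem adjV_le (c : Bool) (x y : Fin 3 × Fin 256) : adjV c x y ≤ 1 := nbit_le _ _

theorem masks_compl : ∀ i : Fin 256, nbit (cm0 true) i.val + nbit (cm0 false) i.val = 1 ∧
    nbit (cm1 true) i.val + nbit (cm1 false) i.val = 1 := by
  decide +kernel

theorem adjV_compl (x y : Fin 3 × Fin 256) : adjV true x y + adjV false x y = 1 := by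
  have h := masks_compl ⟨x.2.val ^^^ y.2.val, xor_lt_256 x.2.isLt y.2.isLt⟩
  unfold adjV
  split
  · exact h.1
  · exact h.2

/-- xor translation on `Fin 256` -/
def xorPerm (a : Fin 256) : Fin 256 ≃ Fin 256 where
  toFun b := ⟨b.val ^^^ a.val, xor_lt_256 b.isLt a.isLt⟩
  invFun b := ⟨b.val ^^^ a.val, xor_lt_256 b.isLt a.isLt⟩
  left_inv b := by ext; simp
  right_inv b := by ext; simp

/-- translation by `x` -/
def shiftV (x : Fin 3 × Fin 256) : Fin 3 × Fin 256 ≃ Fin 3 × Fin 256 :=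
  (Equiv.addRight x.1).prodCongr (xorPerm x.2)

theorem trans_zero (x : Fin 3 × Fin 256) : shiftV x (0, 0) = x := by
  ext <;> simp [shiftV, xorPerm]

theorem adjV_trans (c : Bool) (x y z : Fin 3 × Fin 256) :
    adjV c (shiftV x y) (shiftV x z) = adjV c y z := by
  unfold adjV
  have h1 : (shiftV x y).1 = (shiftV x z).1 ↔ y.1 = z.1 := by
    simp [shiftV]
  have h2 : (shiftV x y).2.val ^^^ (shiftV x z).2.val = y.2.val ^^^ z.2.val := by
    change (y.2.val ^^^ x.2.val) ^^^ (z.2.val ^^^ x.2.val) = _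
    rw [Nat.xor_comm z.2.val, ← Nat.xor_assoc, Nat.xor_assoc y.2.val]
    simp
  rw [h2]
  simp only [h1]

/-- indicator of a monochromatic quadruple -/
noncomputable def quad {V : Type*} (R : V → V → ℕ) (w z x y : V) : ℕ :=
  R w z * (R w x * R z x * (R w y * R z y * R x y))

theorem sum_V (F : ℕ → ℕ) : ∑ x : Fin 3 × Fin 256, F (256 * x.1.val + x.2.val) =
    ∑ i ∈ Finset.range 768, F i := by
  rw [Fintype.sum_prod_type, ← sum_768, Fin.sum_univ_three, Finset.sum_add_distrib,
    Finset.sum_add_distrib]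
  simp only [Finset.sum_range]
  rfl

theorem sum_quad_zero (c : Bool) : ∑ z, ∑ x, ∑ y, quad (adjV c) (0, 0) z x y = total c := by
  rw [total_eq, ← sum_V]
  refine Finset.sum_congr rfl fun z _ => ?_
  rw [← sum_V]
  refine Finset.sum_congr rfl fun x _ => ?_
  rw [← sum_V]
  refine Finset.sum_congr rfl fun y _ => ?_
  simp only [quad, adjV_eq, Fin.val_zero, mul_zero, add_zero]

theorem sum_quad (c : Bool) : ∑ w, ∑ z, ∑ x, ∑ y, quad (adjV c) w z x y = 768 * total c := by
  have h : ∀ w, ∑ z, ∑ x, ∑ y, quad (adjV c) w z x y = total c := by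
    intro w
    rw [← sum_quad_zero, ← (shiftV w).sum_comp]
    refine Finset.sum_congr rfl fun z _ => ?_
    rw [← (shiftV w).sum_comp]
    refine Finset.sum_congr rfl fun x _ => ?_
    rw [← (shiftV w).sum_comp]
    refine Finset.sum_congr rfl fun y _ => ?_
    have hw := adjV_trans c w (0, 0)
    rw [trans_zero] at hw
    simp only [quad, adjV_trans, hw]
  simp [h]

/-! ### Blow-ups -/

/-- colouring of the vertices by the Cayley graph -/
def col {n : ℕ} (i : Fin n) : Fin 3 × Fin 256 :=
  (finProdFinEquiv (m := 3) (n := 256)).symm ⟨i.val % 768, Nat.mod_lt _ (by norm_num)⟩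

theorem fiber_le (n : ℕ) (x : Fin 3 × Fin 256) :
    (Finset.univ.filter fun i : Fin n => col i = x).card ≤ n / 768 + 1 := by
  rw [← Finset.card_range (n / 768 + 1)]
  refine Finset.card_le_card_of_injOn (fun i => i.val / 768) ?_ ?_
  · intro i _
    have := i.isLt
    simp only [Finset.coe_range, Set.mem_Iio]
    exact Nat.lt_succ_of_le (Nat.div_le_div_right this.le)
  · intro i hi j hj hij
    simp only [Finset.coe_filter, Finset.mem_univ, true_and, Set.mem_ofPred_eq] at hi hj hij
    have h : col i = col j := hi.trans hj.symm
    have h' := congrArg Fin.val ((finProdFinEquiv (m := 3) (n := 256)).symm.injective h)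
    simp only at h'
    ext
    omega

theorem sum_col_le (n : ℕ) (g : Fin 3 × Fin 256 → ℕ) :
    ∑ i : Fin n, g (col i) ≤ (n / 768 + 1) * ∑ x, g x := by
  rw [← Finset.sum_fiberwise Finset.univ (fun i : Fin n => col i), Finset.mul_sum]
  refine Finset.sum_le_sum fun x _ => ?_
  rw [Finset.sum_congr rfl (g := fun _ => g x)
    (fun i hi => by rw [(Finset.mem_filter.1 hi).2]), Finset.sum_const, smul_eq_mul]
  exact Nat.mul_le_mul_right _ (fiber_le n x)

theorem sum_quad_col_le (n : ℕ) (R : Fin 3 × Fin 256 → Fin 3 × Fin 256 → ℕ) :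
    ∑ w : Fin n, ∑ z : Fin n, ∑ x : Fin n, ∑ y : Fin n,
      quad R (col w) (col z) (col x) (col y) ≤
    (n / 768 + 1) ^ 4 * ∑ w, ∑ z, ∑ x, ∑ y, quad R w z x y := by
  set q := n / 768 + 1
  have h1 : ∀ w z x, ∑ y : Fin n, quad R w z x (col y) ≤ q * ∑ y, quad R w z x y :=
    fun w z x => sum_col_le n fun y => quad R w z x y
  have h2 : ∀ w z, ∑ x : Fin n, ∑ y : Fin n, quad R w z (col x) (col y) ≤
      q ^ 2 * ∑ x, ∑ y, quad R w z x y := fun w z =>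
    calc _ ≤ ∑ x : Fin n, q * ∑ y, quad R w z (col x) y :=
          Finset.sum_le_sum fun x _ => h1 w z (col x)
      _ ≤ q * ∑ x, q * ∑ y, quad R w z x y := sum_col_le n fun x => q * ∑ y, quad R w z x y
      _ = _ := by rw [← Finset.mul_sum]; ring
  have h3 : ∀ w, ∑ z : Fin n, ∑ x : Fin n, ∑ y : Fin n, quad R w (col z) (col x) (col y) ≤
      q ^ 3 * ∑ z, ∑ x, ∑ y, quad R w z x y := fun w =>
    calc _ ≤ ∑ z : Fin n, q ^ 2 * ∑ x, ∑ y, quad R w (col z) x y :=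
          Finset.sum_le_sum fun z _ => h2 w (col z)
      _ ≤ q * ∑ z, q ^ 2 * ∑ x, ∑ y, quad R w z x y :=
          sum_col_le n fun z => q ^ 2 * ∑ x, ∑ y, quad R w z x y
      _ = _ := by rw [← Finset.mul_sum]; ring
  calc _ ≤ ∑ w : Fin n, q ^ 3 * ∑ z, ∑ x, ∑ y, quad R (col w) z x y :=
          Finset.sum_le_sum fun w _ => h3 (col w)
      _ ≤ q * ∑ w, q ^ 3 * ∑ z, ∑ x, ∑ y, quad R w z x y :=
          sum_col_le n fun w => q ^ 3 * ∑ z, ∑ x, ∑ y, quad R w z x y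
      _ = _ := by rw [← Finset.mul_sum]; ring

theorem kcount_le (n : ℕ) (H : SimpleGraph (Fin n)) (R : Fin n → Fin n → ℕ)
    (hR : ∀ i j, H.Adj i j → R i j = 1) :
    24 * kcount 4 H ≤ ∑ w, ∑ z, ∑ x, ∑ y, quad R w z x y := by
  classical
  let Q : Finset (Fin n × Fin n × Fin n × Fin n) :=
    Finset.univ.filter fun p => quad R p.1 p.2.1 p.2.2.1 p.2.2.2 = 1
  have hQ : Q.card ≤ ∑ w, ∑ z, ∑ x, ∑ y, quad R w z x y := by
    rw [Finset.card_filter]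
    simp only [Fintype.sum_prod_type]
    refine Finset.sum_le_sum fun w _ => Finset.sum_le_sum fun z _ => Finset.sum_le_sum fun x _ =>
      Finset.sum_le_sum fun y _ => ?_
    split
    · omega
    · exact Nat.zero_le _
  refine le_trans ?_ hQ
  have hc : Nat.card ({s : Finset (Fin n) // H.IsNClique 4 s} × Equiv.Perm (Fin 4)) =
      24 * kcount 4 H := by
    rw [Nat.card_prod, kcount, mul_comm]
    congr 1
    rw [Nat.card_eq_fintype_card, Fintype.card_perm]
    rfl
  have hQc : Nat.card Q = Q.card := by simp
  rw [← hc, ← hQc]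
  have adj : ∀ (p : {s : Finset (Fin n) // H.IsNClique 4 s} × Equiv.Perm (Fin 4)) (a b : Fin 4),
      a ≠ b → R (p.1.1.orderEmbOfFin p.1.2.card_eq (p.2 a))
        (p.1.1.orderEmbOfFin p.1.2.card_eq (p.2 b)) = 1 := by
    intro p a b hab
    refine hR _ _ (p.1.2.isClique ?_ ?_ ?_)
    · exact Finset.orderEmbOfFin_mem _ _ _
    · exact Finset.orderEmbOfFin_mem _ _ _
    · intro h
      exact hab (p.2.injective ((p.1.1.orderEmbOfFin p.1.2.card_eq).injective h))
  let e : {s : Finset (Fin n) // H.IsNClique 4 s} × Equiv.Perm (Fin 4) → Q := fun p =>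
    ⟨(p.1.1.orderEmbOfFin p.1.2.card_eq (p.2 0), p.1.1.orderEmbOfFin p.1.2.card_eq (p.2 1),
      p.1.1.orderEmbOfFin p.1.2.card_eq (p.2 2), p.1.1.orderEmbOfFin p.1.2.card_eq (p.2 3)), by
      refine Finset.mem_filter.2 ⟨Finset.mem_univ _, ?_⟩
      simp only [quad]
      rw [adj p 0 1 (by decide), adj p 0 2 (by decide), adj p 0 3 (by decide),
        adj p 1 2 (by decide), adj p 1 3 (by decide), adj p 2 3 (by decide)]⟩
  refine Nat.card_le_card_of_injective e ?_
  rintro ⟨⟨s, hs⟩, σ⟩ ⟨⟨s', hs'⟩, τ⟩ h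
  have h' := congrArg Subtype.val h
  simp only [e, Prod.mk.injEq] at h'
  have hall : ∀ a : Fin 4, s.orderEmbOfFin hs.card_eq (σ a) =
      s'.orderEmbOfFin hs'.card_eq (τ a) := by
    intro a
    fin_cases a
    · exact h'.1
    · exact h'.2.1
    · exact h'.2.2.1
    · exact h'.2.2.2
  have hss : s = s' := by
    have r1 := Finset.range_orderEmbOfFin s hs.card_eq
    have r2 := Finset.range_orderEmbOfFin s' hs'.card_eq
    rw [← Finset.coe_inj, ← r1, ← r2, ← σ.surjective.range_comp (s.orderEmbOfFin hs.card_eq),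
      ← τ.surjective.range_comp (s'.orderEmbOfFin hs'.card_eq)]
    congr 1
    funext a
    exact hall a
  subst hss
  have : σ = τ := by
    ext a
    exact congrArg Fin.val ((s.orderEmbOfFin hs.card_eq).injective (hall a))
  rw [this]

/-- The blow-up graph. -/
def blowup (n : ℕ) : SimpleGraph (Fin n) where
  Adj i j := i ≠ j ∧ adjV true (col i) (col j) = 1
  symm := ⟨fun i j h => ⟨h.1.symm, by rw [adjV_symm]; exact h.2⟩⟩
  loopless := ⟨fun i h => h.1 rfl⟩

theorem blowup_count (n : ℕ) : 24 * (kcount 4 (blowup n) + kcount 4 (blowup n)ᶜ) ≤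
    (n / 768 + 1) ^ 4 * (768 * 13655163) := by
  have h1 := kcount_le n (blowup n) (fun i j => adjV true (col i) (col j)) fun i j h => h.2
  have h2 := kcount_le n (blowup n)ᶜ (fun i j => adjV false (col i) (col j)) fun i j h => by
    rw [SimpleGraph.compl_adj] at h
    have h3 : ¬ (adjV true (col i) (col j) = 1) := fun h4 => h.2 ⟨h.1, h4⟩
    have h5 := adjV_compl (col i) (col j)
    have h6 := adjV_le true (col i) (col j)
    omega
  have h3 := h1.trans (sum_quad_col_le n (adjV true))
  have h4 := h2.trans (sum_quad_col_le n (adjV false))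
  rw [sum_quad] at h3 h4
  rw [← total_sum, mul_add, mul_add, mul_add]
  exact Nat.add_le_add h3 h4

theorem ratio_le (n : ℕ) (hn : 4 ≤ n) :
    sInf {x : ℝ | ∃ G : SimpleGraph (Fin n),
      x = (kcount 4 G : ℝ) + (kcount 4 Gᶜ : ℝ)} / (n.choose 4 : ℝ) ≤
    4551721 / (2 ^ 24 * 3 ^ 2) * (1 + 771 / ((n : ℝ) - 3)) ^ 4 := by
  have hn' : (4 : ℝ) ≤ n := by exact_mod_cast hn
  have hpos : (0 : ℝ) < (n : ℝ) - 3 := by linarith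
  have h1 : sInf {x : ℝ | ∃ G : SimpleGraph (Fin n),
      x = (kcount 4 G : ℝ) + (kcount 4 Gᶜ : ℝ)} ≤
      (kcount 4 (blowup n) : ℝ) + (kcount 4 (blowup n)ᶜ : ℝ) := by
    refine csInf_le ⟨0, ?_⟩ ⟨blowup n, rfl⟩
    rintro x ⟨G, rfl⟩
    positivity
  have h2 : 24 * ((kcount 4 (blowup n) : ℝ) + (kcount 4 (blowup n)ᶜ : ℝ)) ≤
      ((n / 768 : ℕ) + 1 : ℝ) ^ 4 * (768 * 13655163) := by
    exact_mod_cast blowup_count n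
  have h3 : ((n / 768 : ℕ) : ℝ) ≤ (n : ℝ) / 768 := by
    have := @Nat.cast_div_le ℝ _ _ _ n 768
    exact_mod_cast this
  have h4 : ((n / 768 : ℕ) + 1 : ℝ) ^ 4 ≤ ((n : ℝ) / 768 + 1) ^ 4 := by gcongr
  have h5 : ((n : ℝ) - 3) ^ 4 ≤ 24 * (n.choose 4 : ℝ) := by
    have h := Nat.pow_sub_le_descFactorial n 4
    rw [Nat.descFactorial_eq_factorial_mul_choose] at h
    have h' : (n - 3) ^ 4 ≤ 24 * n.choose 4 := by
      have e : n + 1 - 4 = n - 3 := by omega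
      rw [e] at h
      exact h
    have h6 : (((n - 3 : ℕ) : ℝ)) ^ 4 ≤ 24 * (n.choose 4 : ℝ) := by exact_mod_cast h'
    rw [Nat.cast_sub (by omega)] at h6
    exact_mod_cast h6
  have hc : (0 : ℝ) < n.choose 4 := by
    exact_mod_cast Nat.choose_pos hn
  rw [div_le_iff₀ hc]
  have e1 : 1 + 771 / ((n : ℝ) - 3) = ((n : ℝ) + 768) / ((n : ℝ) - 3) := by
    field_simp; ring
  rw [e1, div_pow]
  have h7 : (1 : ℝ) ≤ 24 * (n.choose 4 : ℝ) / ((n : ℝ) - 3) ^ 4 := by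
    rw [le_div_iff₀ (by positivity)]; linarith
  have h8 : (0 : ℝ) ≤ ((n : ℝ) + 768) ^ 4 := by positivity
  calc _ ≤ ((n : ℝ) / 768 + 1) ^ 4 * (768 * 13655163) / 24 := by linarith
    _ = 4551721 / (2 ^ 24 * 3 ^ 2) * ((n : ℝ) + 768) ^ 4 / 24 * 1 := by ring
    _ ≤ 4551721 / (2 ^ 24 * 3 ^ 2) * ((n : ℝ) + 768) ^ 4 / 24 *
        (24 * (n.choose 4 : ℝ) / ((n : ℝ) - 3) ^ 4) := by gcongr
    _ = _ := by field_simp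

theorem bound_tendsto : Tendsto (fun n : ℕ =>
    (4551721 / (2 ^ 24 * 3 ^ 2) * (1 + 771 / ((n : ℝ) - 3)) ^ 4 : ℝ)) atTop
    (𝓝 (4551721 / (2 ^ 24 * 3 ^ 2))) := by
  have h0 : Tendsto (fun n : ℕ => (n : ℝ) - 3) atTop atTop :=
    tendsto_atTop_add_const_right _ _ tendsto_natCast_atTop_atTop
  have h1 : Tendsto (fun n : ℕ => 771 / ((n : ℝ) - 3)) atTop (𝓝 0) := h0.const_div_atTop 771
  have h2 := ((h1.const_add 1).pow 4).const_mul (4551721 / (2 ^ 24 * 3 ^ 2) : ℝ)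
  simpa using h2

/-- The Ramsey multiplicity constant of `K₄` satisfies
`c₄ ≤ 4551721 · 2⁻²⁴ · 3⁻²`. -/
theorem c4_upper_bound :
    Filter.limsup (fun n : ℕ =>
        sInf {x : ℝ | ∃ G : SimpleGraph (Fin n),
            x = (kcount 4 G : ℝ) + (kcount 4 Gᶜ : ℝ)} / (n.choose 4 : ℝ))
      Filter.atTop ≤ 4551721 / (2 ^ 24 * 3 ^ 2) := by
  rw [← bound_tendsto.limsup_eq]
  refine Filter.limsup_le_limsup ?_ ?_ ?_
  · filter_upwards [Filter.eventually_ge_atTop 4] with n hn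
    exact ratio_le n hn
  · refine Filter.IsCoboundedUnder.of_frequently_ge (a := 0) (Filter.Frequently.of_forall ?_)
    intro n
    refine div_nonneg (Real.sInf_nonneg ?_) (Nat.cast_nonneg _)
    rintro x ⟨G, rfl⟩
    positivity
  · exact bound_tendsto.isBoundedUnder_le
end

section
/- The Ramsey multiplicity constant of K_5 satisfies c_5 ≤ 2320651·2^{-24}·3^{-4} (< 0.001708). Concretely: limsup_{n→∞} ( min{ k_5(G) + k_5(Ḡ) : G a simple graph on n vertices } / binomial(n,5) ) ≤ 2320651/(2^24 · 3^4). -/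
open Filter Topology

namespace C5

def sumTo (n : ℕ) (f : ℕ → ℕ) : ℕ := Nat.rec 0 (fun k ih => Nat.add ih (f k)) n
def tbl : ℕ := 232842397385424298302139062864136902541475931758206658891930387264239311852315376086045620003585740808432887499564367663766931038102968071722571015876072143167807776774749710
def bit (x y : ℕ) : ℕ :=
  Nat.land (Nat.shiftRight tbl (Nat.add (Nat.mul 64 (Nat.add (Nat.mul 3 (Nat.div x 64)) (Nat.div y 64)))
    (Nat.mod (Nat.xor x y) 64))) 1
def col (c x y : ℕ) : Bool := Nat.beq (bit x y) c
def pos (P k : ℕ) : ℕ := Nat.land (Nat.shiftRight P (Nat.mul 8 k)) 255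
def adj (c P k l : ℕ) : Bool := col c (pos P k) (pos P l)
def rowEnc (K s : ℕ) (A : ℕ → ℕ → Bool) (x : ℕ) : ℕ :=
  sumTo K fun j => cond (A x j) (Nat.pow 2 (Nat.mul s j)) 0
def sq (K : ℕ) (A : ℕ → ℕ → Bool) (x : ℕ) : ℕ := Nat.mul (rowEnc K (Nat.mul 16 K) A x) (rowEnc K 16 A x)
def mat (K : ℕ) (A : ℕ → ℕ → Bool) : ℕ :=
  sumTo K fun i => Nat.mul (Nat.pow 2 (Nat.mul (Nat.mul 16 K) i)) (rowEnc K 16 A i)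
def base (K : ℕ) (A : ℕ → ℕ → Bool) (x : ℕ) : ℕ := Nat.land (mat K A) (sq K A x)
def comp (K : ℕ) (A : ℕ → ℕ → Bool) : ℕ :=
  sumTo K fun a => sumTo K fun b => cond (A a b)
      (Nat.mod (Nat.land (base K A a) (sq K A b)) 65535) 0
def P0_0 : ℕ := 69309381398104144115697224764931981350931469269078941433544353827690083687747790489550690051723286965011610601509209131772447224205375324962748869726863113789134341654817969529627803634099027125287496394019423241443387704320
def P0_64 : ℕ := 69310793383537981566687104924748855316879077815434516573978183586747984312467718262784764626290212346668765180703902820796873660240499631284674863508753528034028107766355117633552452267943066993708748428961280126310374638081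
def P0_128 : ℕ := 67859255767675232646110071131894726624583848232552022701492481472951982888185247590778316829210660191163455129326234193808165598146702282629454314957688990272937237151411462929076666963754296510148565313921083621422615691777
def P1_0 : ℕ := 19406717926464160766865607750339829987219934493114294529992749651421683440447790886550832655210062003577582678476888712906464778939030411455906515882944161023703193973857855427073163761956883292465365555047204200107747006486878982840189441
def P1_64 : ℕ := 19304972100767141867565470945235791048840084251355830340023498325456037158802561664486007473604709022556804855690125032711892066611969423876783437526684096547406914367505812820542327097987116551186163083208496019684750495935628173057066240
def P1_128 : ℕ := 19509261758565329606492318050576182125018775540232853103258539021056926600541673177981662045818435533814858567518975384209283319005009677073382369795290058207062276762619415238491862319764734060697912470514902384776248953117237715216565504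
theorem nb0_0 : List.map (pos P0_0) (List.range 93) = List.filter (col 0 0) (List.range 192) := by decide +kernel
theorem cnt0_0 : Nat.beq (comp 93 (adj 0 P0_0)) 1101931 = true := by decide +kernel
theorem nb0_64 : List.map (pos P0_64) (List.range 93) = List.filter (col 0 64) (List.range 192) := by decide +kernel
theorem cnt0_64 : Nat.beq (comp 93 (adj 0 P0_64)) 1101931 = true := by decide +kernel
theorem nb0_128 : List.map (pos P0_128) (List.range 93) = List.filter (col 0 128) (List.range 192) := by decide +kernel
theorem cnt0_128 : Nat.beq (comp 93 (adj 0 P0_128)) 1101931 = true := by decide +kernel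
theorem nb1_0 : List.map (pos P1_0) (List.range 99) = List.filter (col 1 0) (List.range 192) := by decide +kernel
theorem cnt1_0 : Nat.beq (comp 99 (adj 1 P1_0)) 1214880 = true := by decide +kernel
theorem nb1_64 : List.map (pos P1_64) (List.range 99) = List.filter (col 1 64) (List.range 192) := by decide +kernel
theorem cnt1_64 : Nat.beq (comp 99 (adj 1 P1_64)) 1214880 = true := by decide +kernel
theorem nb1_128 : List.map (pos P1_128) (List.range 99) = List.filter (col 1 128) (List.range 192) := by decide +kernel
theorem cnt1_128 : Nat.beq (comp 99 (adj 1 P1_128)) 1214880 = true := by decide +kernel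

theorem sumTo_eq (n : ℕ) (f : ℕ → ℕ) : sumTo n f = ∑ i ∈ Finset.range n, f i := by
  induction n with
  | zero => rfl
  | succ k ih =>
    rw [Finset.sum_range_succ, ← ih]; rfl

/-- The number whose binary digits are the (spread out) entries of a 0/1 matrix. -/
def enc (K : ℕ) (R : ℕ → ℕ → Bool) : ℕ :=
  ∑ i ∈ Finset.range K, ∑ j ∈ Finset.range K, if R i j then 2 ^ (16 * (K * i + j)) else 0

def encSet (K : ℕ) (R : ℕ → ℕ → Bool) : Finset ℕ :=
  ((Finset.range K ×ˢ Finset.range K).filter fun q => R q.1 q.2).image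
    fun q => 16 * (K * q.1 + q.2)

theorem idx_inj {K i j i' j' : ℕ} (hj : j < K) (hj' : j' < K)
    (h : 16 * (K * i + j) = 16 * (K * i' + j')) : i = i' ∧ j = j' := by
  have h1 : K * i + j = K * i' + j' := by omega
  have hK : 0 < K := by omega
  have h2 : (K * i + j) / K = (K * i' + j') / K := by rw [h1]
  rw [Nat.mul_add_div hK, Nat.mul_add_div hK, Nat.div_eq_of_lt hj, Nat.div_eq_of_lt hj'] at h2
  have h3 : i = i' := by omega
  subst h3
  exact ⟨rfl, by omega⟩

theorem enc_eq (K : ℕ) (R : ℕ → ℕ → Bool) : enc K R = ∑ i ∈ encSet K R, 2 ^ i := by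
  unfold enc encSet
  rw [Finset.sum_image, Finset.sum_filter, Finset.sum_product]
  rintro ⟨i, j⟩ h ⟨i', j'⟩ h' e
  simp only [Finset.coe_filter, Finset.mem_product, Finset.mem_range, Set.mem_ofPred_eq] at h h'
  obtain ⟨h1, h2⟩ := idx_inj (i := i) (i' := i') h.1.2 h'.1.2 e
  rw [h1, h2]

theorem mem_encSet {K : ℕ} {R : ℕ → ℕ → Bool} {m : ℕ} :
    m ∈ encSet K R ↔ ∃ i j, i < K ∧ j < K ∧ R i j = true ∧ 16 * (K * i + j) = m := by
  unfold encSet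
  simp only [Finset.mem_image, Finset.mem_filter, Finset.mem_product, Finset.mem_range,
    Prod.exists]
  constructor
  · rintro ⟨i, j, ⟨⟨h1, h2⟩, h3⟩, h4⟩; exact ⟨i, j, h1, h2, h3, h4⟩
  · rintro ⟨i, j, h1, h2, h3, h4⟩; exact ⟨i, j, ⟨⟨h1, h2⟩, h3⟩, h4⟩

theorem testBit_sum (s : Finset ℕ) (m : ℕ) : (∑ i ∈ s, 2 ^ i).testBit m = decide (m ∈ s) := by
  have h : m ∈ (∑ i ∈ s, 2 ^ i).bitIndices.toFinset ↔ m ∈ s := by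
    rw [Finset.toFinset_bitIndices_sum_two_pow]
  rw [List.mem_toFinset, Nat.mem_bitIndices] at h
  by_cases hm : m ∈ s
  · simp [hm, h.2 hm]
  · simp only [hm, decide_false]
    by_contra hc
    exact hm (h.1 (by simpa using hc))

theorem enc_land (K : ℕ) (R R' : ℕ → ℕ → Bool) :
    Nat.land (enc K R) (enc K R') = enc K (fun i j => R i j && R' i j) := by
  change (enc K R) &&& (enc K R') = _
  apply Nat.eq_of_testBit_eq
  intro m
  rw [Nat.testBit_and, enc_eq, enc_eq, enc_eq, testBit_sum, testBit_sum, testBit_sum,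
    ← Bool.decide_and]
  apply decide_eq_decide.2
  simp only [mem_encSet]
  constructor
  · rintro ⟨⟨i, j, h1, h2, h3, h4⟩, ⟨i', j', h1', h2', h3', h4'⟩⟩
    obtain ⟨rfl, rfl⟩ := idx_inj h2 h2' (h4.trans h4'.symm)
    exact ⟨i, j, h1, h2, by simp [h3, h3'], h4⟩
  · rintro ⟨i, j, h1, h2, h3, h4⟩
    simp only [Bool.and_eq_true] at h3
    exact ⟨⟨i, j, h1, h2, h3.1, h4⟩, ⟨i, j, h1, h2, h3.2, h4⟩⟩

theorem enc_mod (K : ℕ) (hK : K ≤ 255) (R : ℕ → ℕ → Bool) :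
    Nat.mod (enc K R) 65535 =
      ∑ i ∈ Finset.range K, ∑ j ∈ Finset.range K, if R i j then 1 else 0 := by
  change enc K R % 65535 = _
  have h1 : enc K R ≡ ∑ i ∈ Finset.range K, ∑ j ∈ Finset.range K, (if R i j then 1 else 0)
      [MOD 65535] := by
    unfold enc
    refine Nat.ModEq.sum fun i _ => Nat.ModEq.sum fun j _ => ?_
    split_ifs
    · rw [pow_mul]
      have : (2 ^ 16 : ℕ) ≡ 1 [MOD 65535] := by decide
      simpa using this.pow (K * i + j)
    · rfl
  have h2 : ∑ i ∈ Finset.range K, ∑ j ∈ Finset.range K, (if R i j then 1 else 0) ≤ K * K := by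
    calc _ ≤ ∑ i ∈ Finset.range K, ∑ j ∈ Finset.range K, 1 := by
          refine Finset.sum_le_sum fun i _ => Finset.sum_le_sum fun j _ => ?_
          split_ifs <;> simp
      _ = K * K := by simp
  have h3 : K * K ≤ 255 * 255 := Nat.mul_le_mul hK hK
  rw [h1, Nat.mod_eq_of_lt (by omega)]

theorem rowEnc_eq (K s : ℕ) (A : ℕ → ℕ → Bool) (x : ℕ) :
    rowEnc K s A x = ∑ j ∈ Finset.range K, if A x j then 2 ^ (s * j) else 0 := by
  unfold rowEnc
  rw [sumTo_eq]
  refine Finset.sum_congr rfl fun j _ => ?_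
  cases A x j <;> simp

theorem sq_eq (K : ℕ) (A : ℕ → ℕ → Bool) (x : ℕ) :
    sq K A x = enc K (fun i j => A x i && A x j) := by
  unfold sq enc
  change rowEnc K (16 * K) A x * rowEnc K 16 A x = _
  rw [rowEnc_eq, rowEnc_eq, Finset.sum_mul_sum]
  refine Finset.sum_congr rfl fun i _ => Finset.sum_congr rfl fun j _ => ?_
  cases h1 : A x i <;> cases h2 : A x j <;> simp [h1, h2, mul_add, pow_add, mul_assoc]

theorem mat_eq (K : ℕ) (A : ℕ → ℕ → Bool) : mat K A = enc K A := by
  unfold mat enc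
  rw [sumTo_eq]
  refine Finset.sum_congr rfl fun i _ => ?_
  change 2 ^ ((16 * K) * i) * rowEnc K 16 A i = _
  rw [rowEnc_eq, Finset.mul_sum]
  refine Finset.sum_congr rfl fun j _ => ?_
  cases A i j <;> simp [mul_add, pow_add, mul_assoc]

/-- The number of ordered 4-tuples of pairwise related elements. -/
def T (K : ℕ) (A : ℕ → ℕ → Bool) : ℕ :=
  ∑ a ∈ Finset.range K, ∑ b ∈ Finset.range K, ∑ i ∈ Finset.range K, ∑ j ∈ Finset.range K,
    if A a b && A i j && A a i && A a j && A b i && A b j then 1 else 0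

theorem comp_eq (K : ℕ) (hK : K ≤ 255) (A : ℕ → ℕ → Bool) : comp K A = T K A := by
  unfold comp T base
  rw [sumTo_eq]
  refine Finset.sum_congr rfl fun a _ => ?_
  rw [sumTo_eq]
  refine Finset.sum_congr rfl fun b _ => ?_
  rw [mat_eq, sq_eq, sq_eq, enc_land, enc_land, enc_mod K hK]
  cases A a b
  · simp
  · simp [and_assoc]

/-- Ordered homogeneous 5-tuples with prescribed first entry. -/
def cntS (c x0 : ℕ) : ℕ :=
  ∑ x1 ∈ Finset.range 192, if col c x0 x1 then (
    ∑ x2 ∈ Finset.range 192, if col c x0 x2 then (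
      ∑ x3 ∈ Finset.range 192, if col c x0 x3 then (
        ∑ x4 ∈ Finset.range 192, if col c x0 x4 then (
          if col c x1 x2 && col c x3 x4 && col c x1 x3 && col c x1 x4 && col c x2 x3
            && col c x2 x4 then 1 else 0) else 0) else 0) else 0) else 0

theorem sum_range_list (n : ℕ) (f : ℕ → ℕ) :
    ∑ i ∈ Finset.range n, f i = ((List.range n).map f).sum := rfl

theorem sum_nb {c x0 K P : ℕ}
    (h : List.map (pos P) (List.range K) = List.filter (col c x0) (List.range 192))
    (f : ℕ → ℕ) :
    (∑ x ∈ Finset.range 192, if col c x0 x then f x else 0)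
      = ∑ k ∈ Finset.range K, f (pos P k) := by
  rw [sum_range_list K]
  have : (List.range K).map (fun k => f (pos P k)) = ((List.range K).map (pos P)).map f := by
    simp
  rw [this, h, sum_range_list]
  generalize List.range 192 = l
  induction l with
  | nil => rfl
  | cons a l ih =>
    rw [List.map_cons, List.sum_cons, ih, List.filter_cons]
    split_ifs <;> simp

theorem cntS_eq {c x0 K P v : ℕ} (hK : K ≤ 255)
    (h : List.map (pos P) (List.range K) = List.filter (col c x0) (List.range 192))
    (hv : Nat.beq (comp K (adj c P)) v = true) : cntS c x0 = v := by
  rw [← Nat.eq_of_beq_eq_true hv, comp_eq K hK]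
  unfold cntS T
  simp only [sum_nb h]
  rfl

theorem xor_lt : ∀ t < 64, ∀ x < 192, x ^^^ t < 192 := by decide +kernel

theorem sum_xor (t : ℕ) (ht : t < 64) (f : ℕ → ℕ) :
    ∑ x ∈ Finset.range 192, f x = ∑ x ∈ Finset.range 192, f (x ^^^ t) := by
  have hx : ∀ x, x ^^^ t ^^^ t = x := fun x => by rw [Nat.xor_assoc, Nat.xor_self, Nat.xor_zero]
  refine Finset.sum_nbij' (fun x => x ^^^ t) (fun x => x ^^^ t) ?_ ?_ ?_ ?_ ?_
  · intro a ha; simp only [Finset.mem_range] at ha ⊢; exact xor_lt t ht a ha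
  · intro a ha; simp only [Finset.mem_range] at ha ⊢; exact xor_lt t ht a ha
  · intro a _; exact hx a
  · intro a _; exact hx a
  · intro a _; simp only [hx]

theorem col_xor (c t : ℕ) (ht : t < 64) (x y : ℕ) : col c (x ^^^ t) (y ^^^ t) = col c x y := by
  have hd : ∀ x, Nat.div (x ^^^ t) 64 = Nat.div x 64 := by
    intro x
    change (x ^^^ t) / 2 ^ 6 = x / 2 ^ 6
    have h0 : t / 2 ^ 6 = 0 := Nat.div_eq_of_lt (by simpa using ht)
    rw [Nat.xor_div_two_pow, h0, Nat.xor_zero]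
  have hx : Nat.xor (x ^^^ t) (y ^^^ t) = Nat.xor x y := by
    change (x ^^^ t) ^^^ (y ^^^ t) = x ^^^ y
    rw [Nat.xor_comm y t, Nat.xor_assoc, ← Nat.xor_assoc t t, Nat.xor_self, Nat.zero_xor]
  unfold col bit
  rw [hd, hd, hx]

theorem cntS_xor (c t : ℕ) (ht : t < 64) (x : ℕ) : cntS c (x ^^^ t) = cntS c x := by
  unfold cntS
  refine (sum_xor t ht _).trans ?_
  refine Finset.sum_congr rfl fun x1 _ => ?_
  rw [col_xor c t ht]
  refine if_congr Iff.rfl ?_ rfl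
  refine (sum_xor t ht _).trans ?_
  refine Finset.sum_congr rfl fun x2 _ => ?_
  rw [col_xor c t ht]
  refine if_congr Iff.rfl ?_ rfl
  refine (sum_xor t ht _).trans ?_
  refine Finset.sum_congr rfl fun x3 _ => ?_
  rw [col_xor c t ht]
  refine if_congr Iff.rfl ?_ rfl
  refine (sum_xor t ht _).trans ?_
  refine Finset.sum_congr rfl fun x4 _ => ?_
  simp only [col_xor c t ht]

attribute [irreducible] cntS comp

theorem split_xor : ∀ x < 192, x = (64 * (x / 64)) ^^^ (x % 64) := by decide +kernel

theorem sum_cntS (c v : ℕ) (h0 : cntS c 0 = v) (h1 : cntS c 64 = v) (h2 : cntS c 128 = v) :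
    ∑ x ∈ Finset.range 192, cntS c x = 192 * v := by
  have : ∀ x ∈ Finset.range 192, cntS c x = v := by
    intro x hx
    rw [Finset.mem_range] at hx
    rw [split_xor x hx, cntS_xor c _ (Nat.mod_lt _ (by norm_num))]
    have : x / 64 = 0 ∨ x / 64 = 1 ∨ x / 64 = 2 := by omega
    rcases this with h | h | h
    · rw [h, Nat.mul_zero]; exact h0
    · rw [h, Nat.mul_one]; exact h1
    · rw [h]; exact h2
  rw [Finset.sum_congr rfl this]
  simp

def good (c : ℕ) (q : ℕ × ℕ × ℕ × ℕ × ℕ) : Bool :=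
  col c q.1 q.2.1 && col c q.1 q.2.2.1 && col c q.1 q.2.2.2.1 && col c q.1 q.2.2.2.2 &&
  (col c q.2.1 q.2.2.1 && col c q.2.2.2.1 q.2.2.2.2 && col c q.2.1 q.2.2.2.1 &&
    col c q.2.1 q.2.2.2.2 && col c q.2.2.1 q.2.2.2.1 && col c q.2.2.1 q.2.2.2.2)

def homs (c : ℕ) : Finset (ℕ × ℕ × ℕ × ℕ × ℕ) :=
  (Finset.range 192 ×ˢ Finset.range 192 ×ˢ Finset.range 192 ×ˢ Finset.range 192 ×ˢ
    Finset.range 192).filter fun q => good c q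

theorem card_homs (c : ℕ) : (homs c).card = ∑ x ∈ Finset.range 192, cntS c x := by
  unfold homs
  rw [Finset.card_filter, Finset.sum_product]
  refine Finset.sum_congr rfl fun x0 _ => ?_
  unfold cntS
  rw [Finset.sum_product]
  refine Finset.sum_congr rfl fun x1 _ => ?_
  rw [Finset.sum_product]
  cases h1 : col c x0 x1
  · simp [good, h1]
  rw [if_pos rfl]
  refine Finset.sum_congr rfl fun x2 _ => ?_
  rw [Finset.sum_product]
  cases h2 : col c x0 x2
  · simp [good, h2]
  rw [if_pos rfl]
  refine Finset.sum_congr rfl fun x3 _ => ?_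
  cases h3 : col c x0 x3
  · simp [good, h3]
  rw [if_pos rfl]
  refine Finset.sum_congr rfl fun x4 _ => ?_
  cases h4 : col c x0 x4
  · simp [good, h4]
  simp only [good, h1, h2, h3, h4, Bool.true_and, if_true]

attribute [irreducible] homs good

theorem homs_le_card {c n : ℕ} (G : SimpleGraph (Fin n))
    (h : ∀ i j : Fin n, G.Adj i j → col c (i % 192) (j % 192) = true) :
    kcount 5 G * 120 ≤ (homs c).card * (n / 192 + 1) ^ 5 := by
  let X := {s : Finset (Fin n) // G.IsNClique 5 s} × Equiv.Perm (Fin 5)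
  let F : X → Fin 5 → Fin n := fun q i => q.1.1.orderEmbOfFin q.1.2.card_eq (q.2 i)
  have hF : Function.Injective F := by
    rintro ⟨⟨s, hs⟩, σ⟩ ⟨⟨s', hs'⟩, σ'⟩ e
    have hr : ∀ (s : Finset (Fin n)) (hs : G.IsNClique 5 s) (σ : Equiv.Perm (Fin 5)),
        Set.range (F ⟨⟨s, hs⟩, σ⟩) = s := by
      intro s hs σ
      have : F ⟨⟨s, hs⟩, σ⟩ = (s.orderEmbOfFin hs.card_eq) ∘ σ := rfl
      rw [this, Set.range_comp, σ.surjective.range_eq, Set.image_univ,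
        Finset.range_orderEmbOfFin]
    have h1 : (s : Set (Fin n)) = s' := by rw [← hr s hs σ, ← hr s' hs' σ', e]
    have h2 : s = s' := Finset.coe_injective h1
    subst h2
    have h3 : σ = σ' := by
      ext i
      have := congrFun e i
      exact congrArg Fin.val ((s.orderEmbOfFin hs.card_eq).injective this)
    rw [h3]
  have hA : ∀ q i j, i ≠ j → G.Adj (F q i) (F q j) := by
    rintro ⟨⟨s, hs⟩, σ⟩ i j hij
    refine hs.isClique (Finset.orderEmbOfFin_mem _ _ _) (Finset.orderEmbOfFin_mem _ _ _) ?_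
    intro e
    exact hij (σ.injective ((s.orderEmbOfFin hs.card_eq).injective e))
  let r : X → Fin 5 → ℕ := fun q i => (F q i : ℕ) % 192
  have hr : ∀ q, (r q 0, r q 1, r q 2, r q 3, r q 4) ∈ homs c := by
    intro q
    have hc : ∀ i j, i ≠ j → col c (r q i) (r q j) = true := fun i j hij => h _ _ (hA q i j hij)
    have hl : ∀ i, r q i < 192 := fun i => Nat.mod_lt _ (by norm_num)
    generalize r q = ρ at hc hl ⊢
    unfold homs
    rw [Finset.mem_filter]
    simp only [Finset.mem_product, Finset.mem_range]
    refine ⟨⟨hl 0, hl 1, hl 2, hl 3, hl 4⟩, ?_⟩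
    have h01 := hc 0 1 (by decide)
    have h02 := hc 0 2 (by decide)
    have h03 := hc 0 3 (by decide)
    have h04 := hc 0 4 (by decide)
    have h12 := hc 1 2 (by decide)
    have h13 := hc 1 3 (by decide)
    have h14 := hc 1 4 (by decide)
    have h23 := hc 2 3 (by decide)
    have h24 := hc 2 4 (by decide)
    have h34 := hc 3 4 (by decide)
    simp only [good, h01, h02, h03, h04, h12, h13, h14, h23, h24, h34, Bool.and_self]
  let Φ : X → (homs c) × (Fin 5 → Fin (n / 192 + 1)) := fun q =>
    (⟨_, hr q⟩, fun i => ⟨(F q i : ℕ) / 192,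
      Nat.lt_succ_of_le (Nat.div_le_div_right (F q i).2.le)⟩)
  have hΦ : Function.Injective Φ := by
    intro q q' e
    apply hF
    simp only [Φ, Prod.mk.injEq, Subtype.mk.injEq] at e
    obtain ⟨⟨e0, e1, e2, e3, e4⟩, e5⟩ := e
    funext i
    have hd : (F q i : ℕ) / 192 = (F q' i : ℕ) / 192 := by
      have := congrFun e5 i
      simpa using this
    have hm : (F q i : ℕ) % 192 = (F q' i : ℕ) % 192 := by
      fin_cases i
      · exact e0
      · exact e1
      · exact e2
      · exact e3
      · exact e4
    apply Fin.ext
    omega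
  have := Nat.card_le_card_of_injective Φ hΦ
  simpa [X, kcount, Nat.card_eq_fintype_card, Fintype.card_perm, Nat.factorial] using this

theorem col_symm : ∀ x < 192, ∀ y < 192, col 1 x y = col 1 y x := by decide +kernel

theorem col_irrefl : ∀ x < 192, col 1 x x = false := by decide +kernel

theorem col_compl (x y : ℕ) (h : ¬ col 1 x y = true) : col 0 x y = true := by
  have hb : bit x y = 0 ∨ bit x y = 1 := by
    have : ∀ m, Nat.land m 1 = m % 2 := fun m => Nat.and_one_is_mod m
    unfold bit
    rw [this]
    omega
  unfold col at h ⊢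
  rcases hb with hb | hb
  · rw [hb]; rfl
  · rw [hb] at h; exact absurd rfl h

/-- The blow-up of the 192-vertex graph. -/
def blow (n : ℕ) : SimpleGraph (Fin n) where
  Adj i j := col 1 (i % 192) (j % 192) = true
  symm := ⟨fun i j h => by
    rw [col_symm _ (Nat.mod_lt _ (by norm_num)) _ (Nat.mod_lt _ (by norm_num))]; exact h⟩
  loopless := ⟨fun i h => by
    rw [col_irrefl _ (Nat.mod_lt _ (by norm_num))] at h; exact absurd h (by simp)⟩

theorem val0_0 : cntS 0 0 = 1101931 :=
  cntS_eq (K := 93) (P := P0_0) (by norm_num) nb0_0 cnt0_0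

theorem val0_64 : cntS 0 64 = 1101931 :=
  cntS_eq (K := 93) (P := P0_64) (by norm_num) nb0_64 cnt0_64

theorem val0_128 : cntS 0 128 = 1101931 :=
  cntS_eq (K := 93) (P := P0_128) (by norm_num) nb0_128 cnt0_128

theorem val1_0 : cntS 1 0 = 1214880 :=
  cntS_eq (K := 99) (P := P1_0) (by norm_num) nb1_0 cnt1_0

theorem val1_64 : cntS 1 64 = 1214880 :=
  cntS_eq (K := 99) (P := P1_64) (by norm_num) nb1_64 cnt1_64

theorem val1_128 : cntS 1 128 = 1214880 :=
  cntS_eq (K := 99) (P := P1_128) (by norm_num) nb1_128 cnt1_128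

theorem blow_bound (n : ℕ) :
    (kcount 5 (blow n) + kcount 5 (blow n)ᶜ) * 120 ≤ 192 * 2316811 * (n / 192 + 1) ^ 5 := by
  have h1 := homs_le_card (c := 1) (blow n) (fun i j h => h)
  have h0 := homs_le_card (c := 0) (blow n)ᶜ (fun i j h => by
    rw [SimpleGraph.compl_adj] at h
    exact col_compl _ _ h.2)
  rw [card_homs, sum_cntS 1 1214880 val1_0
    val1_64 val1_128] at h1
  rw [card_homs, sum_cntS 0 1101931 val0_0
    val0_64 val0_128] at h0
  calc _ ≤ 192 * 1214880 * (n / 192 + 1) ^ 5 + 192 * 1101931 * (n / 192 + 1) ^ 5 := by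
        rw [add_mul]; exact add_le_add h1 h0
    _ = _ := by ring

theorem poly_bound (n : ℕ) (hn : 1000000 ≤ n) :
    (192 * 2316811 * ((n / 192 + 1 : ℕ) : ℝ) ^ 5) ≤
      2320651 / (2 ^ 24 * 3 ^ 4) * (120 * (n.choose 5 : ℝ)) := by
  obtain ⟨t, rfl⟩ : ∃ t, n = t + 4 := ⟨n - 4, by omega⟩
  have ht : (999996 : ℝ) ≤ t := by
    have : 999996 ≤ t := by omega
    exact_mod_cast this
  have h1 : (((t + 4) / 192 + 1 : ℕ) : ℝ) ≤ (t * 1.0003) / 192 := by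
    have : (((t + 4) / 192 : ℕ) : ℝ) ≤ ((t + 4 : ℕ) : ℝ) / 192 := by
      simpa using (Nat.cast_div_le (α := ℝ) (m := t + 4) (n := 192))
    push_cast at this ⊢
    linarith
  have h2 : (t : ℝ) ^ 5 ≤ 120 * ((t + 4).choose 5 : ℝ) := by
    have h : (120 : ℝ) * ((t + 4).choose 5 : ℝ) = ((t + 4).descFactorial 5 : ℕ) := by
      rw [Nat.descFactorial_eq_factorial_mul_choose]
      push_cast [Nat.factorial]
      norm_num
    rw [h]
    have : t ^ 5 ≤ (t + 4).descFactorial 5 := by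
      simpa using Nat.pow_sub_le_descFactorial (t + 4) 5
    exact_mod_cast this
  calc _ ≤ 192 * 2316811 * ((t * 1.0003) / 192 : ℝ) ^ 5 := by gcongr
    _ = (192 * 2316811 * (1.0003 / 192) ^ 5) * (t : ℝ) ^ 5 := by ring
    _ ≤ 2320651 / (2 ^ 24 * 3 ^ 4) * (t : ℝ) ^ 5 := by
        gcongr
        norm_num
    _ ≤ _ := by gcongr

end C5

/-- The Ramsey multiplicity constant of `K₅` satisfies
`c₅ ≤ 2320651 · 2⁻²⁴ · 3⁻⁴`. -/
theorem c5_upper_bound :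
    Filter.limsup (fun n : ℕ =>
        sInf {x : ℝ | ∃ G : SimpleGraph (Fin n),
            x = (kcount 5 G : ℝ) + (kcount 5 Gᶜ : ℝ)} / (n.choose 5 : ℝ))
      Filter.atTop ≤ 2320651 / (2 ^ 24 * 3 ^ 4) := by
  have hlow : ∀ n : ℕ, (0 : ℝ) ∈ lowerBounds {x : ℝ | ∃ G : SimpleGraph (Fin n),
            x = (kcount 5 G : ℝ) + (kcount 5 Gᶜ : ℝ)} := by
    rintro n x ⟨G, rfl⟩
    positivity
  refine Filter.limsup_le_of_le ?_ ?_
  · refine Filter.IsCoboundedUnder.of_frequently_ge (a := 0) (Filter.Frequently.of_forall ?_)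
    intro n
    refine div_nonneg (Real.sInf_nonneg fun x hx => hlow n hx) (by positivity)
  · filter_upwards [Filter.eventually_ge_atTop 1000000] with n hn
    have hpos : (0 : ℝ) < (n.choose 5 : ℝ) := by
      exact_mod_cast Nat.choose_pos (by omega)
    rw [div_le_iff₀ hpos]
    have h1 : sInf {x : ℝ | ∃ G : SimpleGraph (Fin n),
            x = (kcount 5 G : ℝ) + (kcount 5 Gᶜ : ℝ)} ≤
        (kcount 5 (C5.blow n) : ℝ) + (kcount 5 (C5.blow n)ᶜ : ℝ) :=
      csInf_le ⟨0, hlow n⟩ ⟨C5.blow n, rfl⟩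
    have h2 : ((kcount 5 (C5.blow n) : ℝ) + (kcount 5 (C5.blow n)ᶜ : ℝ)) * 120 ≤
        192 * 2316811 * ((n / 192 + 1 : ℕ) : ℝ) ^ 5 := by
      exact_mod_cast C5.blow_bound n
    have h3 := C5.poly_bound n hn
    linarith
end

section
/- For all integers s, t ≥ 2, the lower bounding curve c_{s,t}(x) = inf{ y : (x,y) ∈ Ω_{s,t} } is a weakly decreasing (antitone) and continuous function of x on [0,1], and it is differentiable at almost every x ∈ [0,1]. -/
open Filter Topology

/-- `OmegaST s t` is the set of pairs `(x, y)` such that some sequence of graphs `G n`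
on `n` vertices has independent-`s`-set density tending to `x` and `K_t`-density
tending to `y`. -/
def OmegaST (s t : ℕ) : Set (ℝ × ℝ) :=
  {p | ∃ G : (n : ℕ) → SimpleGraph (Fin n),
    Filter.Tendsto (fun n : ℕ => (kcount s (G n)ᶜ : ℝ) / (n.choose s : ℝ))
      Filter.atTop (nhds p.1) ∧
    Filter.Tendsto (fun n : ℕ => (kcount t (G n) : ℝ) / (n.choose t : ℝ))
      Filter.atTop (nhds p.2)}


/-- The lower bounding curve `c_{s,t}(x) = inf { y : (x,y) ∈ Ω_{s,t} }`. -/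
noncomputable def lowerCurve (s t : ℕ) (x : ℝ) : ℝ :=
  sInf {y : ℝ | (x, y) ∈ OmegaST s t}

open Classical in
/-- number of maps `Fin t → V` all of whose pairs are related. -/
noncomputable def hset {V : Type} [Fintype V] (t : ℕ) (R : V → V → Prop) : Finset (Fin t → V) :=
  Finset.univ.filter (fun φ => ∀ i j, i ≠ j → R (φ i) (φ j))

noncomputable def hdens {V : Type} [Fintype V] (t : ℕ) (R : V → V → Prop) : ℝ :=
  ((hset t R).card : ℝ) / (Fintype.card V : ℝ) ^ t

lemma mem_hset {V : Type} [Fintype V] {t : ℕ} {R : V → V → Prop} {φ : Fin t → V} :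
    φ ∈ hset t R ↔ ∀ i j, i ≠ j → R (φ i) (φ j) := by
  simp [hset]

lemma hset_card_le {V : Type} [Fintype V] (t : ℕ) (R : V → V → Prop) :
    (hset t R).card ≤ Fintype.card V ^ t := by
  classical
  calc (hset t R).card ≤ (Finset.univ : Finset (Fin t → V)).card := Finset.card_le_card (Finset.subset_univ _)
    _ = _ := by simp

lemma hdens_nonneg {V : Type} [Fintype V] (t : ℕ) (R : V → V → Prop) : 0 ≤ hdens t R := by
  unfold hdens; positivity

lemma hdens_le_one {V : Type} [Fintype V] (t : ℕ) (R : V → V → Prop) : hdens t R ≤ 1 := by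
  unfold hdens
  apply div_le_one_of_le₀ _ (by positivity)
  exact_mod_cast hset_card_le t R

/-! ### relation with clique counts -/

lemma hset_adj_injective {V : Type} [Fintype V] {t : ℕ} {G : SimpleGraph V} {φ : Fin t → V}
    (h : φ ∈ hset t G.Adj) : Function.Injective φ := by
  intro i j hij
  by_contra hne
  have := mem_hset.1 h i j hne
  rw [hij] at this
  exact G.loopless.irrefl _ this

lemma card_inj_image {V : Type} [Fintype V] [DecidableEq V] {t : ℕ} (S : Finset V) (hS : S.card = t) :
    (Finset.univ.filter (fun φ : Fin t → V => Function.Injective φ ∧ Finset.univ.image φ = S)).card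
      = t.factorial := by
  have e0 : Fin t ≃ S := (Fintype.equivFinOfCardEq (by simpa using hS)).symm
  have : Fintype.card (Fin t ≃ S) = t.factorial := by
    rw [Fintype.card_equiv e0]; simp
  rw [← this, ← Finset.card_univ]
  symm
  refine Finset.card_bij (fun e _ => fun i => ((e i : S) : V)) ?_ ?_ ?_
  · intro e _
    simp only [Finset.mem_filter, Finset.mem_univ, true_and]
    refine ⟨Subtype.val_injective.comp e.injective, ?_⟩
    ext v
    simp only [Finset.mem_image, Finset.mem_univ, true_and]
    constructor
    · rintro ⟨i, rfl⟩; exact (e i).2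
    · intro hv; exact ⟨e.symm ⟨v, hv⟩, by simp⟩
  · intro e _ e' _ h
    ext i
    exact congrFun h i
  · intro φ hφ
    simp only [Finset.mem_filter, Finset.mem_univ, true_and] at hφ
    obtain ⟨hi, him⟩ := hφ
    have hm : ∀ i, φ i ∈ S := fun i => by rw [← him]; simp
    refine ⟨Equiv.ofBijective (fun i => (⟨φ i, hm i⟩ : S)) ⟨?_, ?_⟩, Finset.mem_univ _, ?_⟩
    · intro i j h
      exact hi (congrArg Subtype.val h)
    · rintro ⟨v, hv⟩
      rw [← him] at hv
      obtain ⟨i, _, hiv⟩ := Finset.mem_image.1 hv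
      exact ⟨i, Subtype.ext hiv⟩
    · rfl

lemma hset_adj_card {V : Type} [Fintype V] (t : ℕ) (G : SimpleGraph V) :
    (hset t G.Adj).card = t.factorial * kcount t G := by
  classical
  have hk : kcount t G = (Finset.univ.filter (fun S : Finset V => G.IsNClique t S)).card := by
    unfold kcount
    rw [Nat.card_eq_fintype_card, Fintype.card_subtype]
  rw [hk, Finset.card_eq_sum_card_fiberwise (f := fun φ : Fin t → V => Finset.univ.image φ)
    (t := Finset.univ.filter (fun S : Finset V => G.IsNClique t S))]
  · rw [Finset.sum_congr rfl (g := fun _ => t.factorial)]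
    · simp [mul_comm]
    · intro S hS
      simp only [Finset.mem_filter, Finset.mem_univ, true_and] at hS
      rw [← card_inj_image S hS.card_eq]
      congr 1
      ext φ
      simp only [Finset.mem_filter, Finset.mem_univ, true_and]
      constructor
      · rintro ⟨h, h'⟩; exact ⟨hset_adj_injective h, h'⟩
      · rintro ⟨h, h'⟩
        refine ⟨mem_hset.2 fun i j hij => ?_, h'⟩
        apply hS.isClique
        · rw [← h']; simp
        · rw [← h']; simp
        · exact fun h2 => hij (h h2)
  · intro φ hφ
    have hφ : φ ∈ hset t G.Adj := hφ
    have hinj := hset_adj_injective hφ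
    simp only [Finset.coe_filter, Finset.mem_univ, true_and, Set.mem_ofPred_eq]
    refine ⟨?_, ?_⟩
    · intro a ha b hb hab
      simp only [Finset.coe_image, Finset.coe_univ, Set.image_univ, Set.mem_range] at ha hb
      obtain ⟨i, rfl⟩ := ha
      obtain ⟨j, rfl⟩ := hb
      exact mem_hset.1 hφ i j (fun h => hab (by rw [h]))
    · rw [Finset.card_image_of_injective _ hinj]; simp

lemma card_injective_funs {V : Type} [Fintype V] [DecidableEq V] (t : ℕ) :
    (Finset.univ.filter (fun φ : Fin t → V => Function.Injective φ)).card
      = (Fintype.card V).descFactorial t := by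
  rw [← Fintype.card_subtype, Fintype.card_congr (Equiv.subtypeInjectiveEquivEmbedding _ _),
    Fintype.card_embedding_eq]
  simp

lemma hset_adj_card_le {V : Type} [Fintype V] (t : ℕ) (G : SimpleGraph V) :
    (hset t G.Adj).card ≤ (Fintype.card V).descFactorial t := by
  classical
  rw [← card_injective_funs]
  apply Finset.card_le_card
  intro φ h
  simp [hset_adj_injective h]

lemma hset_compl_card_le {V : Type} [Fintype V] (t : ℕ) (G : SimpleGraph V) :
    (hset t (Gᶜ).Adj).card ≤ (hset t (fun u v => ¬ G.Adj u v)).card := by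
  apply Finset.card_le_card
  intro φ h
  rw [mem_hset] at h ⊢
  intro i j hij
  exact ((SimpleGraph.compl_adj _ _ _).1 (h i j hij)).2

lemma hset_nonadj_card_le {V : Type} [Fintype V] (t : ℕ) (G : SimpleGraph V) :
    (hset t (fun u v => ¬ G.Adj u v)).card + (Fintype.card V).descFactorial t ≤
      (hset t (Gᶜ).Adj).card + (Fintype.card V) ^ t := by
  classical
  rw [← card_injective_funs]
  have h1 : hset t (fun u v => ¬ G.Adj u v) ∩
      (Finset.univ.filter (fun φ : Fin t → V => Function.Injective φ)) ⊆ hset t (Gᶜ).Adj := by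
    intro φ h
    simp only [Finset.mem_inter, Finset.mem_filter, Finset.mem_univ, true_and, mem_hset] at h
    rw [mem_hset]
    intro i j hij
    exact (SimpleGraph.compl_adj _ _ _).2 ⟨fun h' => hij (h.2 h'), h.1 i j hij⟩
  have h2 := Finset.card_le_card h1
  have h3 := Finset.card_union_add_card_inter (hset t (fun u v => ¬ G.Adj u v))
    (Finset.univ.filter (fun φ : Fin t → V => Function.Injective φ))
  have h4 : (hset t (fun u v => ¬ G.Adj u v) ∪
    (Finset.univ.filter (fun φ : Fin t → V => Function.Injective φ))).card ≤ Fintype.card V ^ t := by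
    refine (Finset.card_le_card (Finset.subset_univ _)).trans ?_
    simp
  omega

/-- the error between homomorphism and clique density -/
noncomputable def err (t n : ℕ) : ℝ := 1 - (n.descFactorial t : ℝ) / (n : ℝ) ^ t

lemma err_tendsto (t : ℕ) : Tendsto (err t) atTop (𝓝 0) := by
  have key : Tendsto (fun n : ℕ => (n.descFactorial t : ℝ) / (n : ℝ) ^ t) atTop (𝓝 1) := by
    induction t with
    | zero => simp
    | succ t ih =>
      have h2 : Tendsto (fun n : ℕ => 1 - (t : ℝ) / (n : ℝ)) atTop (𝓝 (1 - 0)) :=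
        tendsto_const_nhds.sub (tendsto_const_div_atTop_nhds_zero_nat _)
      have h3 := h2.mul ih
      simp only [sub_zero, one_mul] at h3
      refine h3.congr' ?_
      filter_upwards [eventually_ge_atTop (t + 1)] with n hn
      have : (n : ℝ) ≠ 0 := by
        have : 0 < n := by omega
        positivity
      rw [Nat.descFactorial_succ, Nat.cast_mul, Nat.cast_sub (by omega)]
      field_simp
      ring
  have := key.const_sub 1
  rw [sub_self] at this
  exact this

lemma err_nonneg (t n : ℕ) : 0 ≤ err t n := by
  unfold err
  have : (n.descFactorial t : ℝ) / (n : ℝ) ^ t ≤ 1 := by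
    apply div_le_one_of_le₀ _ (by positivity)
    exact_mod_cast Nat.descFactorial_le_pow n t
  linarith

lemma kdens_eq (t n : ℕ) (G : SimpleGraph (Fin n)) :
    (kcount t G : ℝ) / (n.choose t : ℝ) = ((hset t G.Adj).card : ℝ) / (n.descFactorial t : ℝ) := by
  rw [hset_adj_card, Nat.descFactorial_eq_factorial_mul_choose]
  push_cast
  rw [mul_div_mul_left]
  exact_mod_cast Nat.factorial_ne_zero t

lemma abs_aux (t n : ℕ) (h : t ≤ n) (a : ℕ) (ha : a ≤ n.descFactorial t) (b : ℕ) (hab : a ≤ b)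
    (hb : b + n.descFactorial t ≤ a + n ^ t) :
    |(b : ℝ) / (n : ℝ) ^ t - (a : ℝ) / (n.descFactorial t : ℝ)| ≤ err t n := by
  have hd : (0 : ℝ) < n.descFactorial t := by exact_mod_cast Nat.descFactorial_pos.2 h
  have hle : (n.descFactorial t : ℝ) ≤ (n : ℝ) ^ t := by exact_mod_cast Nat.descFactorial_le_pow n t
  have hp : (0 : ℝ) < (n : ℝ) ^ t := lt_of_lt_of_le hd hle
  have ha' : (a : ℝ) ≤ n.descFactorial t := by exact_mod_cast ha
  have hab' : (a : ℝ) ≤ b := by exact_mod_cast hab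
  have hb' : (b : ℝ) + n.descFactorial t ≤ a + (n : ℝ) ^ t := by exact_mod_cast hb
  have ha0 : (0 : ℝ) ≤ a := by positivity
  have key : (a : ℝ) / n.descFactorial t - a / (n : ℝ) ^ t ≤ err t n := by
    have h1 : (a : ℝ) / n.descFactorial t ≤ 1 := div_le_one_of_le₀ ha' hd.le
    have h2 : (a : ℝ) / n.descFactorial t - a / (n : ℝ) ^ t = (a / n.descFactorial t) * err t n := by
      unfold err; field_simp
    rw [h2]
    exact mul_le_of_le_one_left (err_nonneg _ _) h1
  have h3 : (a : ℝ) / (n : ℝ) ^ t ≤ a / n.descFactorial t := div_le_div_of_nonneg_left ha0 hd hle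
  have h4 : (a : ℝ) / (n : ℝ) ^ t ≤ b / (n : ℝ) ^ t := by gcongr
  have h5 : (b : ℝ) / (n : ℝ) ^ t ≤ a / (n : ℝ) ^ t + err t n := by
    have : a / (n : ℝ) ^ t + err t n = (a + (n : ℝ) ^ t - n.descFactorial t) / (n : ℝ) ^ t := by
      unfold err; field_simp; ring
    rw [this]
    gcongr
    linarith
  rw [abs_le]
  constructor <;> linarith

lemma abs_hdens_adj (t n : ℕ) (h : t ≤ n) (G : SimpleGraph (Fin n)) :
    |hdens t G.Adj - (kcount t G : ℝ) / (n.choose t : ℝ)| ≤ err t n := by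
  rw [kdens_eq]
  have := abs_aux t n h (hset t G.Adj).card (by simpa using hset_adj_card_le t G) _ le_rfl
    (by gcongr; exact Nat.descFactorial_le_pow n t)
  simpa [hdens] using this

lemma abs_hdens_nonadj (t n : ℕ) (h : t ≤ n) (G : SimpleGraph (Fin n)) :
    |hdens t (fun u v => ¬ G.Adj u v) - (kcount t Gᶜ : ℝ) / (n.choose t : ℝ)| ≤ err t n := by
  rw [kdens_eq]
  have := abs_aux t n h (hset t (Gᶜ).Adj).card (by simpa using hset_adj_card_le t Gᶜ) _
    (hset_compl_card_le t G) (by simpa using hset_nonadj_card_le t G)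
  simpa [hdens] using this

/-! ### blow-ups -/

lemma hset_comap_card {V W : Type} [Fintype V] [Fintype W] [DecidableEq V] (f : W → V) (t : ℕ)
    (R : V → V → Prop) :
    (hset t (fun a b => R (f a) (f b))).card =
      ∑ ψ ∈ hset t R, ∏ i, (Finset.univ.filter (fun w => f w = ψ i)).card := by
  classical
  rw [Finset.card_eq_sum_card_fiberwise (f := fun φ : Fin t → W => f ∘ φ) (t := hset t R)]
  · apply Finset.sum_congr rfl
    intro ψ hψ
    rw [← Fintype.card_piFinset]
    congr 1
    ext φ
    simp only [Finset.mem_filter, Fintype.mem_piFinset, Finset.mem_univ, true_and]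
    constructor
    · rintro ⟨_, rfl⟩ i; rfl
    · intro h
      have : f ∘ φ = ψ := funext h
      refine ⟨?_, this⟩
      subst this
      exact mem_hset.2 (mem_hset.1 hψ)
  · intro φ hφ
    have hφ' := mem_hset.1 (Finset.mem_coe.1 hφ)
    exact Finset.mem_coe.2 (mem_hset.2 hφ')

lemma hset_comap_bounds {V W : Type} [Fintype V] [Fintype W] [DecidableEq V] (f : W → V) (t : ℕ)
    (R : V → V → Prop) (q : ℕ) (h1 : ∀ v, q ≤ (Finset.univ.filter (fun w => f w = v)).card)
    (h2 : ∀ v, (Finset.univ.filter (fun w => f w = v)).card ≤ q + 1) :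
    (hset t R).card * q ^ t ≤ (hset t (fun a b => R (f a) (f b))).card ∧
    (hset t (fun a b => R (f a) (f b))).card ≤ (hset t R).card * (q + 1) ^ t := by
  rw [hset_comap_card f t R]
  constructor
  · rw [← smul_eq_mul]
    apply Finset.card_nsmul_le_sum
    intro ψ _
    calc q ^ t = ∏ _i : Fin t, q := by simp
      _ ≤ _ := Finset.prod_le_prod' (fun i _ => h1 _)
  · rw [← smul_eq_mul]
    apply Finset.sum_le_card_nsmul
    intro ψ _
    calc _ ≤ ∏ _i : Fin t, (q + 1) := Finset.prod_le_prod' (fun i _ => h2 _)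
      _ = (q + 1) ^ t := by simp

lemma exists_equitable (V : Type) [Fintype V] [DecidableEq V] [Nonempty V] (m : ℕ) :
    ∃ f : Fin m → V,
      (∀ v, m / Fintype.card V ≤ (Finset.univ.filter (fun w => f w = v)).card) ∧
      (∀ v, (Finset.univ.filter (fun w => f w = v)).card ≤ m / Fintype.card V + 1) := by
  have hn : 0 < Fintype.card V := Fintype.card_pos
  let e := Fintype.equivFin V
  let f : Fin m → V := fun i => e.symm ⟨i.1 % Fintype.card V, Nat.mod_lt _ hn⟩
  have key : ∀ v, (Finset.univ.filter (fun w => f w = v)).card =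
      m / Fintype.card V + if (e v).1 % Fintype.card V < m % Fintype.card V then 1 else 0 := by
    intro v
    rw [← Nat.count_modEq_card m hn, Nat.count_eq_card_filter_range]
    refine Finset.card_bij (fun i _ => i.1) ?_ ?_ ?_
    · intro i hi
      simp only [Finset.mem_filter, Finset.mem_univ, true_and, f, Equiv.symm_apply_eq] at hi
      simp only [Finset.mem_filter, Finset.mem_range, i.2, true_and]
      rw [← hi]
      simp [Nat.ModEq]
    · intro i _ j _ h; exact Fin.ext h
    · intro b hb
      simp only [Finset.mem_filter, Finset.mem_range] at hb
      refine ⟨⟨b, hb.1⟩, ?_, rfl⟩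
      simp only [Finset.mem_filter, Finset.mem_univ, true_and, f, Equiv.symm_apply_eq]
      apply Fin.ext
      have := hb.2
      unfold Nat.ModEq at this
      rw [Nat.mod_eq_of_lt (e v).2] at this
      exact this
  refine ⟨f, fun v => ?_, fun v => ?_⟩
  · rw [key]; omega
  · rw [key]; split_ifs <;> omega

lemma tendsto_div_nat (n : ℕ) (hn : 0 < n) :
    Tendsto (fun m : ℕ => (((m / n : ℕ)) : ℝ) / m) atTop (𝓝 (1 / n)) := by
  have h := (tendsto_nat_floor_mul_div_atTop (R := ℝ) (a := 1 / n) (by positivity)).comp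
    (tendsto_natCast_atTop_atTop (R := ℝ))
  refine h.congr fun m => ?_
  simp only [Function.comp]
  congr 2
  rw [one_div_mul_eq_div, Nat.floor_div_natCast, Nat.floor_natCast]

lemma tendsto_hdens_blowup {V : Type} [Fintype V] [DecidableEq V] [Nonempty V]
    (f : (m : ℕ) → Fin m → V) (t : ℕ) (R : V → V → Prop)
    (h1 : ∀ m v, m / Fintype.card V ≤ (Finset.univ.filter (fun w => f m w = v)).card)
    (h2 : ∀ m v, (Finset.univ.filter (fun w => f m w = v)).card ≤ m / Fintype.card V + 1) :
    Tendsto (fun m => hdens t (fun a b => R (f m a) (f m b))) atTop (𝓝 (hdens t R)) := by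
  have hn : 0 < Fintype.card V := Fintype.card_pos
  have t1 := tendsto_div_nat _ hn
  have t2 : Tendsto (fun m : ℕ => (((m / Fintype.card V : ℕ)) : ℝ) / m + 1 / (m : ℝ)) atTop
      (𝓝 (1 / Fintype.card V)) := by
    simpa using t1.add (tendsto_const_div_atTop_nhds_zero_nat 1)
  have l1 := (t1.pow t).const_mul ((hset t R).card : ℝ)
  have l2 := (t2.pow t).const_mul ((hset t R).card : ℝ)
  have e : ((hset t R).card : ℝ) * (1 / Fintype.card V) ^ t = hdens t R := by
    unfold hdens; rw [one_div, inv_pow]; rfl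
  rw [e] at l1 l2
  refine tendsto_of_tendsto_of_tendsto_of_le_of_le l1 l2 ?_ ?_
  · intro m
    have := (hset_comap_bounds (f m) t R _ (h1 m) (h2 m)).1
    simp only [hdens, Fintype.card_fin]
    rw [div_pow, ← mul_div_assoc]
    gcongr
    exact_mod_cast this
  · intro m
    have := (hset_comap_bounds (f m) t R _ (h1 m) (h2 m)).2
    simp only [hdens, Fintype.card_fin]
    rw [← add_div, div_pow, ← mul_div_assoc]
    gcongr
    exact_mod_cast this

/-- Points approximated by finite graphs are in `OmegaST`. -/
lemma mem_Omega_of_approx (s t : ℕ) (x y : ℝ)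
    (h : ∀ ε > 0, ∃ (V : Type) (_ : Fintype V) (_ : Nonempty V) (G : SimpleGraph V),
      |hdens s (fun u v => ¬ G.Adj u v) - x| < ε ∧ |hdens t G.Adj - y| < ε) :
    (x, y) ∈ OmegaST s t := by
  classical
  let D : (m : ℕ) → SimpleGraph (Fin m) → ℝ := fun m G =>
    |hdens s (fun u v => ¬ G.Adj u v) - x| + |hdens t G.Adj - y|
  have hex : ∀ m, ∃ G : SimpleGraph (Fin m), ∀ G', D m G ≤ D m G' := fun m =>
    Finite.exists_min (D m)
  choose G hG using hex
  have hD : Tendsto (fun m => D m (G m)) atTop (𝓝 0) := by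
    rw [Metric.tendsto_atTop']
    intro ε hε
    obtain ⟨V, _, _, H, hx, hy⟩ := h (ε / 4) (by positivity)
    choose f h1 h2 using exists_equitable V
    have a1 := tendsto_hdens_blowup f s (fun u v => ¬ H.Adj u v) h1 h2
    have a2 := tendsto_hdens_blowup f t H.Adj h1 h2
    have b1 := ((a1.sub_const x).abs.add (a2.sub_const y).abs).eventually_lt_const
      (show _ < ε by linarith)
    obtain ⟨N, hN⟩ := eventually_atTop.1 b1
    refine ⟨N, fun m hm => ?_⟩
    have c1 := hN m hm.le
    have c2 := hG m (H.comap (f m))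
    have c3 : 0 ≤ D m (G m) := by positivity
    rw [Real.dist_eq, sub_zero, abs_of_nonneg c3]
    exact lt_of_le_of_lt c2 c1
  have fin : ∀ (r : ℕ) (z : ℝ) (u k : ℕ → ℝ), (∀ m, |u m - z| ≤ D m (G m)) →
      (∀ m, r ≤ m → |u m - k m| ≤ err r m) → Tendsto k atTop (𝓝 z) := by
    intro r z u k hu hk
    rw [tendsto_iff_dist_tendsto_zero]
    have := (err_tendsto r).add hD
    rw [add_zero] at this
    refine squeeze_zero' (Eventually.of_forall fun _ => dist_nonneg) ?_ this
    filter_upwards [eventually_ge_atTop r] with m hm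
    rw [Real.dist_eq]
    have p1 := hu m
    have p2 := hk m hm
    rw [abs_le] at *
    constructor <;> linarith
  refine ⟨G, ?_, ?_⟩
  · exact fin s x _ _ (fun m => le_add_of_nonneg_right (abs_nonneg _))
      (fun m hm => abs_hdens_nonadj s m hm (G m))
  · exact fin t y _ _ (fun m => le_add_of_nonneg_left (abs_nonneg _))
      (fun m hm => abs_hdens_adj t m hm (G m))

/-- There are arbitrarily large finite graphs with densities near `x` and below `y`. -/
def Pr (s t : ℕ) (x y : ℝ) : Prop :=
  ∀ δ > 0, ∀ N : ℕ, ∃ (V : Type) (_ : Fintype V) (G : SimpleGraph V),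
    N ≤ Fintype.card V ∧ |hdens s (fun u v => ¬ G.Adj u v) - x| < δ ∧ hdens t G.Adj < y + δ

lemma Pr_of_Omega {s t : ℕ} {x y : ℝ} (h : (x, y) ∈ OmegaST s t) : Pr s t x y := by
  obtain ⟨G, hx, hy⟩ := h
  intro δ hδ N
  have e1 := (err_tendsto s).eventually_lt_const (show 0 < δ / 2 by positivity)
  have e2 := (err_tendsto t).eventually_lt_const (show 0 < δ / 2 by positivity)
  have e3 := (Metric.tendsto_nhds.1 hx) (δ / 2) (by positivity)
  have e4 := (Metric.tendsto_nhds.1 hy) (δ / 2) (by positivity)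
  obtain ⟨n, h1, h2, h3, h4, h5, h6, h7⟩ := (e1.and (e2.and (e3.and (e4.and
    ((eventually_ge_atTop N).and ((eventually_ge_atTop s).and (eventually_ge_atTop t))))))).exists
  have p1 := abs_hdens_nonadj s n h6 (G n)
  have p2 := abs_hdens_adj t n h7 (G n)
  simp only [Real.dist_eq] at h3 h4
  refine ⟨Fin n, inferInstance, G n, by simpa using h5, ?_, ?_⟩
  · rw [abs_lt] at *
    rw [abs_le] at *
    constructor <;> linarith
  · rw [abs_lt] at *
    rw [abs_le] at *
    linarith

lemma Pr_mono {s t : ℕ} {x y y' : ℝ} (h : Pr s t x y) (hy : y ≤ y') : Pr s t x y' := by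
  intro δ hδ N
  obtain ⟨V, i, G, h1, h2, h3⟩ := h δ hδ N
  exact ⟨V, i, G, h1, h2, by linarith⟩

lemma Pr_nonneg {s t : ℕ} {x y : ℝ} (h : Pr s t x y) : 0 ≤ y := by
  by_contra hy
  push Not at hy
  obtain ⟨V, i, G, h1, h2, h3⟩ := h (-y) (by linarith) 0
  have := hdens_nonneg t G.Adj
  linarith

lemma Pr_closed {s t : ℕ} {x y : ℝ} (h : ∀ η > 0, ∃ x' y', |x' - x| < η ∧ y' < y + η ∧ Pr s t x' y') :
    Pr s t x y := by
  intro δ hδ N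
  obtain ⟨x', y', hx, hy, hP⟩ := h (δ / 2) (by positivity)
  obtain ⟨V, i, G, h1, h2, h3⟩ := hP (δ / 2) (by positivity) N
  refine ⟨V, i, G, h1, ?_, by linarith⟩
  rw [abs_lt] at *
  constructor <;> linarith

/-- deleting edges -/
lemma Pr_right {s t : ℕ} {x x' y : ℝ} (h : Pr s t x y) (hx : x ≤ x') (hx' : x' ≤ 1) :
    Pr s t x' y := by
  classical
  intro δ hδ N
  obtain ⟨M, hM⟩ := exists_nat_gt ((s : ℝ) / δ)
  obtain ⟨V, iV, G, h1, h2, h3⟩ := h δ hδ (max N (M + 1))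
  have hN : N ≤ Fintype.card V := (le_max_left _ _).trans h1
  have hMn : M + 1 ≤ Fintype.card V := (le_max_right _ _).trans h1
  have hpos : (0 : ℝ) < Fintype.card V := by
    have : 0 < Fintype.card V := by omega
    exact_mod_cast this
  have hsn : (s : ℝ) / Fintype.card V < δ := by
    rw [div_lt_iff₀ hpos]
    rw [div_lt_iff₀ hδ] at hM
    have : (M : ℝ) ≤ Fintype.card V := by exact_mod_cast (by omega : M ≤ Fintype.card V)
    nlinarith
  let GS : Finset V → SimpleGraph V := fun S =>
    { Adj := fun u v => G.Adj u v ∧ u ∉ S ∧ v ∉ S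
      symm := ⟨fun u v h => ⟨h.1.symm, h.2.2, h.2.1⟩⟩
      loopless := ⟨fun u h => G.loopless.irrefl u h.1⟩ }
  let b : Finset V → ℝ := fun S => hdens s (fun u v => ¬ (GS S).Adj u v)
  have hA : ∀ S, hdens t (GS S).Adj ≤ hdens t G.Adj := by
    intro S
    unfold hdens
    gcongr
    intro φ hφ
    rw [mem_hset] at *
    exact fun i j hij => (hφ i j hij).1
  have hb0 : b ∅ = hdens s (fun u v => ¬ G.Adj u v) := by simp [b, GS]
  have hb1 : b Finset.univ = 1 := by
    have : hset s (fun u v => ¬ (GS Finset.univ).Adj u v) = Finset.univ := by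
      ext φ; simp [mem_hset, GS]
    simp only [b, hdens, this]
    rw [Finset.card_univ, Fintype.card_fun, Fintype.card_fin, Nat.cast_pow]
    exact div_self (by positivity)
  have hstep : ∀ S a, b (insert a S) ≤ b S + s / Fintype.card V := by
    intro S a
    have hsub : hset s (fun u v => ¬ (GS (insert a S)).Adj u v) ⊆
        hset s (fun u v => ¬ (GS S).Adj u v) ∪
        Finset.univ.biUnion (fun i : Fin s =>
          Fintype.piFinset (fun j : Fin s => if j = i then {a} else Finset.univ)) := by
      intro φ hφ
      by_cases hc : ∃ i, φ i = a
      · obtain ⟨i, hi⟩ := hc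
        apply Finset.mem_union_right
        simp only [Finset.mem_biUnion, Finset.mem_univ, true_and, Fintype.mem_piFinset]
        refine ⟨i, fun j => ?_⟩
        split_ifs with hj
        · simp [hj, hi]
        · simp
      · push Not at hc
        apply Finset.mem_union_left
        rw [mem_hset] at *
        intro i j hij hadj
        apply hφ i j hij
        simp only [GS, Finset.mem_insert, not_or] at hadj ⊢
        exact ⟨hadj.1, ⟨hc i, hadj.2.1⟩, hc j, hadj.2.2⟩
    have hcard := Finset.card_le_card hsub
    have hc2 : (Finset.univ.biUnion (fun i : Fin s =>
          Fintype.piFinset (fun j : Fin s => if j = i then ({a} : Finset V) else Finset.univ))).card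
          ≤ s * Fintype.card V ^ (s - 1) := by
      refine Finset.card_biUnion_le.trans ?_
      refine (Finset.sum_le_card_nsmul _ _ (Fintype.card V ^ (s - 1)) ?_).trans (by simp)
      intro i _
      rw [Fintype.card_piFinset]
      have : ∀ j, (if j = i then ({a} : Finset V) else Finset.univ).card =
          if j = i then 1 else Fintype.card V := by
        intro j; split_ifs <;> simp
      simp only [this]
      rw [Finset.prod_ite]
      simp [Finset.filter_ne']
    have hc3 := hcard.trans ((Finset.card_union_le _ _).trans (Nat.add_le_add_left hc2 _))
    have hc4 : ((hset s (fun u v => ¬ (GS (insert a S)).Adj u v)).card : ℝ) ≤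
      (hset s (fun u v => ¬ (GS S).Adj u v)).card + s * (Fintype.card V : ℝ) ^ (s - 1) := by
      exact_mod_cast hc3
    simp only [b, hdens]
    have e : (s : ℝ) / Fintype.card V =
        s * (Fintype.card V : ℝ) ^ (s - 1) / (Fintype.card V : ℝ) ^ s := by
      rcases s with _ | s
      · simp
      · rw [Nat.add_sub_cancel, pow_succ]; field_simp
    rw [e, ← add_div]
    gcongr
  have main : ∀ S, b S < x' ∨ ∃ T, |b T - x'| < δ := by
    intro S
    induction S using Finset.induction_on with
    | empty =>
      by_cases hc : b ∅ < x'
      · exact Or.inl hc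
      · right
        refine ⟨∅, ?_⟩
        rw [hb0] at *
        rw [abs_lt] at *
        constructor <;> linarith
    | insert a S _ ih =>
      rcases ih with ih | ih
      · by_cases hc : b (insert a S) < x'
        · exact Or.inl hc
        · right
          refine ⟨insert a S, ?_⟩
          have := hstep S a
          rw [abs_lt]
          constructor <;> linarith
      · exact Or.inr ih
  obtain ⟨T, hT⟩ : ∃ T, |b T - x'| < δ := by
    rcases main Finset.univ with h | h
    · rw [hb1] at h; linarith
    · exact h
  exact ⟨V, iV, GS T, hN, hT, (hA T).trans_lt h3⟩

/-- join with a clique on `k` vertices -/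
def joinK {V : Type} (G : SimpleGraph V) (k : ℕ) : SimpleGraph (V ⊕ Fin k) where
  Adj := fun a b => a ≠ b ∧ ∀ u v, a = Sum.inl u → b = Sum.inl v → G.Adj u v
  symm := ⟨fun _ _ h => ⟨h.1.symm, fun u v hu hv => (h.2 v u hv hu).symm⟩⟩
  loopless := ⟨fun _ h => h.1 rfl⟩

lemma inl_comp_injective {V W : Type} (t : ℕ) :
    Function.Injective (fun φ : Fin t → V => (fun i => (Sum.inl (φ i) : V ⊕ W))) := by
  intro φ ψ h
  funext i
  exact Sum.inl_injective (congrFun h i)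

lemma joinK_indep {V : Type} [Fintype V] (G : SimpleGraph V) (k s : ℕ) :
    (hset s (fun u v => ¬ G.Adj u v)).card ≤ (hset s (fun u v => ¬ (joinK G k).Adj u v)).card ∧
    (hset s (fun u v => ¬ (joinK G k).Adj u v)).card ≤ (hset s (fun u v => ¬ G.Adj u v)).card + k := by
  classical
  constructor
  · rw [← Finset.card_image_of_injective _ (inl_comp_injective (W := Fin k) s)]
    apply Finset.card_le_card
    intro ψ hψ
    obtain ⟨φ, hφ, rfl⟩ := Finset.mem_image.1 hψ
    rw [mem_hset] at *
    intro i j hij hadj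
    exact hφ i j hij (hadj.2 _ _ rfl rfl)
  · have hsub : hset s (fun u v => ¬ (joinK G k).Adj u v) ⊆
        (hset s (fun u v => ¬ G.Adj u v)).image (fun φ => fun i => Sum.inl (φ i)) ∪
        Finset.univ.image (fun c : Fin k => fun _ : Fin s => (Sum.inr c : V ⊕ Fin k)) := by
      intro ψ hψ
      rw [mem_hset] at hψ
      by_cases hc : ∃ i c, ψ i = Sum.inr c
      · obtain ⟨i, c, hi⟩ := hc
        apply Finset.mem_union_right
        refine Finset.mem_image.2 ⟨c, Finset.mem_univ _, ?_⟩
        funext j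
        by_contra hne
        have hij : i ≠ j := by rintro rfl; exact hne hi.symm
        apply hψ i j hij
        refine ⟨by rw [hi]; exact hne, ?_⟩
        intro u v hu
        rw [hi] at hu
        cases hu
      · push Not at hc
        apply Finset.mem_union_left
        have : ∀ i, ∃ v, Sum.inl v = ψ i := by
          intro i
          rcases h : ψ i with v | c
          · exact ⟨v, rfl⟩
          · exact absurd h (hc i c)
        choose φ hφ using this
        refine Finset.mem_image.2 ⟨φ, ?_, funext hφ⟩
        rw [mem_hset]
        intro i j hij hadj
        apply hψ i j hij
        refine ⟨?_, ?_⟩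
        · rw [← hφ i, ← hφ j]
          intro h
          exact hadj.ne (Sum.inl_injective h)
        · intro u v hu hv
          rw [← hφ] at hu hv
          rw [← Sum.inl_injective hu, ← Sum.inl_injective hv]
          exact hadj
    refine (Finset.card_le_card hsub).trans ((Finset.card_union_le _ _).trans ?_)
    rw [Finset.card_image_of_injective _ (inl_comp_injective s)]
    gcongr
    exact Finset.card_image_le.trans (by simp)

lemma joinK_clique {V : Type} [Fintype V] (G : SimpleGraph V) (k t : ℕ) :
    (hset t (joinK G k).Adj).card + Fintype.card V ^ t ≤
      (hset t G.Adj).card + (Fintype.card V + k) ^ t := by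
  classical
  have himg : ((Finset.univ : Finset (Fin t → V)).image
      (fun φ => fun i => (Sum.inl (φ i) : V ⊕ Fin k))).card = Fintype.card V ^ t := by
    rw [Finset.card_image_of_injective _ (inl_comp_injective t)]; simp
  have hunion : (hset t (joinK G k).Adj ∪ (Finset.univ : Finset (Fin t → V)).image
      (fun φ => fun i => (Sum.inl (φ i) : V ⊕ Fin k))).card ≤ (Fintype.card V + k) ^ t := by
    refine (Finset.card_le_card (Finset.subset_univ _)).trans ?_
    simp
  have hinter : (hset t (joinK G k).Adj ∩ (Finset.univ : Finset (Fin t → V)).image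
      (fun φ => fun i => (Sum.inl (φ i) : V ⊕ Fin k))).card ≤ (hset t G.Adj).card := by
    rw [← Finset.card_image_of_injective (hset t G.Adj) (inl_comp_injective (W := Fin k) t)]
    apply Finset.card_le_card
    intro ψ hψ
    rw [Finset.mem_inter] at hψ
    obtain ⟨φ, _, rfl⟩ := Finset.mem_image.1 hψ.2
    refine Finset.mem_image.2 ⟨φ, ?_, rfl⟩
    have := mem_hset.1 hψ.1
    rw [mem_hset]
    intro i j hij
    exact (this i j hij).2 _ _ rfl rfl
  have := Finset.card_union_add_card_inter (hset t (joinK G k).Adj)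
    ((Finset.univ : Finset (Fin t → V)).image (fun φ => fun i => (Sum.inl (φ i) : V ⊕ Fin k)))
  omega

lemma Pr_left {s t : ℕ} (hs : 2 ≤ s) {x y ρ : ℝ} (h : Pr s t x y) (h0 : 0 < ρ) (h1 : ρ ≤ 1) :
    Pr s t (ρ ^ s * x) (y + (1 - ρ ^ t)) := by
  intro δ hδ N
  let k : ℕ → ℕ := fun n => ⌊(1 / ρ - 1) * (n : ℝ)⌋₊
  let r : ℕ → ℝ := fun n => (n : ℝ) / (n + k n)
  have hr0 : (0 : ℝ) ≤ 1 / ρ - 1 := by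
    rw [sub_nonneg, le_div_iff₀ h0]; linarith
  have hr : Tendsto r atTop (𝓝 ρ) := by
    have a1 := (tendsto_nat_floor_mul_div_atTop (R := ℝ) hr0).comp
      (tendsto_natCast_atTop_atTop (R := ℝ))
    have a2 := (a1.const_add 1).inv₀ (by rw [add_sub_cancel]; positivity)
    have e : (1 + (1 / ρ - 1))⁻¹ = ρ := by rw [add_sub_cancel]; simp
    rw [e] at a2
    refine a2.congr' ?_
    filter_upwards [eventually_gt_atTop 0] with n hn
    have : (0 : ℝ) < n := by exact_mod_cast hn
    simp only [r, k, Function.comp]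
    have : (0 : ℝ) ≤ ⌊(1 / ρ - 1) * (n : ℝ)⌋₊ := by positivity
    field_simp
  have e1 := (Metric.tendsto_nhds.1 (hr.pow s)) (δ / 4) (by positivity)
  have e2 := (Metric.tendsto_nhds.1 (hr.pow t)) (δ / 4) (by positivity)
  have e3 := (tendsto_const_div_atTop_nhds_zero_nat (1 : ℝ)).eventually_lt_const
    (show 0 < δ / 4 by positivity)
  obtain ⟨M, hM⟩ := eventually_atTop.1 (e1.and (e2.and (e3.and
    ((eventually_ge_atTop N).and (eventually_gt_atTop 0)))))
  obtain ⟨V, iV, G, g1, g2, g3⟩ := h (δ / 4) (by positivity) M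
  obtain ⟨m1, m2, m3, m4, m5⟩ := hM _ g1
  have hj1 := joinK_indep G (k (Fintype.card V)) s
  have hj2 := joinK_clique G (k (Fintype.card V)) t
  refine ⟨V ⊕ Fin (k (Fintype.card V)), inferInstance, joinK G (k (Fintype.card V)), ?_, ?_, ?_⟩
  · rw [Fintype.card_sum]; omega
  all_goals
    have hB0 := hdens_nonneg s (fun u v => ¬ G.Adj u v)
    have hB1 := hdens_le_one s (fun u v => ¬ G.Adj u v)
    have hA0 := hdens_nonneg t G.Adj
    have hn : (0 : ℝ) < Fintype.card V := by exact_mod_cast m5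
    have hcard : (Fintype.card (V ⊕ Fin (k (Fintype.card V))) : ℝ) =
      Fintype.card V + k (Fintype.card V) := by simp
    rw [Real.dist_eq] at m1 m2
    simp only [r] at m1 m2
    generalize k (Fintype.card V) = κ at *
    have hκ : (0 : ℝ) ≤ κ := by positivity
    generalize hnn : (Fintype.card V : ℝ) = n at *
    have hr1 : n / (n + κ) ≤ 1 := by
      apply div_le_one_of_le₀ <;> linarith
    have hr0' : 0 ≤ n / (n + κ) := by positivity
    have hnk : 0 < n + κ := by positivity
  · have c1 : hdens s (fun u v => ¬ G.Adj u v) * (n / (n + κ)) ^ s ≤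
        hdens s (fun u v => ¬ (joinK G κ).Adj u v) := by
      unfold hdens
      rw [hcard, hnn, div_pow, div_mul_div_cancel₀ (by positivity)]
      gcongr
      exact hj1.1
    have c2 : hdens s (fun u v => ¬ (joinK G κ).Adj u v) ≤
        hdens s (fun u v => ¬ G.Adj u v) * (n / (n + κ)) ^ s + 1 / n := by
      have d1 : (κ : ℝ) / (n + κ) ^ s ≤ 1 / n := by
        have n1 : 1 ≤ n := by rw [← hnn]; exact_mod_cast m5
        rw [div_le_div_iff₀ (by positivity) hn]
        calc (κ : ℝ) * n ≤ (n + κ) ^ 2 := by nlinarith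
          _ ≤ (n + κ) ^ s := pow_le_pow_right₀ (by linarith) hs
          _ = 1 * (n + κ) ^ s := by ring
      refine le_trans ?_ (add_le_add_right d1 _)
      unfold hdens
      rw [hcard, hnn, div_pow, div_mul_div_cancel₀ (by positivity), ← add_div]
      gcongr
      exact_mod_cast hj1.2
    have hρs : ρ ^ s ≤ 1 := pow_le_one₀ h0.le h1
    have hρs0 : 0 ≤ ρ ^ s := by positivity
    generalize hdens s (fun u v => ¬ G.Adj u v) = b at *
    have c3 : |b * (n / (n + κ)) ^ s - ρ ^ s * x| < δ / 2 := by
      have : b * (n / (n + κ)) ^ s - ρ ^ s * x =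
        b * ((n / (n + κ)) ^ s - ρ ^ s) + ρ ^ s * (b - x) := by ring
      rw [this]
      refine (abs_add_le _ _).trans_lt ?_
      rw [abs_mul, abs_mul, abs_of_nonneg hB0, abs_of_nonneg hρs0]
      have q1 := mul_le_of_le_one_left (abs_nonneg ((n / (n + κ)) ^ s - ρ ^ s)) hB1
      have q2 := mul_le_of_le_one_left (abs_nonneg (b - x)) hρs
      linarith
    rw [abs_lt] at c3 ⊢
    constructor <;> linarith
  · have c1 : hdens t (joinK G κ).Adj ≤ hdens t G.Adj * (n / (n + κ)) ^ t + (1 - (n / (n + κ)) ^ t) := by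
      have hj2' : ((hset t (joinK G κ).Adj).card : ℝ) + n ^ t ≤ (hset t G.Adj).card + (n + κ) ^ t := by
        rw [← hnn]; exact_mod_cast hj2
      unfold hdens
      rw [hcard, hnn, div_pow, div_mul_div_cancel₀ (by positivity)]
      have : ((hset t G.Adj).card : ℝ) / (n + κ) ^ t + (1 - n ^ t / (n + κ) ^ t) =
        ((hset t G.Adj).card + (n + κ) ^ t - n ^ t) / (n + κ) ^ t := by field_simp; ring
      rw [this]
      gcongr
      linarith
    have c2 := mul_le_of_le_one_right hA0 (pow_le_one₀ (n := t) hr0' hr1)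
    rw [abs_lt] at m2
    linarith

lemma Pr_zero_one {s t : ℕ} (hs : 2 ≤ s) : Pr s t 0 1 := by
  intro δ hδ N
  obtain ⟨n, h1, h2, h3⟩ := (((err_tendsto s).eventually_lt_const hδ).and
    ((eventually_ge_atTop N).and (eventually_ge_atTop s))).exists
  refine ⟨Fin n, inferInstance, ⊤, by simpa using h2, ?_, ?_⟩
  · have p := abs_hdens_nonadj s n h3 ⊤
    have hk : kcount s (⊤ : SimpleGraph (Fin n))ᶜ = 0 := by
      have := hset_adj_card s (⊤ : SimpleGraph (Fin n))ᶜ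
      have he : hset s ((⊤ : SimpleGraph (Fin n))ᶜ).Adj = ∅ := by
        ext φ
        simp only [mem_hset, Finset.notMem_empty, iff_false]
        intro h
        have := h ⟨0, by omega⟩ ⟨1, by omega⟩ (by simp)
        simp at this
      rw [he, Finset.card_empty] at this
      rcases Nat.mul_eq_zero.1 this.symm with h | h
      · exact absurd h (Nat.factorial_ne_zero s)
      · exact h
    rw [hk] at p
    simp only [Nat.cast_zero, zero_div] at p
    exact p.trans_lt h1
  · have := hdens_le_one t (⊤ : SimpleGraph (Fin n)).Adj
    linarith

lemma lowerCurve_le_iff {s t : ℕ} (hs : 2 ≤ s) {x : ℝ} (hx : x ∈ Set.Icc (0 : ℝ) 1) (y : ℝ) :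
    lowerCurve s t x ≤ y ↔ Pr s t x y := by
  have hne : {y | Pr s t x y}.Nonempty := ⟨1, Pr_right (Pr_zero_one hs) hx.1 hx.2⟩
  have hbd : BddBelow {y | Pr s t x y} := ⟨0, fun y hy => Pr_nonneg hy⟩
  set y0 := sInf {y | Pr s t x y} with hy0
  have hP : Pr s t x y0 := by
    apply Pr_closed
    intro η hη
    obtain ⟨y', h1, h2⟩ := exists_lt_of_csInf_lt hne (show y0 < y0 + η by linarith)
    exact ⟨x, y', by simpa using hη, h2, h1⟩
  have hmem : (x, y0) ∈ OmegaST s t := by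
    apply mem_Omega_of_approx
    intro ε hε
    have hnot : ¬ Pr s t x (y0 - ε / 2) := by
      intro h
      have := csInf_le hbd h
      linarith
    unfold Pr at hnot
    push Not at hnot
    obtain ⟨δ, hδ, N, hN⟩ := hnot
    obtain ⟨V, iV, G, g1, g2, g3⟩ := hP (min δ ε) (by positivity) (max N 1)
    have hcard : 0 < Fintype.card V := by
      have := (le_max_right N 1).trans g1
      omega
    have g4 := hN V iV G ((le_max_left _ _).trans g1) (g2.trans_le (min_le_left _ _))
    refine ⟨V, iV, Fintype.card_pos_iff.1 hcard, G, g2.trans_le (min_le_right _ _), ?_⟩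
    have := min_le_right δ ε
    rw [abs_lt]
    constructor <;> linarith
  have heq : lowerCurve s t x = y0 := by
    have hl : IsLeast {y : ℝ | (x, y) ∈ OmegaST s t} y0 :=
      ⟨hmem, fun y hy => csInf_le hbd (Pr_of_Omega hy)⟩
    exact hl.csInf_eq
  rw [heq]
  exact ⟨fun h => Pr_mono hP h, fun h => csInf_le hbd h⟩

/-- For all `s, t ≥ 2`, the lower bounding curve `c_{s,t}` is weakly decreasing and
continuous on `[0,1]`, and differentiable at almost every `x ∈ [0,1]`. -/
theorem lowerCurve_antitone_continuous_ae_differentiable (s t : ℕ)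
    (hs : 2 ≤ s) (ht : 2 ≤ t) :
    AntitoneOn (lowerCurve s t) (Set.Icc 0 1) ∧
    ContinuousOn (lowerCurve s t) (Set.Icc 0 1) ∧
    (∀ᵐ x ∂MeasureTheory.volume, x ∈ Set.Icc (0 : ℝ) 1 →
      DifferentiableAt ℝ (lowerCurve s t) x) := by
  have hanti : AntitoneOn (lowerCurve s t) (Set.Icc 0 1) := by
    intro x hx x' hx' hxx
    rw [lowerCurve_le_iff hs hx']
    exact Pr_right ((lowerCurve_le_iff hs hx _).1 le_rfl) hxx hx'.2
  refine ⟨hanti, ?_, ?_⟩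
  · intro x hx
    unfold ContinuousWithinAt
    rw [tendsto_order]
    constructor
    · intro y hy
      have hn : ¬ Pr s t x y := fun h => absurd ((lowerCurve_le_iff hs hx _).2 h) (not_le.2 hy)
      have hn' : ∃ η > 0, ∀ x', |x' - x| < η → ¬ Pr s t x' y := by
        by_contra hc
        push Not at hc
        apply hn
        apply Pr_closed
        intro η hη
        obtain ⟨x', h1, h2⟩ := hc η hη
        exact ⟨x', y, h1, by linarith, h2⟩
      obtain ⟨η, hη, hh⟩ := hn'
      filter_upwards [self_mem_nhdsWithin, mem_nhdsWithin_of_mem_nhds (Metric.ball_mem_nhds x hη)]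
        with x' hx' hb
      rw [Metric.mem_ball, Real.dist_eq] at hb
      by_contra hc
      exact hh x' hb ((lowerCurve_le_iff hs hx' _).1 (not_lt.1 hc))
    · intro y hy
      rcases hx.1.eq_or_lt with h0 | h0
      · filter_upwards [self_mem_nhdsWithin] with x' hx'
        exact (hanti hx hx' (by rw [← h0]; exact hx'.1)).trans_lt hy
      · obtain ⟨ρ, hρ0, hρ1, hρ⟩ : ∃ ρ : ℝ, 0 < ρ ∧ ρ < 1 ∧ lowerCurve s t x + (1 - ρ ^ t) < y := by
          have hc : Tendsto (fun ρ : ℝ => lowerCurve s t x + (1 - ρ ^ t)) (𝓝[<] 1)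
              (𝓝 (lowerCurve s t x + (1 - 1 ^ t))) := by
            apply tendsto_nhdsWithin_of_tendsto_nhds
            exact Continuous.tendsto (by fun_prop) 1
          have hc' := hc.eventually_lt_const (show _ < y by simpa using hy)
          obtain ⟨ρ, h1, h2⟩ := (hc'.and (Ioo_mem_nhdsLT (show (0 : ℝ) < 1 by norm_num))).exists
          exact ⟨ρ, h2.1, h2.2, h1⟩
        have hps : ρ ^ s < 1 := pow_lt_one₀ hρ0.le hρ1 (by omega)
        have hlt : ρ ^ s * x < x := by nlinarith
        have hmem : ρ ^ s * x ∈ Set.Icc (0 : ℝ) 1 := ⟨by positivity, hlt.le.trans hx.2⟩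
        have hle := (lowerCurve_le_iff (t := t) hs hmem _).2
          (Pr_left hs ((lowerCurve_le_iff hs hx _).1 le_rfl) hρ0 hρ1.le)
        filter_upwards [self_mem_nhdsWithin, mem_nhdsWithin_of_mem_nhds (Ioi_mem_nhds hlt)]
          with x' hx' hb
        exact ((hanti hmem hx' (le_of_lt hb)).trans hle).trans_lt hρ
  · have hm : MonotoneOn (fun x => - lowerCurve s t x) (Set.Icc 0 1) := hanti.neg
    have h0 : ∀ᵐ x : ℝ ∂MeasureTheory.volume, x ≠ 0 := MeasureTheory.Measure.ae_ne _ _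
    have h1 : ∀ᵐ x : ℝ ∂MeasureTheory.volume, x ≠ 1 := MeasureTheory.Measure.ae_ne _ _
    filter_upwards [hm.ae_differentiableWithinAt_of_mem, h0, h1] with x hx hx0 hx1 hmem
    have hnb : Set.Icc (0 : ℝ) 1 ∈ 𝓝 x :=
      Icc_mem_nhds (lt_of_le_of_ne hmem.1 (Ne.symm hx0)) (lt_of_le_of_ne hmem.2 hx1)
    have := ((hx hmem).differentiableAt hnb).neg
    simpa using this
end

section
/- For all integers s, t ≥ 2, the upper bounding curve C_{s,t}(x) = sup{ y : (x,y) ∈ Ω_{s,t} } is a weakly decreasing (antitone) and continuous function of x on [0,1], and it is differentiable at almost every x ∈ [0,1]. -/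
open Filter Topology

/-- The upper bounding curve `C_{s,t}(x) = sup { y : (x,y) ∈ Ω_{s,t} }`. -/
noncomputable def upperCurve (s t : ℕ) (x : ℝ) : ℝ :=
  sSup {y : ℝ | (x, y) ∈ OmegaST s t}


/-- Clique density. -/
noncomputable def dens {n : ℕ} (t : ℕ) (G : SimpleGraph (Fin n)) : ℝ :=
  (kcount t G : ℝ) / (n.choose t : ℝ)

theorem kcount_eq {n : ℕ} (t : ℕ) (G : SimpleGraph (Fin n))
    [DecidablePred (fun S : Finset (Fin n) => G.IsNClique t S)] :
    kcount t G = (Finset.univ.filter (fun S : Finset (Fin n) => G.IsNClique t S)).card := by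
  unfold kcount
  rw [Nat.card_eq_fintype_card, Fintype.card_subtype]

theorem kcount_add_not {n : ℕ} (t : ℕ) (K : SimpleGraph (Fin n))
    (F : Finset (Finset (Fin n)))
    (hF : ∀ S, S ∈ F ↔ S.card = t ∧ ¬ K.IsNClique t S) :
    F.card + kcount t K = n.choose t := by
  classical
  rw [kcount_eq, ← Finset.card_union_of_disjoint]
  · have : F ∪ Finset.univ.filter (fun S : Finset (Fin n) => K.IsNClique t S)
        = Finset.powersetCard t (Finset.univ : Finset (Fin n)) := by
      ext S
      simp only [Finset.mem_union, hF, Finset.mem_filter, Finset.mem_univ, true_and,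
        Finset.mem_powersetCard, Finset.subset_univ]
      have : K.IsNClique t S → S.card = t := fun h => h.card_eq
      tauto
    rw [this]; simp
  · rw [Finset.disjoint_left]
    intro S hS hS'
    exact ((hF S).1 hS).2 (Finset.mem_filter.1 hS').2

theorem kcount_le_choose {n : ℕ} (t : ℕ) (G : SimpleGraph (Fin n)) :
    kcount t G ≤ n.choose t := by
  classical
  rw [kcount_eq]
  calc _ ≤ (Finset.powersetCard t (Finset.univ : Finset (Fin n))).card := by
        apply Finset.card_le_card
        intro S hS
        simp only [Finset.mem_filter, Finset.mem_univ, true_and] at hS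
        simp [Finset.mem_powersetCard, hS.card_eq]
    _ = _ := by simp

theorem kcount_mono {n : ℕ} (t : ℕ) {G H : SimpleGraph (Fin n)} (h : G ≤ H) :
    kcount t G ≤ kcount t H := by
  classical
  rw [kcount_eq, kcount_eq]
  apply Finset.card_le_card
  intro S hS
  simp only [Finset.mem_filter, Finset.mem_univ, true_and] at hS ⊢
  exact hS.mono h

theorem dens_mem {n : ℕ} (t : ℕ) (G : SimpleGraph (Fin n)) : dens t G ∈ Set.Icc (0 : ℝ) 1 := by
  constructor
  · unfold dens; positivity
  · unfold dens
    apply div_le_one_of_le₀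
    · exact_mod_cast kcount_le_choose t G
    · positivity

theorem dens_mono {n : ℕ} (t : ℕ) {G H : SimpleGraph (Fin n)} (h : G ≤ H) :
    dens t G ≤ dens t H := by
  unfold dens
  gcongr
  exact kcount_mono t h

theorem card_supersets {n : ℕ} (a : ℕ) (S : Finset (Fin n)) (h : S.card ≤ a) :
    ((Finset.powersetCard a (Finset.univ : Finset (Fin n))).filter (fun A => S ⊆ A)).card
      = (n - S.card).choose (a - S.card) := by
  classical
  have : ((Finset.powersetCard a (Finset.univ : Finset (Fin n))).filter (fun A => S ⊆ A))
      = (Finset.powersetCard (a - S.card) Sᶜ).image (fun B => S ∪ B) := by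
    ext A
    simp only [Finset.mem_filter, Finset.mem_powersetCard, Finset.mem_image, Finset.subset_univ,
      true_and]
    constructor
    · rintro ⟨hA, hSA⟩
      refine ⟨A \ S, ⟨?_, ?_⟩, ?_⟩
      · intro x hx; simp at hx ⊢; exact hx.2
      · rw [Finset.card_sdiff_of_subset hSA, hA]
      · exact Finset.union_sdiff_of_subset hSA
    · rintro ⟨B, ⟨hB, hc⟩, rfl⟩
      refine ⟨?_, Finset.subset_union_left⟩
      rw [Finset.card_union_of_disjoint, hc]
      · omega
      · exact (Finset.disjoint_left.2 fun x hx hx' => by have := hB hx'; simp at this; exact this hx)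
  rw [this, Finset.card_image_of_injOn, Finset.card_powersetCard, Finset.card_compl,
    Fintype.card_fin]
  intro B hB C hC h
  rw [Finset.mem_coe, Finset.mem_powersetCard] at hB hC
  have key : ∀ D : Finset (Fin n), D ⊆ Sᶜ → (S ∪ D) \ S = D := by
    intro D hD
    ext x
    have := @hD x
    simp at this ⊢
    tauto
  rw [← key B hB.1, ← key C hC.1]
  simp only at h
  rw [h]

/-- Changing edges touching `A` changes few cliques. -/
theorem kcount_change {n : ℕ} (t : ℕ) (ht : 1 ≤ t) (A : Finset (Fin n))
    (G H : SimpleGraph (Fin n))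
    (h : ∀ a b, a ∉ A → b ∉ A → G.Adj a b → H.Adj a b) :
    kcount t G ≤ kcount t H + A.card * (n - 1).choose (t - 1) := by
  classical
  rw [kcount_eq, kcount_eq]
  have hsub : Finset.univ.filter (fun S : Finset (Fin n) => G.IsNClique t S) ⊆
      Finset.univ.filter (fun S : Finset (Fin n) => H.IsNClique t S) ∪
      A.biUnion (fun v => (Finset.powersetCard t (Finset.univ : Finset (Fin n))).filter
        (fun S => {v} ⊆ S)) := by
    intro S hS
    simp only [Finset.mem_filter, Finset.mem_univ, true_and] at hS
    simp only [Finset.mem_union, Finset.mem_filter, Finset.mem_univ, true_and, Finset.mem_biUnion,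
      Finset.mem_powersetCard, Finset.subset_univ, Finset.singleton_subset_iff]
    by_cases hA : ∃ v ∈ A, v ∈ S
    · obtain ⟨v, hv, hvS⟩ := hA
      exact Or.inr ⟨v, hv, hS.card_eq, hvS⟩
    · push Not at hA
      left
      refine ⟨?_, hS.card_eq⟩
      intro a ha b hb hab
      exact h a b (fun h' => hA a h' ha) (fun h' => hA b h' hb) (hS.isClique ha hb hab)
  refine (Finset.card_le_card hsub).trans ((Finset.card_union_le _ _).trans ?_)
  gcongr
  apply Finset.card_biUnion_le_card_mul
  intro v _
  rw [card_supersets _ _ (by simpa using ht)]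
  simp

theorem choose_ratio {n t : ℕ} (hn : 1 ≤ n) (ht : 1 ≤ t) (htn : t ≤ n) :
    ((n - 1).choose (t - 1) : ℝ) / (n.choose t : ℝ) = t / n := by
  obtain ⟨n, rfl⟩ := Nat.exists_eq_add_of_le' hn
  obtain ⟨t, rfl⟩ := Nat.exists_eq_add_of_le' ht
  have h := Nat.add_one_mul_choose_eq n t
  have hp : 0 < (n+1).choose (t+1) := Nat.choose_pos htn
  rw [div_eq_div_iff (by positivity) (by positivity)]
  simp only [Nat.add_sub_cancel]
  have : ((n + 1 : ℕ) * n.choose t : ℝ) = ((n+1).choose (t+1) : ℝ) * (t + 1 : ℕ) := by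
    exact_mod_cast h
  linarith

theorem dens_change {n : ℕ} (t : ℕ) (ht : 1 ≤ t) (htn : t ≤ n) (A : Finset (Fin n))
    (G H : SimpleGraph (Fin n))
    (h : ∀ a b, a ∉ A → b ∉ A → G.Adj a b → H.Adj a b) :
    dens t G ≤ dens t H + A.card * (t / n) := by
  have h1 := kcount_change t ht A G H h
  have hp : 0 < n.choose t := Nat.choose_pos htn
  rw [← choose_ratio (by omega) ht htn]
  unfold dens
  rw [mul_div_assoc', ← add_div]
  gcongr
  exact_mod_cast h1

theorem dens_bot {n : ℕ} (t : ℕ) (ht : 2 ≤ t) : dens t (⊥ : SimpleGraph (Fin n)) = 0 := by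
  classical
  have : kcount t (⊥ : SimpleGraph (Fin n)) = 0 := by
    rw [kcount_eq, Finset.card_eq_zero, Finset.filter_eq_empty_iff]
    intro S _ hS
    have h1 : 1 < S.card := by rw [hS.card_eq]; omega
    obtain ⟨a, ha, b, hb, hab⟩ := Finset.one_lt_card.1 h1
    exact hS.isClique ha hb hab
  simp [dens, this]

theorem dens_top {n : ℕ} (t : ℕ) (htn : t ≤ n) : dens t (⊤ : SimpleGraph (Fin n)) = 1 := by
  classical
  have : kcount t (⊤ : SimpleGraph (Fin n)) = n.choose t := by
    rw [kcount_eq]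
    have : (Finset.univ.filter (fun S : Finset (Fin n) => (⊤ : SimpleGraph (Fin n)).IsNClique t S))
      = Finset.powersetCard t (Finset.univ : Finset (Fin n)) := by
      ext S
      simp only [Finset.mem_filter, Finset.mem_univ, true_and, Finset.mem_powersetCard,
        Finset.subset_univ]
      constructor
      · intro h; exact h.card_eq
      · intro h; exact ⟨fun a _ b _ hab => hab, h⟩
    rw [this]; simp
  have hp : 0 < n.choose t := Nat.choose_pos htn
  unfold dens
  rw [this, div_self]
  positivity

/-- Add edges until the independence density drops to about `x`. -/
theorem exists_add_edges {n : ℕ} (s : ℕ) (hs : 2 ≤ s) (hsn : s ≤ n) (G : SimpleGraph (Fin n))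
    (x : ℝ) (hx0 : 0 ≤ x) (hx : x ≤ dens s Gᶜ) :
    ∃ H : SimpleGraph (Fin n), G ≤ H ∧ x ≤ dens s Hᶜ ∧ dens s Hᶜ ≤ x + s / n := by
  classical
  obtain ⟨H, hH⟩ := (Set.toFinite {H : SimpleGraph (Fin n) | G ≤ H ∧ x ≤ dens s Hᶜ}).exists_maximal
    ⟨G, le_refl _, hx⟩
  refine ⟨H, hH.prop.1, hH.prop.2, ?_⟩
  by_cases hT : H = ⊤
  · subst hT
    rw [compl_top, dens_bot s hs]
    positivity
  · have : ∃ u v, u ≠ v ∧ ¬ H.Adj u v := by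
      by_contra hc
      push Not at hc
      apply hT
      ext u v
      simp only [SimpleGraph.top_adj]
      exact ⟨fun h => h.ne, hc u v⟩
    obtain ⟨u, v, huv, hadj⟩ := this
    have hlt : ¬ x ≤ dens s (H ⊔ SimpleGraph.edge u v)ᶜ := by
      intro hle
      have := hH.le_of_ge (y := H ⊔ SimpleGraph.edge u v) ⟨hH.prop.1.trans le_sup_left, hle⟩
        le_sup_left
      apply hadj
      apply this
      right
      simp [SimpleGraph.edge_adj, huv]
    have := dens_change s (by omega) hsn {u} Hᶜ (H ⊔ SimpleGraph.edge u v)ᶜ (by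
      intro a b ha hb hab
      simp only [Finset.mem_singleton] at ha hb
      simp only [SimpleGraph.compl_adj, SimpleGraph.sup_adj, SimpleGraph.edge_adj] at hab ⊢
      refine ⟨hab.1, ?_⟩
      rintro (h | h)
      · exact hab.2 h
      · rcases h.1 with h | h
        · exact ha h.1
        · exact hb h.2)
    rw [Finset.card_singleton, Nat.cast_one, one_mul] at this
    push Not at hlt
    linarith

/-- Some `a`-subset has at least the average number of members of a family of `s`-sets. -/
theorem exists_dense_subset {n : ℕ} (s a : ℕ) (hsa : s ≤ a) (han : a ≤ n)
    (F : Finset (Finset (Fin n))) (hF : ∀ S ∈ F, S.card = s) :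
    ∃ A : Finset (Fin n), A.card = a ∧
      F.card * a.choose s ≤ (F.filter (fun S => S ⊆ A)).card * n.choose s := by
  classical
  by_contra hc
  push Not at hc
  have h1 : ∑ A ∈ Finset.powersetCard a (Finset.univ : Finset (Fin n)),
      (F.filter (fun S => S ⊆ A)).card = F.card * (n - s).choose (a - s) := by
    simp_rw [Finset.card_filter]
    rw [Finset.sum_comm]
    simp_rw [← Finset.card_filter]
    rw [Finset.sum_congr rfl (g := fun _ => (n - s).choose (a - s))]
    · simp
    · intro S hS
      rw [card_supersets a S (by rw [hF S hS]; exact hsa), hF S hS]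
  have h2 : ∑ A ∈ Finset.powersetCard a (Finset.univ : Finset (Fin n)),
      (F.filter (fun S => S ⊆ A)).card * n.choose s <
      ∑ A ∈ Finset.powersetCard a (Finset.univ : Finset (Fin n)), F.card * a.choose s := by
    apply Finset.sum_lt_sum_of_nonempty
    · rw [Finset.powersetCard_nonempty]; simpa using han
    · intro A hA
      exact hc A (Finset.mem_powersetCard.1 hA).2
  rw [← Finset.sum_mul, h1] at h2
  simp only [Finset.sum_const, Finset.card_powersetCard, Finset.card_univ, Fintype.card_fin,
    smul_eq_mul] at h2
  have h3 := Nat.choose_mul (n := n) hsa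
  have : F.card * (n - s).choose (a - s) * n.choose s = n.choose a * (F.card * a.choose s) := by
    calc _ = F.card * (n.choose s * (n - s).choose (a - s)) := by ring
      _ = F.card * (n.choose a * a.choose s) := by rw [h3]
      _ = _ := by ring
  omega

/-- Isolate a set of vertices. -/
def isol {n : ℕ} (A : Finset (Fin n)) (G : SimpleGraph (Fin n)) : SimpleGraph (Fin n) where
  Adj a b := G.Adj a b ∧ a ∉ A ∧ b ∉ A
  symm := ⟨fun _ _ h => ⟨h.1.symm, h.2.2, h.2.1⟩⟩
  loopless := ⟨fun _ h => h.1.ne rfl⟩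

theorem exists_isolate {n : ℕ} (s t a : ℕ) (ht : 1 ≤ t) (htn : t ≤ n) (hsa : s ≤ a) (han : a ≤ n)
    (G : SimpleGraph (Fin n)) :
    ∃ H : SimpleGraph (Fin n),
      dens s Gᶜ + (1 - dens s Gᶜ) * ((a.choose s : ℝ) / n.choose s) ≤ dens s Hᶜ ∧
      dens t G ≤ dens t H + a * (t / n) := by
  classical
  obtain ⟨F, hFm⟩ : ∃ F : Finset (Finset (Fin n)), ∀ S, S ∈ F ↔ S.card = s ∧ ¬ Gᶜ.IsNClique s S :=
    ⟨Finset.univ.filter (fun S => S.card = s ∧ ¬ Gᶜ.IsNClique s S), fun S => by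
      simp only [Finset.mem_filter, Finset.mem_univ, true_and]⟩
  obtain ⟨A, hA, hcard⟩ := exists_dense_subset s a hsa han F
    (fun S hS => ((hFm S).1 hS).1)
  refine ⟨isol A G, ?_, ?_⟩
  · have hF : F.card + kcount s Gᶜ = n.choose s := kcount_add_not s _ F hFm
    have hk : kcount s Gᶜ + (F.filter (fun S => S ⊆ A)).card ≤ kcount s (isol A G)ᶜ := by
      rw [kcount_eq, kcount_eq, ← Finset.card_union_of_disjoint]
      · apply Finset.card_le_card
        intro S hS
        simp only [hFm, Finset.mem_union, Finset.mem_filter, Finset.mem_univ, true_and] at hS ⊢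
        rcases hS with hS | hS
        · refine hS.mono ?_
          intro u v huv
          rw [SimpleGraph.compl_adj] at huv ⊢
          exact ⟨huv.1, fun h => huv.2 h.1⟩
        · refine ⟨?_, hS.1.1⟩
          intro u hu v hv huv
          rw [SimpleGraph.compl_adj]
          exact ⟨huv, fun h => h.2.1 (hS.2 hu)⟩
      · rw [Finset.disjoint_left]
        intro S hS hS'
        simp only [hFm, Finset.mem_filter, Finset.mem_univ, true_and] at hS hS'
        exact hS'.1.2 hS
    have hp : (0:ℝ) < n.choose s := by exact_mod_cast Nat.choose_pos (hsa.trans han)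
    have hF' : (F.card : ℝ) + kcount s Gᶜ = n.choose s := by exact_mod_cast hF
    have hk' : (kcount s Gᶜ : ℝ) + (F.filter (fun S => S ⊆ A)).card ≤ kcount s (isol A G)ᶜ := by
      exact_mod_cast hk
    have hc' : (F.card : ℝ) * a.choose s ≤ (F.filter (fun S => S ⊆ A)).card * n.choose s := by
      exact_mod_cast hcard
    have h1 : 1 - dens s Gᶜ = F.card / n.choose s := by
      unfold dens
      rw [eq_div_iff hp.ne', sub_mul, div_mul_cancel₀ _ hp.ne']; linarith
    rw [h1]
    unfold dens
    have h2 : (F.card : ℝ) / n.choose s * (a.choose s / n.choose s) ≤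
        ((F.filter (fun S => S ⊆ A)).card : ℝ) / n.choose s := by
      rw [div_mul_div_comm, div_le_div_iff₀ (by positivity) hp]
      nlinarith
    refine (add_le_add_right h2 _).trans ?_
    rw [← add_div]
    gcongr
  · have := dens_change t ht htn A G (isol A G) (fun u v hu hv h => ⟨h, hu, hv⟩)
    rwa [hA] at this

/-- Blow-up lower bound for families. -/
theorem family_lower {m N q t : ℕ} (hq : m * q ≤ N) (φ : Fin N → Fin m)
    (hφ : ∀ i, (φ i : ℕ) = i % m) (F : Finset (Finset (Fin m)))
    (hF : ∀ S ∈ F, S.card = t) (F' : Finset (Finset (Fin N)))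
    (hF' : ∀ T : Finset (Fin N), T.card = t → T.image φ ∈ F → T ∈ F') :
    F.card * q ^ t ≤ F'.card := by
  classical
  have hlt : ∀ (v : Fin m) (j : Fin q), (v : ℕ) + m * j < N := by
    intro v j
    have hv := v.2
    have hj := j.2
    calc (v : ℕ) + m * j < m + m * j := by omega
      _ = m * (j + 1) := by ring
      _ ≤ m * q := Nat.mul_le_mul_left _ (by omega)
      _ ≤ N := hq
  let e : Fin m → Fin q → Fin N := fun v j => ⟨v + m * j, hlt v j⟩
  have he : ∀ v j, φ (e v j) = v := by
    intro v j
    apply Fin.ext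
    rw [hφ]
    simp [e, Nat.mod_eq_of_lt v.2]
  have heinj : ∀ v j j', e v j = e v j' → j = j' := by
    intro v j j' h
    have h1 := congrArg Fin.val h
    have : 0 < m := by have := v.2; omega
    simp only [e] at h1
    apply Fin.ext
    have h2 : m * (j : ℕ) = m * j' := by omega
    exact Nat.eq_of_mul_eq_mul_left this h2
  have hsum : F.card * q ^ t ≤ ∑ S ∈ F, (F'.filter (fun T => T.image φ = S)).card := by
    rw [← smul_eq_mul]
    apply Finset.card_nsmul_le_sum
    intro S hS
    have : q ^ t = (Finset.univ : Finset (S → Fin q)).card := by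
      simp [hF S hS]
    rw [this]
    have himg : ∀ f : S → Fin q, (Finset.univ.image (fun v : S => e v (f v))).image φ = S := by
      intro f
      rw [Finset.image_image]
      ext w
      simp [he]
    apply Finset.card_le_card_of_injOn (fun f => Finset.univ.image (fun v : S => e v (f v)))
    · intro f _
      simp only [Finset.coe_filter, Set.mem_ofPred_eq]
      refine ⟨hF' _ ?_ ?_, himg f⟩
      · rw [Finset.card_image_of_injective]
        · simp [hF S hS]
        · intro v w hvw
          have := congrArg φ hvw
          simp only [he] at this
          exact Subtype.ext this
      · rw [himg f]; exact hS
    · intro f _ g _ hfg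
      funext v
      have hmem : e v (f v) ∈ Finset.univ.image (fun v : S => e v (g v)) := by
        simp only at hfg
        rw [← hfg]
        exact Finset.mem_image_of_mem _ (Finset.mem_univ v)
      obtain ⟨w, _, hw⟩ := Finset.mem_image.1 hmem
      have := congrArg φ hw
      simp only [he] at this
      have hwv : w = v := Subtype.ext this
      subst hwv
      exact (heinj _ _ _ hw).symm
  refine hsum.trans ?_
  rw [← Finset.card_biUnion]
  · apply Finset.card_le_card
    intro T hT
    simp only [Finset.mem_biUnion, Finset.mem_filter] at hT
    obtain ⟨_, _, h, _⟩ := hT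
    exact h
  · intro S _ S' _ hne
    rw [Function.onFun, Finset.disjoint_left]
    intro T hT hT'
    simp only [Finset.mem_filter] at hT hT'
    exact hne (hT.2.symm.trans hT'.2)

theorem ratio_bound {m N t : ℕ} (hm : 1 ≤ m) (htm : t ≤ m) (hN : m ^ 2 ≤ N) :
    1 - (m.choose t * (N / m) ^ t : ℕ) / (N.choose t : ℝ) ≤ (t ^ 2 + t : ℝ) / m := by
  have hmN : m ≤ N := by nlinarith
  have hp : (0:ℝ) < N.choose t := by exact_mod_cast Nat.choose_pos (htm.trans hmN)
  have hm0 : (0:ℝ) < m := by exact_mod_cast hm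
  have hN0 : (0:ℝ) < N := by exact_mod_cast (by omega : 0 < N)
  have h1 : (N.choose t : ℝ) * t.factorial ≤ (N:ℝ) ^ t := by
    have := Nat.descFactorial_le_pow N t
    rw [Nat.descFactorial_eq_factorial_mul_choose] at this
    rw [mul_comm]
    exact_mod_cast this
  have h2 : ((m:ℝ) - t) ^ t ≤ m.choose t * t.factorial := by
    have := Nat.pow_sub_le_descFactorial m t
    rw [Nat.descFactorial_eq_factorial_mul_choose] at this
    have h3 : (((m + 1 - t : ℕ) : ℝ)) ^ t ≤ t.factorial * m.choose t := by exact_mod_cast this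
    rw [mul_comm]
    refine le_trans ?_ h3
    have htm' : (t:ℝ) ≤ m := by exact_mod_cast htm
    apply pow_le_pow_left₀
    · linarith
    · rw [Nat.cast_sub (by omega)]; push_cast; linarith
  have hq : (N:ℝ) / m - 1 ≤ (N / m : ℕ) := by
    have := Nat.lt_div_mul_add (a := N) (b := m) (by omega)
    have h4 : (N:ℝ) < (N/m : ℕ) * m + m := by exact_mod_cast this
    rw [sub_le_iff_le_add, div_le_iff₀ hm0]
    nlinarith
  set u : ℝ := (1 - t / m) * (1 - m / N) with hu
  have htm' : (t:ℝ) / m ≤ 1 := by rw [div_le_one hm0]; exact_mod_cast htm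
  have hmN' : (m:ℝ) / N ≤ 1 := by rw [div_le_one hN0]; exact_mod_cast hmN
  have hu0 : 0 ≤ u := mul_nonneg (by linarith) (by linarith)
  have hmN2 : (m:ℝ) / N ≤ 1 / m := by
    rw [div_le_div_iff₀ hN0 hm0]
    have : ((m ^ 2 : ℕ) : ℝ) ≤ N := by exact_mod_cast hN
    push_cast at this
    nlinarith
  have hu1 : 1 - (t + 1 : ℝ) / m ≤ u := by
    rw [hu, add_div]
    have : 0 ≤ (t:ℝ) / m * (m / N) := by positivity
    nlinarith
  have hbern : 1 - (t ^ 2 + t : ℝ) / m ≤ u ^ t := by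
    have := one_add_mul_le_pow (a := u - 1) (by linarith) t
    have h5 : (t:ℝ) * (1 - (t+1)/m - 1) ≤ t * (u - 1) := by gcongr
    have h6 : (t:ℝ) * (1 - (t+1)/m - 1) = - ((t^2+t)/m) := by ring
    have h7 : (1 + (u - 1)) ^ t = u ^ t := by ring_nf
    linarith
  have hmain : u ^ t ≤ (m.choose t * (N / m) ^ t : ℕ) / (N.choose t : ℝ) := by
    rw [le_div_iff₀ hp]
    have hf : (0:ℝ) < t.factorial := by exact_mod_cast t.factorial_pos
    rw [← mul_le_mul_iff_left₀ hf]
    calc u ^ t * N.choose t * t.factorial = u ^ t * (N.choose t * t.factorial) := by ring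
      _ ≤ u ^ t * N ^ t := by gcongr
      _ = ((m - t) * (N / m - 1)) ^ t := by
        rw [← mul_pow]; congr 1; rw [hu]; field_simp
      _ = (m - t : ℝ) ^ t * ((N:ℝ) / m - 1) ^ t := by rw [mul_pow]
      _ ≤ (m.choose t * t.factorial) * ((N / m : ℕ) : ℝ) ^ t := by
        have : (1:ℝ) ≤ N / m := by rw [le_div_iff₀ hm0]; simpa using (by exact_mod_cast hmN)
        gcongr
      _ = _ := by push_cast; ring
  linarith

theorem blow_one {m N t : ℕ} (hm : 1 ≤ m) (htm : t ≤ m) (hN : m ^ 2 ≤ N)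
    (φ : Fin N → Fin m) (hφ : ∀ i, (φ i : ℕ) = i % m)
    (G : SimpleGraph (Fin m)) (H : SimpleGraph (Fin N))
    (hGH : ∀ a b, φ a ≠ φ b → (H.Adj a b ↔ G.Adj (φ a) (φ b))) :
    |dens t H - dens t G| ≤ (t ^ 2 + t : ℝ) / m := by
  classical
  have hmN : m ≤ N := by nlinarith
  have hr := ratio_bound hm htm hN
  have hcl : ∀ T : Finset (Fin N), T.card = t → (T.image φ).card = t →
      (H.IsNClique t T ↔ G.IsNClique t (T.image φ)) := by
    intro T hT hT'
    have hinj : Set.InjOn φ T := Finset.card_image_iff.1 (hT'.trans hT.symm)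
    constructor
    · intro h
      refine ⟨?_, hT'⟩
      intro a ha b hb hab
      simp only [Finset.coe_image, Set.mem_image, Finset.mem_coe] at ha hb
      obtain ⟨a, ha, rfl⟩ := ha
      obtain ⟨b, hb, rfl⟩ := hb
      exact (hGH a b hab).1 (h.isClique ha hb (fun h => hab (by rw [h])))
    · intro h
      refine ⟨?_, hT⟩
      intro a ha b hb hab
      have hne : φ a ≠ φ b := fun h' => hab (hinj ha hb h')
      exact (hGH a b hne).2 (h.isClique (by simpa using ⟨a, ha, rfl⟩) (by simpa using ⟨b, hb, rfl⟩)
        hne)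
  have key : ∀ (k : ℕ) (K : SimpleGraph (Fin k)),
      kcount t K = ((Finset.powersetCard t (Finset.univ : Finset (Fin k))).filter
        (fun S => K.IsNClique t S)).card := by
    intro k K
    rw [kcount_eq]
    congr 1
    ext S
    simp only [Finset.mem_filter, Finset.mem_univ, true_and, Finset.mem_powersetCard,
      Finset.subset_univ]
    exact ⟨fun h => ⟨h.card_eq, h⟩, fun h => h.2⟩
  have tot : ∀ (k : ℕ) (K : SimpleGraph (Fin k)),
      kcount t K + ((Finset.powersetCard t (Finset.univ : Finset (Fin k))).filter
        (fun S => ¬ K.IsNClique t S)).card = k.choose t := by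
    intro k K
    rw [key, Finset.card_filter_add_card_filter_not]
    simp
  have hq : m * (N / m) ≤ N := Nat.mul_div_le N m
  have h1 : kcount t G * (N / m) ^ t ≤ kcount t H := by
    rw [key, key]
    refine family_lower hq φ hφ _ ?_ _ ?_
    · intro S hS
      exact (Finset.mem_powersetCard.1 (Finset.mem_filter.1 hS).1).2
    · intro T hT hTF
      simp only [Finset.mem_filter, Finset.mem_powersetCard, Finset.subset_univ, true_and]
        at hTF ⊢
      exact ⟨hT, (hcl T hT hTF.1).2 hTF.2⟩
  have h2 : ((Finset.powersetCard t (Finset.univ : Finset (Fin m))).filter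
        (fun S => ¬ G.IsNClique t S)).card * (N / m) ^ t ≤
        ((Finset.powersetCard t (Finset.univ : Finset (Fin N))).filter
        (fun S => ¬ H.IsNClique t S)).card := by
    refine family_lower hq φ hφ _ ?_ _ ?_
    · intro S hS
      exact (Finset.mem_powersetCard.1 (Finset.mem_filter.1 hS).1).2
    · intro T hT hTF
      simp only [Finset.mem_filter, Finset.mem_powersetCard, Finset.subset_univ, true_and]
        at hTF ⊢
      exact ⟨hT, fun h => hTF.2 ((hcl T hT hTF.1).1 h)⟩
  have tG := tot m G
  have tH := tot N H
  generalize ((Finset.powersetCard t (Finset.univ : Finset (Fin m))).filter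
        (fun S => ¬ G.IsNClique t S)).card = g' at *
  generalize ((Finset.powersetCard t (Finset.univ : Finset (Fin N))).filter
        (fun S => ¬ H.IsNClique t S)).card = h' at *
  have hpm : (0:ℝ) < m.choose t := by exact_mod_cast Nat.choose_pos htm
  have hpN : (0:ℝ) < N.choose t := by exact_mod_cast Nat.choose_pos (htm.trans hmN)
  have dG := dens_mem t G
  unfold dens at dG ⊢
  have h1' : (kcount t G : ℝ) * ((N / m : ℕ) : ℝ) ^ t ≤ kcount t H := by exact_mod_cast h1
  have h2' : (g' : ℝ) * ((N / m : ℕ) : ℝ) ^ t ≤ h' := by exact_mod_cast h2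
  have tG' : (kcount t G : ℝ) + g' = m.choose t := by exact_mod_cast tG
  have tH' : (kcount t H : ℝ) + h' = N.choose t := by exact_mod_cast tH
  push_cast at hr
  generalize ((N / m : ℕ) : ℝ) ^ t = Q at *
  generalize (kcount t G : ℝ) = g at *
  generalize (kcount t H : ℝ) = h at *
  generalize (m.choose t : ℝ) = M at *
  generalize (N.choose t : ℝ) = L at *
  generalize (g' : ℝ) = g' at *
  generalize (h' : ℝ) = h' at *
  set r := M * Q / L with hrdef
  have e1 : g / M * r ≤ h / L := by
    have : g / M * r = g * Q / L := by rw [hrdef]; field_simp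
    rw [this]; gcongr
  have e2 : (1 - g / M) * r ≤ 1 - h / L := by
    have a1 : 1 - g / M = g' / M := by field_simp; linarith
    have a2 : 1 - h / L = h' / L := by field_simp; linarith
    have : g' / M * r = g' * Q / L := by rw [hrdef]; field_simp
    rw [a1, a2, this]; gcongr
  obtain ⟨d0, d1⟩ := dG
  generalize g / M = d at *
  generalize h / L = d' at *
  have r1 : r ≤ 1 := by linarith
  rw [abs_le]
  constructor <;> nlinarith

theorem blow {m N s t : ℕ} (hm : 1 ≤ m) (hsm : s ≤ m) (htm : t ≤ m) (hN : m ^ 2 ≤ N)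
    (G : SimpleGraph (Fin m)) : ∃ H : SimpleGraph (Fin N),
    |dens s Hᶜ - dens s Gᶜ| ≤ (s ^ 2 + s : ℝ) / m ∧ |dens t H - dens t G| ≤ (t ^ 2 + t : ℝ) / m := by
  let φ : Fin N → Fin m := fun i => ⟨i % m, Nat.mod_lt _ (by omega)⟩
  refine ⟨G.comap φ, blow_one hm hsm hN φ (fun _ => rfl) _ _ ?_,
    blow_one hm htm hN φ (fun _ => rfl) _ _ ?_⟩
  · intro a b hab
    simp only [SimpleGraph.compl_adj, SimpleGraph.comap_adj]
    exact ⟨fun h => ⟨hab, h.2⟩, fun h => ⟨fun h' => hab (by rw [h']), h.2⟩⟩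
  · intro a b _
    rfl

theorem mem_Omega_iff (s t : ℕ) (p : ℝ × ℝ) :
    p ∈ OmegaST s t ↔ ∃ G : (n : ℕ) → SimpleGraph (Fin n),
      Tendsto (fun n => dens s (G n)ᶜ) atTop (nhds p.1) ∧
      Tendsto (fun n => dens t (G n)) atTop (nhds p.2) := Iff.rfl

theorem mem_Omega_of_approx_s12 (s t : ℕ) (p : ℝ × ℝ)
    (h : ∀ ε > 0, ∀ M : ℕ, ∃ n ≥ M, ∃ G : SimpleGraph (Fin n),
      |dens s Gᶜ - p.1| < ε ∧ |dens t G - p.2| < ε) : p ∈ OmegaST s t := by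
  have hmin : ∀ n : ℕ, ∃ H : SimpleGraph (Fin n), ∀ K : SimpleGraph (Fin n),
      max |dens s Hᶜ - p.1| |dens t H - p.2| ≤ max |dens s Kᶜ - p.1| |dens t K - p.2| := by
    intro n
    exact Finite.exists_min (fun H : SimpleGraph (Fin n) =>
      max |dens s Hᶜ - p.1| |dens t H - p.2|)
  choose H hH using hmin
  have key : ∀ ε > 0, ∃ N0, ∀ N ≥ N0, max |dens s (H N)ᶜ - p.1| |dens t (H N) - p.2| < ε := by
    intro ε hε
    obtain ⟨M0, hM0⟩ := exists_nat_gt (2 * ((s^2+s : ℝ) + (t^2+t)) / ε)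
    obtain ⟨m, hm, G, hG1, hG2⟩ := h (ε / 2) (by positivity) (M0 + s + t + 1)
    refine ⟨m ^ 2, fun N hN => ?_⟩
    obtain ⟨K, hK1, hK2⟩ := blow (by omega) (by omega) (by omega) hN G (s := s) (t := t)
    have hm0 : (0:ℝ) < m := by exact_mod_cast (by omega : 0 < m)
    have hmM : (M0 : ℝ) ≤ m := by exact_mod_cast (by omega : M0 ≤ m)
    have hb : ((s^2+s : ℝ) + (t^2+t)) / m < ε / 2 := by
      rw [div_lt_iff₀ hε] at hM0
      rw [div_lt_iff₀ hm0]
      nlinarith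
    rw [add_div] at hb
    have hs' : (0:ℝ) ≤ (s^2+s : ℝ) / m := by positivity
    have ht' : (0:ℝ) ≤ (t^2+t : ℝ) / m := by positivity
    refine (hH N K).trans_lt (max_lt ?_ ?_)
    · have := abs_sub_le (dens s Kᶜ) (dens s Gᶜ) p.1
      linarith
    · have := abs_sub_le (dens t K) (dens t G) p.2
      linarith
  rw [mem_Omega_iff]
  refine ⟨H, ?_, ?_⟩
  · rw [Metric.tendsto_atTop]
    intro ε hε
    obtain ⟨N0, h0⟩ := key ε hε
    exact ⟨N0, fun n hn => (le_max_left _ _).trans_lt (h0 n hn)⟩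
  · rw [Metric.tendsto_atTop]
    intro ε hε
    obtain ⟨N0, h0⟩ := key ε hε
    exact ⟨N0, fun n hn => (le_max_right _ _).trans_lt (h0 n hn)⟩

theorem Omega_approx (s t : ℕ) (p : ℝ × ℝ) (hp : p ∈ OmegaST s t) :
    ∀ ε > 0, ∀ M : ℕ, ∃ n ≥ M, ∃ G : SimpleGraph (Fin n),
      |dens s Gᶜ - p.1| < ε ∧ |dens t G - p.2| < ε := by
  rw [mem_Omega_iff] at hp
  obtain ⟨G, h1, h2⟩ := hp
  intro ε hε M
  rw [Metric.tendsto_atTop] at h1 h2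
  obtain ⟨N1, h1⟩ := h1 ε hε
  obtain ⟨N2, h2⟩ := h2 ε hε
  exact ⟨M + N1 + N2, by omega, G _, h1 _ (by omega), h2 _ (by omega)⟩

theorem Omega_closed (s t : ℕ) : IsClosed (OmegaST s t) := by
  rw [← isSeqClosed_iff_isClosed]
  intro u p hu hp
  apply mem_Omega_of_approx_s12
  intro ε hε M
  rw [Metric.tendsto_atTop] at hp
  obtain ⟨k, hk⟩ := hp (ε / 2) (by positivity)
  have hk := hk k le_rfl
  obtain ⟨n, hn, G, h1, h2⟩ := Omega_approx s t _ (hu k) (ε / 2) (by positivity) M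
  rw [Prod.dist_eq, max_lt_iff, Real.dist_eq, Real.dist_eq] at hk
  refine ⟨n, hn, G, ?_, ?_⟩
  · have := abs_sub_le (dens s Gᶜ) (u k).1 p.1
    linarith [hk.1]
  · have := abs_sub_le (dens t G) (u k).2 p.2
    linarith [hk.2]

theorem Omega_sub (s t : ℕ) : OmegaST s t ⊆ Set.Icc 0 1 ×ˢ Set.Icc 0 1 := by
  intro p hp
  rw [mem_Omega_iff] at hp
  obtain ⟨G, h1, h2⟩ := hp
  exact ⟨isClosed_Icc.mem_of_tendsto h1 (Eventually.of_forall fun n => dens_mem s _),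
    isClosed_Icc.mem_of_tendsto h2 (Eventually.of_forall fun n => dens_mem t _)⟩

theorem exists_limit (s t : ℕ) (H : (n : ℕ) → SimpleGraph (Fin n)) :
    ∃ p ∈ OmegaST s t, ∃ φ : ℕ → ℕ, StrictMono φ ∧
      Tendsto (fun k => dens s (H (φ k))ᶜ) atTop (nhds p.1) ∧
      Tendsto (fun k => dens t (H (φ k))) atTop (nhds p.2) := by
  have hc : IsCompact (Set.Icc (0:ℝ) 1 ×ˢ Set.Icc (0:ℝ) 1) := isCompact_Icc.prod isCompact_Icc
  obtain ⟨p, -, φ, hφ, hl⟩ := hc.tendsto_subseq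
    (x := fun n => (dens s (H n)ᶜ, dens t (H n))) (fun n => ⟨dens_mem s _, dens_mem t _⟩)
  have l1 : Tendsto (fun k => dens s (H (φ k))ᶜ) atTop (nhds p.1) :=
    (continuous_fst.tendsto p).comp hl
  have l2 : Tendsto (fun k => dens t (H (φ k))) atTop (nhds p.2) :=
    (continuous_snd.tendsto p).comp hl
  refine ⟨p, ?_, φ, hφ, l1, l2⟩
  apply mem_Omega_of_approx_s12
  intro ε hε M
  rw [Metric.tendsto_atTop] at l1 l2
  obtain ⟨N1, h1⟩ := l1 ε hε
  obtain ⟨N2, h2⟩ := l2 ε hε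
  refine ⟨φ (M + N1 + N2), ?_, H _, h1 _ (by omega), h2 _ (by omega)⟩
  have := hφ.id_le (M + N1 + N2)
  simp only [id] at this
  omega

theorem Omega_down (s t : ℕ) (hs : 2 ≤ s) {x y x' : ℝ} (hp : (x, y) ∈ OmegaST s t)
    (h0 : 0 ≤ x') (hx : x' ≤ x) : ∃ y', y ≤ y' ∧ (x', y') ∈ OmegaST s t := by
  rw [mem_Omega_iff] at hp
  obtain ⟨G, h1, h2⟩ := hp
  simp only at h1 h2
  have hex : ∀ n : ℕ, ∃ H : SimpleGraph (Fin n), s ≤ n → (G n ≤ H ∧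
      min x' (dens s (G n)ᶜ) ≤ dens s Hᶜ ∧
      dens s Hᶜ ≤ min x' (dens s (G n)ᶜ) + s / n) := by
    intro n
    by_cases hn : s ≤ n
    · obtain ⟨H, hH⟩ := exists_add_edges s hs hn (G n) (min x' (dens s (G n)ᶜ))
        (le_min h0 (dens_mem s _).1) (min_le_right _ _)
      exact ⟨H, fun _ => hH⟩
    · exact ⟨⊥, fun h => absurd h hn⟩
  choose H hH using hex
  obtain ⟨p, hp, φ, hφ, l1, l2⟩ := exists_limit s t H
  have hmin : Tendsto (fun n => min x' (dens s (G n)ᶜ)) atTop (nhds x') := by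
    have := (tendsto_const_nhds (x := x') (f := atTop)).min h1
    rwa [min_eq_left hx] at this
  have hup : Tendsto (fun n : ℕ => min x' (dens s (G n)ᶜ) + (s : ℝ) / n) atTop (nhds x') := by
    have := hmin.add (tendsto_const_div_atTop_nhds_zero_nat (s : ℝ))
    rwa [add_zero] at this
  have hev : ∀ᶠ n : ℕ in atTop, s ≤ n := eventually_ge_atTop s
  have lH : Tendsto (fun n => dens s (H n)ᶜ) atTop (nhds x') := by
    refine tendsto_of_tendsto_of_tendsto_of_le_of_le' hmin hup ?_ ?_
    · filter_upwards [hev] with n hn using (hH n hn).2.1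
    · filter_upwards [hev] with n hn using (hH n hn).2.2
  have e1 : p.1 = x' := tendsto_nhds_unique l1 (lH.comp hφ.tendsto_atTop)
  refine ⟨p.2, ?_, ?_⟩
  · refine le_of_tendsto_of_tendsto (h2.comp hφ.tendsto_atTop) l2 ?_
    filter_upwards [hφ.tendsto_atTop.eventually hev] with k hk
    exact dens_mono t (hH _ hk).1
  · rw [← e1]; exact hp

theorem choose_lower {n a s : ℕ} {c : ℝ} (hc : 0 ≤ c) (han : s ≤ n) (hsa : s ≤ a)
    (h : c * n ≤ a - s) : c ^ s ≤ (a.choose s : ℝ) / n.choose s := by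
  have hp : (0:ℝ) < n.choose s := by exact_mod_cast Nat.choose_pos han
  rw [le_div_iff₀ hp]
  have hf : (0:ℝ) < s.factorial := by exact_mod_cast s.factorial_pos
  rw [← mul_le_mul_iff_left₀ hf]
  have h1 : (n.choose s : ℝ) * s.factorial ≤ (n:ℝ) ^ s := by
    have := Nat.descFactorial_le_pow n s
    rw [Nat.descFactorial_eq_factorial_mul_choose] at this
    rw [mul_comm]
    exact_mod_cast this
  have h2 : ((a:ℝ) - s) ^ s ≤ a.choose s * s.factorial := by
    have := Nat.pow_sub_le_descFactorial a s
    rw [Nat.descFactorial_eq_factorial_mul_choose] at this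
    have h3 : (((a + 1 - s : ℕ) : ℝ)) ^ s ≤ s.factorial * a.choose s := by exact_mod_cast this
    rw [mul_comm]
    refine le_trans ?_ h3
    have : (s:ℝ) ≤ a := by exact_mod_cast hsa
    apply pow_le_pow_left₀
    · linarith
    · rw [Nat.cast_sub (by omega)]; push_cast; linarith
  calc c ^ s * n.choose s * s.factorial = c ^ s * (n.choose s * s.factorial) := by ring
    _ ≤ c ^ s * n ^ s := by gcongr
    _ = (c * n) ^ s := by rw [mul_pow]
    _ ≤ (a - s : ℝ) ^ s := by gcongr
    _ ≤ _ := h2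

theorem Omega_gain (s t : ℕ) (ht : 2 ≤ t) {x y δ : ℝ} (hp : (x, y) ∈ OmegaST s t)
    (h0 : 0 < δ) (h1 : δ < 1) : ∃ x' y', (x', y') ∈ OmegaST s t ∧
      x + (1 - x) * (δ / 2) ^ s ≤ x' ∧ y - t * δ ≤ y' := by
  rw [mem_Omega_iff] at hp
  obtain ⟨G, g1, g2⟩ := hp
  simp only at g1 g2
  obtain ⟨M0, hM0⟩ := exists_nat_gt (2 * (s + 1 : ℝ) / δ)
  have hM0' : 2 * (s + 1 : ℝ) < M0 * δ := by rwa [div_lt_iff₀ h0] at hM0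
  have hex : ∀ n : ℕ, ∃ H : SimpleGraph (Fin n), M0 + t + s ≤ n →
      (dens s (G n)ᶜ + (1 - dens s (G n)ᶜ) * (δ / 2) ^ s ≤ dens s Hᶜ ∧
      dens t (G n) - t * δ ≤ dens t H) := by
    intro n
    by_cases hn : M0 + t + s ≤ n
    · have hnM : (M0:ℝ) ≤ n := by exact_mod_cast (by omega : M0 ≤ n)
      have hn0 : (0:ℝ) < n := by exact_mod_cast (by omega : 0 < n)
      have hfl : δ * n < ⌊δ * n⌋₊ + 1 := Nat.lt_floor_add_one _
      have hfl' : (⌊δ * n⌋₊ : ℝ) ≤ δ * n := Nat.floor_le (by positivity)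
      have hMn : (M0:ℝ) * δ ≤ n * δ := by gcongr
      have hsa : s ≤ ⌊δ * n⌋₊ := by
        apply Nat.le_floor
        have : (0:ℝ) ≤ s := by positivity
        linarith
      have han : ⌊δ * n⌋₊ ≤ n := by
        have : (⌊δ * n⌋₊ : ℝ) ≤ n := hfl'.trans (by nlinarith)
        exact_mod_cast this
      obtain ⟨H, hH1, hH2⟩ := exists_isolate s t ⌊δ * n⌋₊ (by omega) (by omega) hsa han (G n)
      refine ⟨H, fun _ => ⟨le_trans ?_ hH1, ?_⟩⟩
      · have hd := (dens_mem s (G n)ᶜ).2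
        have := choose_lower (c := δ / 2) (n := n) (by positivity) (hsa.trans han) hsa (by linarith)
        have h3 : 0 ≤ 1 - dens s (G n)ᶜ := by linarith
        gcongr
      · have : (⌊δ * n⌋₊ : ℝ) * (t / n) ≤ δ * n * (t / n) := by gcongr
        have e : δ * n * (t / n) = t * δ := by field_simp
        linarith
    · exact ⟨⊥, fun h => absurd h hn⟩
  choose H hH using hex
  obtain ⟨p, hp, φ, hφ, l1, l2⟩ := exists_limit s t H
  have hev : ∀ᶠ k : ℕ in atTop, M0 + t + s ≤ φ k :=
    hφ.tendsto_atTop.eventually (eventually_ge_atTop _)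
  have k1 := g1.comp hφ.tendsto_atTop
  have k2 := g2.comp hφ.tendsto_atTop
  refine ⟨p.1, p.2, hp, ?_, ?_⟩
  · refine le_of_tendsto_of_tendsto
      (k1.add ((tendsto_const_nhds.sub k1).mul_const ((δ / 2) ^ s))) l1 ?_
    filter_upwards [hev] with k hk using (hH _ hk).1
  · refine le_of_tendsto_of_tendsto (k2.sub_const (t * δ)) l2 ?_
    filter_upwards [hev] with k hk using (hH _ hk).2

theorem fibre_nonempty (s t : ℕ) (hs : 2 ≤ s) {x : ℝ} (hx : x ∈ Set.Icc (0:ℝ) 1) :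
    ∃ y, (x, y) ∈ OmegaST s t := by
  obtain ⟨p, hp, φ, hφ, l1, l2⟩ := exists_limit s t (fun n => ⊥)
  have : p.1 = 1 := by
    refine tendsto_nhds_unique l1 (tendsto_const_nhds.congr' ?_)
    filter_upwards [hφ.tendsto_atTop.eventually (eventually_ge_atTop s)] with k hk
    rw [compl_bot, dens_top s hk]
  have hp' : (p.1, p.2) ∈ OmegaST s t := hp
  obtain ⟨y, -, hy⟩ := Omega_down s t hs hp' hx.1 (by rw [this]; exact hx.2)
  exact ⟨y, hy⟩

theorem fibre_bdd (s t : ℕ) (x : ℝ) : BddAbove {y : ℝ | (x, y) ∈ OmegaST s t} :=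
  ⟨1, fun _ hy => (Omega_sub s t hy).2.2⟩

theorem le_upper {s t : ℕ} {x y : ℝ} (h : (x, y) ∈ OmegaST s t) : y ≤ upperCurve s t x :=
  le_csSup (fibre_bdd s t x) h

theorem upper_antitone (s t : ℕ) (hs : 2 ≤ s) :
    AntitoneOn (upperCurve s t) (Set.Icc 0 1) := by
  intro a ha b hb hab
  apply csSup_le (fibre_nonempty s t hs hb)
  intro y hy
  obtain ⟨y', hyy, hy'⟩ := Omega_down s t hs hy ha.1 hab
  exact hyy.trans (le_upper hy')

theorem upper_continuous (s t : ℕ) (hs : 2 ≤ s) (ht : 2 ≤ t) :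
    ContinuousOn (upperCurve s t) (Set.Icc 0 1) := by
  intro x hx
  rw [ContinuousWithinAt, tendsto_order]
  constructor
  · intro c hc
    by_cases hx1 : x = 1
    · filter_upwards [self_mem_nhdsWithin] with z hz
      exact hc.trans_le (upper_antitone s t hs hz hx (by rw [hx1]; exact hz.2))
    have hxlt : x < 1 := lt_of_le_of_ne hx.2 hx1
    obtain ⟨δ, hδ0, hδ⟩ : ∃ δ : ℝ, 0 < δ ∧ δ < 1 ∧ c < upperCurve s t x - t * δ := by
      have ht0 : (0:ℝ) < t := by exact_mod_cast (by omega : 0 < t)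
      refine ⟨min (1/2) ((upperCurve s t x - c) / (2 * t)), ?_, ?_, ?_⟩
      · apply lt_min (by norm_num)
        apply div_pos <;> linarith
      · exact (min_le_left _ _).trans_lt (by norm_num)
      · have h1 : t * min (1/2) ((upperCurve s t x - c) / (2 * t)) ≤
          t * ((upperCurve s t x - c) / (2 * t)) := by gcongr; exact min_le_right _ _
        have h2 : t * ((upperCurve s t x - c) / (2 * t)) = (upperCurve s t x - c) / 2 := by
          field_simp
        linarith
    have hlt : x < x + (1 - x) * (δ / 2) ^ s := by
      have : 0 < (1 - x) * (δ / 2) ^ s := mul_pos (by linarith) (by positivity)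
      linarith
    filter_upwards [self_mem_nhdsWithin, mem_nhdsWithin_of_mem_nhds (Iio_mem_nhds hlt)] with z hz hz'
    refine hδ.2.trans_le ?_
    rw [sub_le_iff_le_add]
    apply csSup_le (fibre_nonempty s t hs hx)
    intro y hy
    obtain ⟨x', y', hp, h1, h2⟩ := Omega_gain s t ht hy hδ0 hδ.1
    have h3 := upper_antitone s t hs hz (Omega_sub s t hp).1 ((le_of_lt hz').trans h1)
    have h4 := le_upper hp
    linarith
  · intro c hc
    obtain ⟨d, hd, hdc⟩ := exists_between hc
    have hK : IsClosed (Prod.fst '' (OmegaST s t ∩ (Set.Icc 0 1 ×ˢ Set.Icc d 1))) := by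
      apply IsCompact.isClosed
      apply IsCompact.image _ continuous_fst
      exact (isCompact_Icc.prod isCompact_Icc).inter_left (Omega_closed s t)
    have hxK : x ∈ (Prod.fst '' (OmegaST s t ∩ (Set.Icc 0 1 ×ˢ Set.Icc d 1)))ᶜ := by
      rintro ⟨⟨a, b⟩, ⟨hp, hq⟩, rfl⟩
      exact absurd (le_upper hp) (not_le.2 (hd.trans_le hq.2.1))
    filter_upwards [self_mem_nhdsWithin,
      mem_nhdsWithin_of_mem_nhds (hK.isOpen_compl.mem_nhds hxK)] with z hz hzK
    refine lt_of_le_of_lt ?_ hdc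
    apply csSup_le (fibre_nonempty s t hs hz)
    intro y hy
    by_contra hlt
    exact hzK ⟨(z, y), ⟨hy, hz, (not_le.1 hlt).le, (Omega_sub s t hy).2.2⟩, rfl⟩

theorem upper_ae (s t : ℕ) (hs : 2 ≤ s) :
    ∀ᵐ x ∂MeasureTheory.volume, x ∈ Set.Icc (0 : ℝ) 1 →
      DifferentiableAt ℝ (upperCurve s t) x := by
  have hm : MonotoneOn (fun x => - upperCurve s t x) (Set.Icc 0 1) := (upper_antitone s t hs).neg
  have h := hm.ae_differentiableWithinAt_of_mem
  have h0 : ∀ᵐ x : ℝ ∂MeasureTheory.volume, x ≠ 0 := by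
    simp [MeasureTheory.ae_iff]
  have h1 : ∀ᵐ x : ℝ ∂MeasureTheory.volume, x ≠ 1 := by
    simp [MeasureTheory.ae_iff]
  filter_upwards [h, h0, h1] with x hx hx0 hx1 hmem
  have := (hx hmem).differentiableAt (Icc_mem_nhds (lt_of_le_of_ne hmem.1 (Ne.symm hx0))
    (lt_of_le_of_ne hmem.2 hx1))
  simpa using this.neg

/-- For all `s, t ≥ 2`, the upper bounding curve `C_{s,t}` is weakly decreasing and
continuous on `[0,1]`, and differentiable at almost every `x ∈ [0,1]`. -/
theorem upperCurve_antitone_continuous_ae_differentiable (s t : ℕ)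
    (hs : 2 ≤ s) (ht : 2 ≤ t) :
    AntitoneOn (upperCurve s t) (Set.Icc 0 1) ∧
    ContinuousOn (upperCurve s t) (Set.Icc 0 1) ∧
    (∀ᵐ x ∂MeasureTheory.volume, x ∈ Set.Icc (0 : ℝ) 1 →
      DifferentiableAt ℝ (upperCurve s t) x) :=
  ⟨upper_antitone s t hs, upper_continuous s t hs ht, upper_ae s t hs⟩
end

section
/- For every x ∈ [0,1/4], c_{3,3}(x) = 1/4 − x. That is, the minimum possible limiting density of independent triples over all sequences of graphs whose triangle density tends to x equals 1/4 − x. -/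
open Filter Topology

open Classical in
/-- indicator of adjacency -/
noncomputable def adjInd {n : ℕ} (G : SimpleGraph (Fin n)) (i j : Fin n) : ℝ :=
  if G.Adj i j then 1 else 0

noncomputable def triSum {n : ℕ} (G : SimpleGraph (Fin n)) : ℝ :=
  ∑ i, ∑ j, ∑ k, adjInd G i j * adjInd G i k * adjInd G j k

noncomputable def degR {n : ℕ} (G : SimpleGraph (Fin n)) (i : Fin n) : ℝ :=
  ∑ j, adjInd G i j

open Classical in
lemma six_kcount {n : ℕ} (G : SimpleGraph (Fin n)) :
    (6 * kcount 3 G : ℝ) = triSum G := by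
  have h1 : kcount 3 G = (Finset.univ.filter (fun s : Finset (Fin n) => G.IsNClique 3 s)).card := by
    rw [kcount, Nat.card_eq_fintype_card, Fintype.card_subtype]
  have h2 : triSum G = ((Finset.univ.filter (fun p : Fin n × Fin n × Fin n =>
      G.Adj p.1 p.2.1 ∧ G.Adj p.1 p.2.2 ∧ G.Adj p.2.1 p.2.2)).card : ℝ) := by
    rw [Finset.card_filter]
    push_cast
    rw [Fintype.sum_prod_type]
    simp_rw [Fintype.sum_prod_type]
    unfold triSum adjInd
    refine Finset.sum_congr rfl fun i _ => Finset.sum_congr rfl fun j _ =>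
      Finset.sum_congr rfl fun k _ => ?_
    by_cases a : G.Adj i j <;> by_cases b : G.Adj i k <;> by_cases c : G.Adj j k <;> simp [a, b, c]
  rw [h2, h1]
  rw [Finset.card_eq_sum_card_fiberwise (f := fun p : Fin n × Fin n × Fin n =>
      ({p.1, p.2.1, p.2.2} : Finset (Fin n)))
      (t := Finset.univ.filter (fun s : Finset (Fin n) => G.IsNClique 3 s))]
  · rw [Finset.sum_congr rfl (g := fun _ => 6)]
    · simp [mul_comm]
    · intro s hs
      rw [Finset.mem_filter] at hs
      obtain ⟨a, b, c, hab, hac, hbc, rfl⟩ := SimpleGraph.is3Clique_iff.1 hs.2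
      have e : (Finset.filter (fun p : Fin n × Fin n × Fin n =>
          ({p.1, p.2.1, p.2.2} : Finset (Fin n)) = {a, b, c})
          (Finset.univ.filter (fun p : Fin n × Fin n × Fin n =>
          G.Adj p.1 p.2.1 ∧ G.Adj p.1 p.2.2 ∧ G.Adj p.2.1 p.2.2))) =
          {(a, b, c), (a, c, b), (b, a, c), (b, c, a), (c, a, b), (c, b, a)} := by
        ext ⟨i, j, k⟩
        simp only [Finset.mem_filter, Finset.mem_univ, true_and, Finset.mem_insert,
          Finset.mem_singleton, Prod.mk.injEq]
        constructor
        · rintro ⟨⟨h1, h2, h3⟩, h⟩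
          have hi : i ∈ ({a, b, c} : Finset (Fin n)) := by rw [← h]; simp
          have hj : j ∈ ({a, b, c} : Finset (Fin n)) := by rw [← h]; simp
          have hk : k ∈ ({a, b, c} : Finset (Fin n)) := by rw [← h]; simp
          simp only [Finset.mem_insert, Finset.mem_singleton] at hi hj hk
          have := h1.ne
          have := h2.ne
          have := h3.ne
          grind
        · have := hab.symm
          have := hac.symm
          have := hbc.symm
          rintro (⟨rfl, rfl, rfl⟩ | ⟨rfl, rfl, rfl⟩ | ⟨rfl, rfl, rfl⟩ | ⟨rfl, rfl, rfl⟩ |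
            ⟨rfl, rfl, rfl⟩ | ⟨rfl, rfl, rfl⟩) <;> refine ⟨⟨?_, ?_, ?_⟩, ?_⟩ <;>
            first | assumption | (ext z; simp; try tauto)
      rw [e]
      have := hab.ne
      have := hac.ne
      have := hbc.ne
      rw [Finset.card_eq_of_equiv_fin]
      have : ([(a, b, c), (a, c, b), (b, a, c), (b, c, a), (c, a, b), (c, b, a)] :
        List (Fin n × Fin n × Fin n)).Nodup := by
        simp; grind
      have h6 := List.toFinset_card_of_nodup this
      simp only [List.toFinset_cons, List.toFinset_nil, List.length] at h6
      exact Finset.equivFinOfCardEq h6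
  · intro p hp
    simp only [Finset.coe_filter, Finset.mem_univ, true_and, Set.mem_ofPred_eq] at hp ⊢
    exact SimpleGraph.is3Clique_iff.2 ⟨_, _, _, hp.1, hp.2.1, hp.2.2, rfl⟩

lemma adjInd_compl {n : ℕ} (G : SimpleGraph (Fin n)) (i j : Fin n) :
    adjInd Gᶜ i j = 1 - (if i = j then 1 else 0) - adjInd G i j := by
  unfold adjInd
  by_cases h : i = j
  · subst h; simp
  · by_cases h' : G.Adj i j <;> simp [h, h']

lemma adjInd_comm {n : ℕ} (G : SimpleGraph (Fin n)) (i j : Fin n) :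
    adjInd G i j = adjInd G j i := by
  unfold adjInd
  by_cases h : G.Adj i j
  · simp [h, h.symm]
  · have h2 : ¬ G.Adj j i := fun h' => h (SimpleGraph.Adj.symm h')
    simp [h, h2]

lemma adjInd_self {n : ℕ} (G : SimpleGraph (Fin n)) (i : Fin n) :
    adjInd G i i = 0 := by
  simp [adjInd]

lemma adjInd_cases {n : ℕ} (G : SimpleGraph (Fin n)) (i j : Fin n) :
    adjInd G i j = 0 ∨ adjInd G i j = 1 := by
  unfold adjInd
  split_ifs <;> simp

lemma deg_compl {n : ℕ} (G : SimpleGraph (Fin n)) (i : Fin n) :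
    degR Gᶜ i = n - 1 - degR G i := by
  have := adjInd_compl G i
  unfold degR
  simp_rw [this]
  simp [Finset.sum_sub_distrib]

lemma goodman {n : ℕ} (G : SimpleGraph (Fin n)) :
    triSum G + triSum Gᶜ + 3 * ∑ i, degR G i * (n - 1 - degR G i) = n * (n - 1) * (n - 2) := by
  have key : ∀ i j k : Fin n,
      (1 - (if i = j then (1:ℝ) else 0)) * (1 - (if i = k then (1:ℝ) else 0)) *
        (1 - (if j = k then (1:ℝ) else 0)) =
      adjInd G i j * adjInd G i k * adjInd G j k + adjInd Gᶜ i j * adjInd Gᶜ i k * adjInd Gᶜ j k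
      + (1 / 2) * ((adjInd G i j * adjInd Gᶜ i k + adjInd G i k * adjInd Gᶜ i j)
        + (adjInd G j i * adjInd Gᶜ j k + adjInd G j k * adjInd Gᶜ j i)
        + (adjInd G k i * adjInd Gᶜ k j + adjInd G k j * adjInd Gᶜ k i)) := by
    intro i j k
    rw [adjInd_comm G j i, adjInd_comm G k i, adjInd_comm G k j,
      adjInd_comm Gᶜ j i, adjInd_comm Gᶜ k i, adjInd_comm Gᶜ k j]
    simp only [adjInd_compl]
    by_cases h1 : i = j
    · subst h1
      by_cases h2 : i = k
      · subst h2; simp [adjInd_self]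
      · rcases adjInd_cases G i k with a | a <;> simp [h2, a, adjInd_self]
    · by_cases h2 : i = k
      · subst h2
        rcases adjInd_cases G i j with a | a <;>
          simp [h1, a, adjInd_self, adjInd_comm G j i, Ne.symm h1]
      · by_cases h3 : j = k
        · subst h3
          rcases adjInd_cases G i j with a | a <;> simp [h1, a, adjInd_self]
        · rcases adjInd_cases G i j with a | a <;> rcases adjInd_cases G i k with b | b <;>
            rcases adjInd_cases G j k with c | c <;>
            simp [h1, h2, h3, a, b, c] <;> norm_num
  have hs := Finset.sum_congr (rfl : (Finset.univ : Finset (Fin n)) = Finset.univ)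
    fun i _ => Finset.sum_congr (rfl : (Finset.univ : Finset (Fin n)) = Finset.univ)
    fun j _ => Finset.sum_congr (rfl : (Finset.univ : Finset (Fin n)) = Finset.univ)
    fun k _ => key i j k
  have hM : ∀ (f g : Fin n → ℝ), ∑ j, ∑ k, (f j * g k + f k * g j) =
      2 * ((∑ j, f j) * ∑ k, g k) := by
    intro f g
    simp_rw [Finset.sum_add_distrib]
    rw [Finset.sum_comm (f := fun j k => f k * g j), Finset.sum_mul_sum]
    ring
  have e1 : ∑ i : Fin n, ∑ j, ∑ k, (adjInd G i j * adjInd Gᶜ i k + adjInd G i k * adjInd Gᶜ i j)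
      = 2 * ∑ i, degR G i * (n - 1 - degR G i) := by
    simp_rw [hM, ← Finset.mul_sum]
    congr 1
    refine Finset.sum_congr rfl fun i _ => ?_
    rw [← deg_compl]; rfl
  have e2 : ∑ i : Fin n, ∑ j, ∑ k, (adjInd G j i * adjInd Gᶜ j k + adjInd G j k * adjInd Gᶜ j i)
      = 2 * ∑ i, degR G i * (n - 1 - degR G i) := by
    rw [Finset.sum_comm, e1]
  have e3 : ∑ i : Fin n, ∑ j, ∑ k, (adjInd G k i * adjInd Gᶜ k j + adjInd G k j * adjInd Gᶜ k i)
      = 2 * ∑ i, degR G i * (n - 1 - degR G i) := by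
    rw [← e1]
    simp_rw [Finset.sum_comm (s := Finset.univ) (t := Finset.univ)
      (f := fun j k => adjInd G k _ * adjInd Gᶜ k j + adjInd G k j * adjInd Gᶜ k _)]
    rw [Finset.sum_comm]
  have e0 : ∑ i : Fin n, ∑ j : Fin n, ∑ k : Fin n,
      (1 - (if i = j then (1:ℝ) else 0)) * (1 - (if i = k then (1:ℝ) else 0)) *
        (1 - (if j = k then (1:ℝ) else 0)) = n * (n - 1) * (n - 2) := by
    have : ∀ i j : Fin n, ∑ k : Fin n,
      (1 - (if i = j then (1:ℝ) else 0)) * (1 - (if i = k then (1:ℝ) else 0)) *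
        (1 - (if j = k then (1:ℝ) else 0)) = (1 - (if i = j then (1:ℝ) else 0)) * (n - 2) := by
      intro i j
      by_cases h : i = j
      · simp [h]
      · have : ∀ k : Fin n, (1 - (if i = k then (1:ℝ) else 0)) *
          (1 - (if j = k then (1:ℝ) else 0)) = 1 - (if i = k then (1:ℝ) else 0)
            - (if j = k then (1:ℝ) else 0) := by
          intro k
          by_cases h1 : i = k
          · subst h1; simp [Ne.symm h]
          · simp [h1]
        simp only [h, if_false, sub_zero, one_mul, this, Finset.sum_sub_distrib]
        simp
        ring
    simp_rw [this, ← Finset.sum_mul, Finset.sum_sub_distrib]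
    simp
    left
    ring
  rw [e0] at hs
  simp_rw [Finset.sum_add_distrib, ← Finset.mul_sum, Finset.sum_add_distrib] at hs
  simp_rw [Finset.sum_add_distrib] at e1 e2 e3
  unfold triSum
  linarith

lemma choose3 (n : ℕ) : (6 * n.choose 3 : ℝ) = n * (n - 1) * (n - 2) := by
  have : ∀ n : ℕ, (6 * n.choose 3 : ℝ) = n * (n - 1) * (n - 2) := by
    intro n
    induction n with
    | zero => simp
    | succ k ih =>
      rw [Nat.choose_succ_succ' k 2]
      push_cast
      rw [mul_add, ih, Nat.cast_choose_two]
      ring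
  exact this n

lemma dens_eq {n : ℕ} (G : SimpleGraph (Fin n)) :
    (kcount 3 G : ℝ) / (n.choose 3 : ℝ) = triSum G / (n * (n - 1) * (n - 2)) := by
  rw [← six_kcount, ← choose3]
  rw [mul_div_mul_left _ _ (by norm_num)]

/-- the interpolating graph -/
def inH (n k u : ℕ) : Prop := u < k ∨ n ≤ u + k

def Gk (n k : ℕ) : SimpleGraph (Fin n) where
  Adj u v := u ≠ v ∧ (((u : ℕ) < n / 2 ↔ (v : ℕ) < n / 2) ↔ (inH n k u ∧ inH n k v))
  symm := ⟨by intro u v h; refine ⟨h.1.symm, ?_⟩; have := h.2; tauto⟩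
  loopless := ⟨by intro u h; exact h.1 rfl⟩

open Classical in
lemma deg_Gk (n k : ℕ) (hk : k ≤ n / 2) (v : Fin n) :
    |degR (Gk n k) v - (n - 1) / 2| ≤ 1 := by
  have h0 : degR (Gk n k) v = (((Finset.range n).filter (fun u => (v : ℕ) ≠ u ∧
      (((v : ℕ) < n / 2 ↔ u < n / 2) ↔ (inH n k v ∧ inH n k u)))).card : ℝ) := by
    rw [Finset.card_filter]
    push_cast
    rw [← Fin.sum_univ_eq_sum_range (fun u => if ((v : ℕ) ≠ u ∧
      (((v : ℕ) < n / 2 ↔ u < n / 2) ↔ (inH n k v ∧ inH n k u))) then (1:ℝ) else 0)]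
    unfold degR adjInd Gk
    simp only [ne_eq, Fin.ext_iff]
  have hv := v.2
  set w : ℕ := (v : ℕ) with hw
  have hdisj : ∀ a b c d : ℕ, b ≤ c → Disjoint (Finset.Ico a b) (Finset.Ico c d) := by
    intro a b c d h
    rw [Finset.disjoint_left]
    intro x
    simp only [Finset.mem_Ico]
    omega
  obtain ⟨d, hd, hd1, hd2⟩ : ∃ d : ℕ, degR (Gk n k) v = d ∧ n ≤ 2 * d + 3 ∧ 2 * d ≤ n + 1 := by
    refine ⟨_, h0, ?_⟩
    by_cases hA : w < n / 2 <;> by_cases hH : inH n k w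
    · have : (Finset.range n).filter (fun u => w ≠ u ∧
          ((w < n / 2 ↔ u < n / 2) ↔ (inH n k w ∧ inH n k u))) =
          (Finset.Ico 0 k ∪ Finset.Ico (n / 2) (n - k)).erase w := by
        ext u
        simp only [Finset.mem_filter, Finset.mem_range, Finset.mem_erase, Finset.mem_union,
          Finset.mem_Ico, hA, hH, true_iff, true_and]
        unfold inH at *
        omega
      rw [this, Finset.card_erase_of_mem, Finset.card_union_of_disjoint (hdisj _ _ _ _ hk)]
      · simp only [Nat.card_Ico]; omega
      · simp only [Finset.mem_union, Finset.mem_Ico]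
        unfold inH at *
        omega
    · have : (Finset.range n).filter (fun u => w ≠ u ∧
          ((w < n / 2 ↔ u < n / 2) ↔ (inH n k w ∧ inH n k u))) =
          Finset.Ico (n / 2) n := by
        ext u
        simp only [Finset.mem_filter, Finset.mem_range, 
          Finset.mem_Ico, hA, hH, true_iff, false_and, iff_false]
        omega
      rw [this]
      simp only [Nat.card_Ico]; omega
    · have : (Finset.range n).filter (fun u => w ≠ u ∧
          ((w < n / 2 ↔ u < n / 2) ↔ (inH n k w ∧ inH n k u))) =
          (Finset.Ico k (n / 2) ∪ Finset.Ico (n - k) n).erase w := by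
        ext u
        simp only [Finset.mem_filter, Finset.mem_range, Finset.mem_erase, Finset.mem_union,
          Finset.mem_Ico, hA, hH, false_iff, true_and]
        unfold inH at *
        omega
      rw [this, Finset.card_erase_of_mem, Finset.card_union_of_disjoint
        (hdisj _ _ _ _ (by omega))]
      · simp only [Nat.card_Ico]; omega
      · simp only [Finset.mem_union, Finset.mem_Ico]
        unfold inH at *
        omega
    · have : (Finset.range n).filter (fun u => w ≠ u ∧
          ((w < n / 2 ↔ u < n / 2) ↔ (inH n k w ∧ inH n k u))) =
          Finset.Ico 0 (n / 2) := by
        ext u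
        simp only [Finset.mem_filter, Finset.mem_range, 
          Finset.mem_Ico, hA, hH, false_iff, false_and, iff_false]
        omega
      rw [this]
      simp only [Nat.card_Ico]; omega
  rw [hd, abs_le]
  have a1 : (n : ℝ) ≤ 2 * d + 3 := by exact_mod_cast hd1
  have a2 : (2 * d : ℝ) ≤ n + 1 := by exact_mod_cast hd2
  constructor <;> linarith

lemma adjInd_eq_zero {n : ℕ} {G : SimpleGraph (Fin n)} {i j : Fin n} (h : ¬ G.Adj i j) :
    adjInd G i j = 0 := by simp [adjInd, h]

lemma triSum_zero {n : ℕ} {G : SimpleGraph (Fin n)}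
    (h : ∀ i j k, G.Adj i j → G.Adj i k → G.Adj j k → False) : triSum G = 0 := by
  refine Finset.sum_eq_zero fun i _ => Finset.sum_eq_zero fun j _ => Finset.sum_eq_zero fun k _ => ?_
  by_cases a : G.Adj i j
  · by_cases b : G.Adj i k
    · rw [adjInd_eq_zero (fun c => h i j k a b c), mul_zero]
    · rw [adjInd_eq_zero b]; ring
  · rw [adjInd_eq_zero a]; ring

lemma triSum_Gk_zero (n : ℕ) : triSum (Gk n 0) = 0 := by
  apply triSum_zero
  intro i j k
  have := i.2
  have := j.2
  have := k.2
  simp only [Gk, inH, ne_eq, Fin.ext_iff]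
  omega

lemma triSum_Gk_top (n : ℕ) : triSum (Gk n (n / 2))ᶜ = 0 := by
  apply triSum_zero
  intro i j k
  have := i.2
  have := j.2
  have := k.2
  simp only [SimpleGraph.compl_adj, Gk, inH, ne_eq, Fin.ext_iff]
  omega

lemma triSum_step (n k : ℕ) (hk : k + 1 ≤ n / 2) :
    triSum (Gk n k)ᶜ ≤ triSum (Gk n (k + 1))ᶜ + 6 * n ^ 2 := by
  have h1 : k < n := by omega
  have h2 : n - 1 - k < n := by omega
  set p : Fin n := ⟨k, h1⟩ with hp
  set q : Fin n := ⟨n - 1 - k, h2⟩ with hq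
  let δ : Fin n → ℝ := fun i => (if p = i then 1 else 0) + (if q = i then 1 else 0)
  have hδ0 : ∀ i, 0 ≤ δ i := by
    intro i; simp only [δ]; split_ifs <;> norm_num
  have hδ1 : ∀ i, ¬ (i ≠ p ∧ i ≠ q) → 1 ≤ δ i := by
    intro i hi
    simp only [δ]
    by_cases a : p = i
    · simp only [a, if_true]; split_ifs <;> norm_num
    · have : q = i := by by_contra b; exact hi ⟨fun h => a h.symm, fun h => b h.symm⟩
      simp only [this, if_true]; split_ifs <;> norm_num
  have hH : ∀ i : Fin n, (i ≠ p ∧ i ≠ q) → (inH n k i ↔ inH n (k + 1) i) := by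
    intro i
    have := i.2
    simp only [hp, hq, ne_eq, Fin.ext_iff, inH]
    omega
  have hadj : ∀ i j : Fin n, (i ≠ p ∧ i ≠ q) → (j ≠ p ∧ j ≠ q) →
      adjInd (Gk n k)ᶜ i j = adjInd (Gk n (k + 1))ᶜ i j := by
    intro i j hi hj
    have : (Gk n k)ᶜ.Adj i j ↔ (Gk n (k + 1))ᶜ.Adj i j := by
      simp only [SimpleGraph.compl_adj, Gk, hH i hi, hH j hj]
    unfold adjInd
    by_cases h : (Gk n k)ᶜ.Adj i j
    · rw [if_pos h, if_pos (this.1 h)]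
    · rw [if_neg h, if_neg (fun h' => h (this.2 h'))]
  have h01 : ∀ (G : SimpleGraph (Fin n)) i j, 0 ≤ adjInd G i j ∧ adjInd G i j ≤ 1 := by
    intro G i j
    unfold adjInd
    split_ifs <;> norm_num
  have hδs : ∑ i, δ i = 2 := by
    simp only [δ, Finset.sum_add_distrib]
    simp; norm_num
  have hpt : ∀ i j l, adjInd (Gk n k)ᶜ i j * adjInd (Gk n k)ᶜ i l * adjInd (Gk n k)ᶜ j l ≤
      adjInd (Gk n (k+1))ᶜ i j * adjInd (Gk n (k+1))ᶜ i l * adjInd (Gk n (k+1))ᶜ j l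
      + (δ i + δ j + δ l) := by
    intro i j l
    have u1 := hδ0 i
    have u2 := hδ0 j
    have u3 := hδ0 l
    by_cases hall : (i ≠ p ∧ i ≠ q) ∧ (j ≠ p ∧ j ≠ q) ∧ (l ≠ p ∧ l ≠ q)
    · rw [hadj i j hall.1 hall.2.1, hadj i l hall.1 hall.2.2, hadj j l hall.2.1 hall.2.2]
      linarith
    · have g1 : adjInd (Gk n k)ᶜ i j * adjInd (Gk n k)ᶜ i l * adjInd (Gk n k)ᶜ j l ≤ 1 :=
        mul_le_one₀ (mul_le_one₀ (h01 _ _ _).2 (h01 _ _ _).1 (h01 _ _ _).2) (h01 _ _ _).1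
          (h01 _ _ _).2
      have g2 : 0 ≤ adjInd (Gk n (k+1))ᶜ i j * adjInd (Gk n (k+1))ᶜ i l *
          adjInd (Gk n (k+1))ᶜ j l :=
        mul_nonneg (mul_nonneg (h01 _ _ _).1 (h01 _ _ _).1) (h01 _ _ _).1
      have g3 : 1 ≤ δ i + δ j + δ l := by
        by_cases a : i ≠ p ∧ i ≠ q
        · by_cases b : j ≠ p ∧ j ≠ q
          · have := hδ1 l (fun c => hall ⟨a, b, c⟩); linarith
          · have := hδ1 j b; linarith
        · have := hδ1 i a; linarith
      linarith
  have hsum := Finset.sum_le_sum fun i (_ : i ∈ Finset.univ) =>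
    Finset.sum_le_sum fun j (_ : j ∈ Finset.univ) =>
    Finset.sum_le_sum fun l (_ : l ∈ Finset.univ) => hpt i j l
  simp only [Finset.sum_add_distrib, Finset.sum_const, Finset.card_univ, Fintype.card_fin,
    nsmul_eq_mul, ← Finset.mul_sum, hδs] at hsum
  unfold triSum
  linarith

lemma goodman_lower {n : ℕ} (G : SimpleGraph (Fin n)) :
    (n : ℝ) * (n - 1) * (n - 2) - 3 / 4 * (n * (n - 1) ^ 2) ≤ triSum G + triSum Gᶜ := by
  have h := goodman G
  have : ∑ i, degR G i * (n - 1 - degR G i) ≤ ∑ i : Fin n, ((n : ℝ) - 1) ^ 2 / 4 :=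
    Finset.sum_le_sum fun i _ => by nlinarith [sq_nonneg (degR G i - (n - 1) / 2)]
  simp at this
  linarith

lemma goodman_upper {n k : ℕ} (hk : k ≤ n / 2) :
    triSum (Gk n k) + triSum (Gk n k)ᶜ ≤
      (n : ℝ) * (n - 1) * (n - 2) - 3 / 4 * (n * (n - 1) ^ 2) + 3 * n := by
  have h := goodman (Gk n k)
  have : ∑ i : Fin n, (((n : ℝ) - 1) ^ 2 / 4 - 1) ≤
      ∑ i, degR (Gk n k) i * (n - 1 - degR (Gk n k) i) :=
    Finset.sum_le_sum fun i _ => by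
      have := (sq_le_one_iff_abs_le_one _).2 (deg_Gk n k hk i)
      nlinarith
  simp at this
  linarith

lemma exists_k (n : ℕ) (x : ℝ) (hx0 : 0 ≤ x) (hx : x ≤ 1 / 4) (hn : 3 ≤ n) :
    ∃ k ≤ n / 2, triSum (Gk n k)ᶜ ≤ x * (n * (n - 1) * (n - 2)) ∧
      x * (n * (n - 1) * (n - 2)) - 6 * n ^ 2 ≤ triSum (Gk n k)ᶜ := by
  classical
  have hn' : (3 : ℝ) ≤ n := by exact_mod_cast hn
  have hN : (0 : ℝ) ≤ n * (n - 1) * (n - 2) :=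
    mul_nonneg (mul_nonneg (by linarith) (by linarith)) (by linarith)
  have hex : ∃ k, triSum (Gk n k)ᶜ ≤ x * (n * (n - 1) * (n - 2)) :=
    ⟨n / 2, by rw [triSum_Gk_top]; positivity⟩
  have hle : Nat.find hex ≤ n / 2 := Nat.find_min' hex (by rw [triSum_Gk_top]; positivity)
  refine ⟨Nat.find hex, hle, Nat.find_spec hex, ?_⟩
  rcases h : Nat.find hex with _ | k
  · have := goodman_lower (Gk n 0)
    rw [triSum_Gk_zero] at this
    have : x * (n * (n - 1) * (n - 2)) ≤ 1 / 4 * (n * (n - 1) * (n - 2) : ℝ) :=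
      mul_le_mul_of_nonneg_right hx hN
    nlinarith
  · have h1 := Nat.find_min hex (m := k) (by omega)
    have h2 := triSum_step n k (by omega)
    push Not at h1
    linarith

lemma tend_lower : Tendsto (fun n : ℕ => ((n : ℝ) * (n - 1) * (n - 2) - 3 / 4 * (n * (n - 1) ^ 2)) /
    (n * (n - 1) * (n - 2))) atTop (𝓝 (1 / 4)) := by
  have h : Tendsto (fun n : ℕ => (1 / 4 : ℝ) - 3 / 4 * ((n : ℝ) - 2)⁻¹) atTop
      (𝓝 (1 / 4 - 3 / 4 * 0)) := by
    refine tendsto_const_nhds.sub (Tendsto.const_mul _ ?_)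
    exact tendsto_inv_atTop_zero.comp (tendsto_atTop_add_const_right _ _
      tendsto_natCast_atTop_atTop)
  rw [mul_zero, sub_zero] at h
  refine h.congr' ?_
  filter_upwards [eventually_ge_atTop 3] with n hn
  have hn' : (3 : ℝ) ≤ n := by exact_mod_cast hn
  have : (n : ℝ) - 1 ≠ 0 := by linarith
  have : (n : ℝ) - 2 ≠ 0 := by linarith
  have : (n : ℝ) ≠ 0 := by linarith
  field_simp
  ring

lemma tend_err : Tendsto (fun n : ℕ => (6 * (n : ℝ) ^ 2) / (n * (n - 1) * (n - 2))) atTop (𝓝 0) := by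
  have h : Tendsto (fun n : ℕ => 12 * ((n : ℝ) - 2)⁻¹) atTop (𝓝 (12 * 0)) := by
    refine Tendsto.const_mul _ ?_
    exact tendsto_inv_atTop_zero.comp (tendsto_atTop_add_const_right _ _
      tendsto_natCast_atTop_atTop)
  rw [mul_zero] at h
  refine squeeze_zero' ?_ ?_ h
  · filter_upwards [eventually_ge_atTop 3] with n hn
    have hn' : (3 : ℝ) ≤ n := by exact_mod_cast hn
    exact div_nonneg (by positivity)
      (mul_nonneg (mul_nonneg (by linarith) (by linarith)) (by linarith))
  · filter_upwards [eventually_ge_atTop 3] with n hn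
    have hn' : (3 : ℝ) ≤ n := by exact_mod_cast hn
    have h2 : (0 : ℝ) < n - 2 := by linarith
    have h1 : (0 : ℝ) < n - 1 := by linarith
    have h0 : (0 : ℝ) < n := by linarith
    rw [← div_eq_mul_inv, div_le_div_iff₀ (by positivity) h2]
    have : 6 * (n : ℝ) ^ 2 ≤ 12 * (n * (n - 1)) := by nlinarith
    nlinarith [mul_le_mul_of_nonneg_right this h2.le]

lemma lower_bound {x y : ℝ} (h : (x, y) ∈ OmegaST 3 3) : 1 / 4 - x ≤ y := by
  obtain ⟨G, h1, h2⟩ := h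
  simp_rw [dens_eq] at h1 h2
  have := le_of_tendsto_of_tendsto tend_lower (h2.add h1) (by
    filter_upwards [eventually_ge_atTop 3] with n hn
    have hn' : (3 : ℝ) ≤ n := by exact_mod_cast hn
    rw [← add_div]
    exact div_le_div_of_nonneg_right (goodman_lower (G n))
      (mul_nonneg (mul_nonneg (by linarith) (by linarith)) (by linarith)))
  linarith

lemma attained (x : ℝ) (hx : x ∈ Set.Icc (0 : ℝ) (1 / 4)) : (x, 1 / 4 - x) ∈ OmegaST 3 3 := by
  have hk : ∀ n : ℕ, ∃ k, 3 ≤ n → k ≤ n / 2 ∧ triSum (Gk n k)ᶜ ≤ x * (n * (n - 1) * (n - 2)) ∧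
      x * (n * (n - 1) * (n - 2)) - 6 * n ^ 2 ≤ triSum (Gk n k)ᶜ := by
    intro n
    by_cases hn : 3 ≤ n
    · obtain ⟨k, h⟩ := exists_k n x hx.1 hx.2 hn
      exact ⟨k, fun _ => h⟩
    · exact ⟨0, fun h => absurd h hn⟩
  choose k hk using hk
  have hpos : ∀ n : ℕ, 3 ≤ n → (0 : ℝ) < n * (n - 1) * (n - 2) := by
    intro n hn
    have hn' : (3 : ℝ) ≤ n := by exact_mod_cast hn
    exact mul_pos (mul_pos (by linarith) (by linarith)) (by linarith)
  have t1 : Tendsto (fun n : ℕ => triSum (Gk n (k n))ᶜ / ((n : ℝ) * (n - 1) * (n - 2)))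
      atTop (𝓝 x) := by
    have hl := (tendsto_const_nhds (x := x)).sub tend_err
    rw [sub_zero] at hl
    refine tendsto_of_tendsto_of_tendsto_of_le_of_le' hl tendsto_const_nhds ?_ ?_
    · filter_upwards [eventually_ge_atTop 3] with n hn
      have hp := hpos n hn
      rw [le_div_iff₀ hp, sub_mul, div_mul_cancel₀ _ hp.ne']
      exact (hk n hn).2.2
    · filter_upwards [eventually_ge_atTop 3] with n hn
      have hp := hpos n hn
      rw [div_le_iff₀ hp]
      exact (hk n hn).2.1
  have t2 : Tendsto (fun n : ℕ => (triSum (Gk n (k n)) + triSum (Gk n (k n))ᶜ) /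
      ((n : ℝ) * (n - 1) * (n - 2))) atTop (𝓝 (1 / 4)) := by
    have hu := tend_lower.add tend_err
    rw [add_zero] at hu
    refine tendsto_of_tendsto_of_tendsto_of_le_of_le' tend_lower hu ?_ ?_
    · filter_upwards [eventually_ge_atTop 3] with n hn
      exact div_le_div_of_nonneg_right (goodman_lower _) (hpos n hn).le
    · filter_upwards [eventually_ge_atTop 3] with n hn
      rw [← add_div]
      refine div_le_div_of_nonneg_right ((goodman_upper (hk n hn).1).trans ?_) (hpos n hn).le
      have hn' : (3 : ℝ) ≤ n := by exact_mod_cast hn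
      nlinarith
  refine ⟨fun n => Gk n (k n), ?_, ?_⟩
  · simp_rw [dens_eq]
    exact t1
  · simp_rw [dens_eq]
    refine (t2.sub t1).congr fun n => ?_
    rw [← sub_div, add_sub_cancel_right]

/-- `c_{3,3}(x) = 1/4 − x` for all `x ∈ [0, 1/4]`: the minimum possible limiting density
of independent triples over sequences of graphs whose triangle density tends to `x`
equals `1/4 − x`. (Here, by symmetry of the two roles, the first coordinate of
`OmegaST 3 3` plays the role of the prescribed density `x`.) -/
theorem c33_curve_linear (x : ℝ) (hx : x ∈ Set.Icc (0 : ℝ) (1 / 4)) :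
    sInf {y : ℝ | (x, y) ∈ OmegaST 3 3} = 1 / 4 - x := by
  apply le_antisymm
  · exact csInf_le ⟨1 / 4 - x, fun y hy => lower_bound hy⟩ (attained x hx)
  · exact le_csInf ⟨_, attained x hx⟩ fun y hy => lower_bound hy
end
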